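/- Let N ≥ 1, m > 1, q ∈ (0,1), σ ≥ 2(1−q)/(m−1), a > σ/(1−q) and A_0 > 0. Then there exists M > 0, depending only on m, a, N, q, σ and A_0, such that: for every non-negative u_0 ∈ L^∞(ℝ^N) satisfying u_0(x) ≤ A_0|x|^a for a.e. x ∈ ℝ^N and ‖u_0‖_∞ ≤ M, every non-negative weak solution u of ∂_t u = Δ(u^m) − |x|^σ u^q with u(0) = u_0 vanishes in finite time. -/

import Mathlib

open MeasureTheory Set

noncomputable section

/-- A non-negative weak solution of `∂ₜ u = Δ(uᵐ) − w(x) u^q` on `(0,∞)×ℝᴺ`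
with initial condition `u₀`, in the sense of Definition 1.1 of the paper:
`u` is a bounded non-negative measurable function, and there is a measurable
vector field `g` (the weak spatial gradient of `uᵐ`) which is locally square
integrable on `(0,T)×ℝᴺ`, satisfies the weak derivative identity against test
functions in `C_c^1((0,T)×ℝᴺ)`, and satisfies the weak formulation of the
equation against test functions in `C_c^1([0,T)×ℝᴺ)`. -/
def IsWeakSolution (N : ℕ) (m q : ℝ) (w : EuclideanSpace ℝ (Fin N) → ℝ)
    (u0 : EuclideanSpace ℝ (Fin N) → ℝ)
    (u : ℝ → EuclideanSpace ℝ (Fin N) → ℝ) : Prop :=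
  Measurable (Function.uncurry u) ∧
  (∀ t x, 0 ≤ u t x) ∧
  (∃ C : ℝ, ∀ t x, u t x ≤ C) ∧
  ∃ g : ℝ → EuclideanSpace ℝ (Fin N) → EuclideanSpace ℝ (Fin N),
    Measurable (Function.uncurry g) ∧
    ∀ T > (0:ℝ),
      (∀ K : Set (EuclideanSpace ℝ (Fin N)), IsCompact K →
        ∫⁻ s in Ioo (0:ℝ) T, ∫⁻ x in K, ENNReal.ofReal (‖g s x‖ ^ 2) < ⊤) ∧
      (∀ ζ : ℝ × EuclideanSpace ℝ (Fin N) → ℝ, ContDiff ℝ 1 ζ →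
        HasCompactSupport ζ → (∀ s x, s ∉ Ioo (0:ℝ) T → ζ (s, x) = 0) →
        ∀ i : Fin N,
          (∫ s in Ioo (0:ℝ) T, ∫ x,
              (u s x) ^ m * fderiv ℝ ζ (s, x) (0, EuclideanSpace.single i 1))
            = - ∫ s in Ioo (0:ℝ) T, ∫ x, g s x i * ζ (s, x)) ∧
      (∀ ζ : ℝ × EuclideanSpace ℝ (Fin N) → ℝ, ContDiff ℝ 1 ζ →
        HasCompactSupport ζ → (∀ s x, T ≤ s → ζ (s, x) = 0) →
        ∫ s in Ioo (0:ℝ) T, ∫ x,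
            ((u0 x - u s x) * fderiv ℝ ζ (s, x) (1, 0)
              + fderiv ℝ ζ (s, x) (0, g s x)
              + w x * (u s x) ^ q * ζ (s, x)) = 0)

/-- `u₀` is a non-negative function in `L^∞(ℝᴺ)`. -/
def IsBddNonneg (N : ℕ) (u0 : EuclideanSpace ℝ (Fin N) → ℝ) : Prop :=
  Measurable u0 ∧ (∀ x, 0 ≤ u0 x) ∧ ∃ C : ℝ, ∀ x, u0 x ≤ C

/-- The solution `u` vanishes in finite time. -/
def VanishesInFiniteTime (N : ℕ) (u : ℝ → EuclideanSpace ℝ (Fin N) → ℝ) : Prop :=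
  ∃ Te : ℝ, 0 < Te ∧ ∀ᵐ t : ℝ, Te ≤ t → ∀ᵐ x : EuclideanSpace ℝ (Fin N), u t x = 0

/-- The support of `u(t)` is contained in `B(0,R)` for a.e. `t > 0`. -/
def SupportLocalized (N : ℕ) (R : ℝ) (u : ℝ → EuclideanSpace ℝ (Fin N) → ℝ) : Prop :=
  ∀ᵐ t : ℝ, 0 < t → ∀ᵐ x : EuclideanSpace ℝ (Fin N), R ≤ ‖x‖ → u t x = 0

open Filter Topology ENNReal in
lemma aux_transl_L2 {G : Type*} [NormedAddCommGroup G] [NormedSpace ℝ G] [FiniteDimensional ℝ G]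
    [MeasurableSpace G] [BorelSpace G] (μ : Measure G) [μ.IsAddHaarMeasure]
    (g : G → ℝ) (hg : Measurable g)
    (hg2 : ∀ R : ℝ, IntegrableOn (fun z => g z ^ 2) (Metric.closedBall 0 R) μ)
    (R δ : ℝ) (hδ : 0 < δ) :
    ∃ r > 0, ∀ y : G, ‖y‖ ≤ r →
      ∫⁻ z in Metric.closedBall 0 R, ENNReal.ofReal ((g (z - y) - g z) ^ 2) ∂μ
        ≤ ENNReal.ofReal δ := by
  have : ProperSpace G := FiniteDimensional.proper_real G
  set G' : G → ℝ := (Metric.closedBall (0:G) (R + 1)).indicator g with hG'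
  have hG'm : Measurable G' := hg.indicator Metric.isClosed_closedBall.measurableSet
  have hmem : MemLp G' 2 μ := by
    rw [memLp_two_iff_integrable_sq hG'm.aestronglyMeasurable]
    have := (integrable_indicator_iff (Metric.isClosed_closedBall.measurableSet)).2 (hg2 (R + 1))
    refine this.congr (Eventually.of_forall fun z => ?_)
    simp only [hG', indicator]
    split_ifs <;> simp
  set f : Lp ℝ 2 μ := hmem.toLp G' with hf
  let T : G → C(G, G) := fun y => ⟨fun z => z - y, by fun_prop⟩
  have hTc : Continuous T := by
    have : Continuous (fun p : G × G => p.2 - p.1) := by fun_prop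
    exact (ContinuousMap.curry ⟨_, this⟩).continuous
  have hTm : ∀ y, MeasurePreserving (T y) μ μ := fun y => measurePreserving_sub_right μ y
  have hcont := Continuous.compMeasurePreservingLp (f := fun _ : G => f) (g := T)
    continuous_const hTc hTm (by norm_num)
  have ht := hcont.tendsto 0
  rw [Metric.tendsto_nhds] at ht
  obtain ⟨r, hr, hr'⟩ := Metric.eventually_nhds_iff.1 (ht (Real.sqrt δ) (Real.sqrt_pos.2 hδ))
  refine ⟨min (r/2) 1, by positivity, fun y hy => ?_⟩
  have hy1 : ‖y‖ ≤ 1 := hy.trans (min_le_right _ _)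
  have hyr : dist y 0 < r := by
    rw [dist_zero_right]; have := hy.trans (min_le_left _ _); linarith
  have h1 := hr' hyr
  rw [Lp.dist_def] at h1
  have h2 : eLpNorm (fun z => G' (z - y) - G' z) 2 μ < ENNReal.ofReal (Real.sqrt δ) := by
    rw [← ENNReal.ofReal_toReal (a := eLpNorm (fun z => G' (z - y) - G' z) 2 μ)]
    · apply (ENNReal.ofReal_lt_ofReal_iff (Real.sqrt_pos.2 hδ)).2
      convert h1 using 2
      apply eLpNorm_congr_ae
      have e1 := Lp.coeFn_compMeasurePreserving f (hTm y)
      have e2 := Lp.coeFn_compMeasurePreserving f (hTm 0)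
      have e3 := hmem.coeFn_toLp
      have e4 := (hTm y).quasiMeasurePreserving.ae_eq_comp e3
      have e5 := (hTm 0).quasiMeasurePreserving.ae_eq_comp e3
      filter_upwards [e1, e2, e4, e5] with z a1 a2 a4 a5
      simp only [Pi.sub_apply]
      rw [a1, a2, a4, a5]
      simp [T]
    · have m1 : MemLp (fun z => G' (z - y)) 2 μ := hmem.comp_measurePreserving (hTm y)
      exact (m1.sub hmem).2.ne
  have h3 : ∫⁻ z, ENNReal.ofReal ((G' (z - y) - G' z) ^ 2) ∂μ ≤ ENNReal.ofReal δ := by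
    rw [eLpNorm_eq_lintegral_rpow_enorm_toReal (by norm_num) (by norm_num)] at h2
    simp only [ENNReal.toReal_ofNat, one_div] at h2
    have h4 := ENNReal.rpow_le_rpow h2.le (z := 2) (by norm_num)
    rw [← ENNReal.rpow_mul, ENNReal.ofReal_rpow_of_nonneg (Real.sqrt_nonneg _) (by norm_num)] at h4
    norm_num [Real.sq_sqrt hδ.le] at h4
    refine le_trans (le_of_eq ?_) h4
    refine lintegral_congr fun z => ?_
    rw [← sq_abs, ENNReal.ofReal_pow (abs_nonneg _), ← Real.enorm_eq_ofReal_abs]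
  refine le_trans ?_ h3
  rw [← lintegral_indicator Metric.isClosed_closedBall.measurableSet]
  refine lintegral_mono fun z => ?_
  by_cases hz : z ∈ Metric.closedBall (0:G) R
  · have hz1 : z ∈ Metric.closedBall (0:G) (R+1) := Metric.closedBall_subset_closedBall (by linarith) hz
    have hz2 : z - y ∈ Metric.closedBall (0:G) (R+1) := by
      rw [mem_closedBall_zero_iff] at hz ⊢
      have := norm_sub_le z y
      linarith
    simp [hG', hz, hz1, hz2]
  · simp [hz]

open Filter Topology ENNReal Convolution in
lemma aux_mollify_L2 {G : Type*} [NormedAddCommGroup G] [NormedSpace ℝ G] [FiniteDimensional ℝ G]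
    [MeasurableSpace G] [BorelSpace G] (μ : Measure G) [μ.IsAddHaarMeasure]
    (g : G → ℝ) (hg : Measurable g)
    (hg2 : ∀ R : ℝ, IntegrableOn (fun z => g z ^ 2) (Metric.closedBall 0 R) μ)
    (R δ : ℝ) (hδ : 0 < δ) :
    ∃ r > 0, ∀ ρ : ContDiffBump (0:G), ρ.rOut ≤ r →
      ∫⁻ z in Metric.closedBall 0 R,
        ENNReal.ofReal (((∫ y, ρ.normed μ y * g (z - y) ∂μ) - g z) ^ 2) ∂μ
        ≤ ENNReal.ofReal δ := by
  have : ProperSpace G := FiniteDimensional.proper_real G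
  obtain ⟨r, hr, hr'⟩ := aux_transl_L2 μ g hg hg2 R δ hδ
  refine ⟨r, hr, fun ρ hρ => ?_⟩
  have hρi := ρ.integral_normed (μ := μ)
  have hρint : Integrable (ρ.normed μ) μ := ρ.integrable_normed
  have hρc : Continuous (ρ.normed μ) := ρ.continuous_normed
  have hρ0 := ρ.nonneg_normed (μ := μ)
  -- integrability
  have hli2 : LocallyIntegrable (fun z => g z ^ 2) μ := by
    rw [locallyIntegrable_iff]
    intro k hk
    obtain ⟨R', hR'⟩ := hk.isBounded.subset_closedBall 0
    exact (hg2 R').mono_set hR'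
  have hli : LocallyIntegrable g μ := by
    have h1 : LocallyIntegrable (fun z => 1 + g z ^ 2) μ := (locallyIntegrable_const 1).add hli2
    refine h1.mono hg.aestronglyMeasurable (Eventually.of_forall fun z => ?_)
    rw [Real.norm_eq_abs, Real.norm_eq_abs, abs_of_nonneg (by positivity : 0 ≤ 1 + g z ^ 2)]
    nlinarith [sq_abs (g z), sq_nonneg (|g z| - 1)]
  have hi1 : ∀ z, Integrable (fun y => ρ.normed μ y * g (z - y)) μ := fun z =>
    (ρ.hasCompactSupport_normed (μ := μ)).convolutionExists_left (ContinuousLinearMap.mul ℝ ℝ) hρc hli z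
  have hi2 : ∀ z, Integrable (fun y => ρ.normed μ y * g (z - y) ^ 2) μ := fun z =>
    (ρ.hasCompactSupport_normed (μ := μ)).convolutionExists_left (ContinuousLinearMap.mul ℝ ℝ) hρc hli2 z
  have key : ∀ z, ENNReal.ofReal (((∫ y, ρ.normed μ y * g (z - y) ∂μ) - g z) ^ 2)
      ≤ ∫⁻ y, ENNReal.ofReal (ρ.normed μ y) * ENNReal.ofReal ((g (z - y) - g z) ^ 2) ∂μ := by
    intro z
    set c := ∫ y, ρ.normed μ y * g (z - y) ∂μ with hc
    have e1 : Integrable (fun y => ρ.normed μ y * (g (z - y) - g z) ^ 2) μ := by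
      have : (fun y => ρ.normed μ y * (g (z - y) - g z) ^ 2) =
        fun y => ρ.normed μ y * g (z - y) ^ 2 - (2 * g z) * (ρ.normed μ y * g (z - y)) + g z ^ 2 * ρ.normed μ y := by
        ext y; ring
      rw [this]
      exact ((hi2 z).sub ((hi1 z).const_mul _)).add (hρint.const_mul _)
    have e2 : (c - g z) ^ 2 ≤ ∫ y, ρ.normed μ y * (g (z - y) - g z) ^ 2 ∂μ := by
      have p : 0 ≤ ∫ y, ρ.normed μ y * (g (z - y) - c) ^ 2 ∂μ :=
        integral_nonneg fun y => mul_nonneg (hρ0 y) (sq_nonneg _)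
      have a1 : ∫ y, ρ.normed μ y * (g (z - y) - c) ^ 2 ∂μ =
        (∫ y, ρ.normed μ y * (g (z - y) - g z) ^ 2 ∂μ) - (c - g z)^2 := by
        have : (fun y => ρ.normed μ y * (g (z - y) - c) ^ 2) =
          fun y => ρ.normed μ y * (g (z - y) - g z) ^ 2 - (2 * (c - g z)) * (ρ.normed μ y * g (z - y)) + (c ^ 2 - g z ^2) * ρ.normed μ y := by
          ext y; ring
        have s1 : Integrable (fun y => ρ.normed μ y * (g (z - y) - g z) ^ 2 - (2 * (c - g z)) * (ρ.normed μ y * g (z - y))) μ :=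
          e1.sub ((hi1 z).const_mul _)
        rw [this, integral_add s1 (hρint.const_mul _),
          integral_sub e1 ((hi1 z).const_mul _), integral_const_mul, integral_const_mul, hρi, ← hc]
        ring
      linarith
    refine (ENNReal.ofReal_le_ofReal e2).trans ?_
    rw [ofReal_integral_eq_lintegral_ofReal e1 (Eventually.of_forall fun y => mul_nonneg (hρ0 y) (sq_nonneg _))]
    refine lintegral_mono fun y => ?_
    rw [ENNReal.ofReal_mul (hρ0 y)]
  refine (lintegral_mono key).trans ?_
  rw [lintegral_lintegral_swap]
  · calc _ ≤ ∫⁻ y, ENNReal.ofReal (ρ.normed μ y) * ENNReal.ofReal δ ∂μ := by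
          refine lintegral_mono fun y => ?_
          rw [lintegral_const_mul' _ _ ENNReal.ofReal_ne_top]
          by_cases hy : ‖y‖ ≤ r
          · gcongr; exact hr' y hy
          · have : ρ.normed μ y = 0 := by
              have : y ∉ Function.support (ρ.normed μ) := by
                rw [ρ.support_normed_eq]; simp; linarith [not_le.1 hy]
              simpa using this
            simp [this]
      _ = ENNReal.ofReal δ := by
          rw [lintegral_mul_const' _ _ ENNReal.ofReal_ne_top, ← ofReal_integral_eq_lintegral_ofReal hρint (Eventually.of_forall hρ0), hρi]
          simp
  · apply Measurable.aemeasurable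
    have := hρc.measurable
    fun_prop

lemma posp_hasDerivAt (k : ℕ) (s : ℝ) :
    HasDerivAt (fun s : ℝ => max s 0 ^ (k + 2)) ((k + 2 : ℕ) * max s 0 ^ (k + 1)) s := by
  rcases lt_trichotomy s 0 with h | h | h
  · have : (fun s : ℝ => max s 0 ^ (k + 2)) =ᶠ[nhds s] fun _ => 0 := by
      filter_upwards [gt_mem_nhds h] with t ht
      simp [max_eq_right ht.le]
    rw [max_eq_right h.le]
    simpa using (hasDerivAt_const s (0:ℝ)).congr_of_eventuallyEq this
  · subst h
    rw [hasDerivAt_iff_isLittleO_nhds_zero]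
    simp only [zero_add, max_self]
    have h1 : (fun h : ℝ => h ^ (k + 2)) =o[nhds 0] fun h : ℝ => h := by
      simpa using Asymptotics.isLittleO_pow_pow (𝕜 := ℝ) (m := 1) (n := k + 2) (by omega)
    refine Asymptotics.IsBigO.trans_isLittleO ?_ h1
    refine Asymptotics.IsBigO.of_bound 1 (Filter.Eventually.of_forall fun h => ?_)
    simp only [ne_eq, Nat.add_eq_zero_iff, OfNat.ofNat_ne_zero, and_false, not_false_eq_true,
      zero_pow, sub_zero, smul_eq_mul, one_mul, one_ne_zero, mul_zero]
    rw [norm_pow, norm_pow]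
    gcongr
    rw [Real.norm_eq_abs, Real.norm_eq_abs, abs_of_nonneg (le_max_right _ _)]
    exact max_le (le_abs_self _) (abs_nonneg _)
  · have : (fun s : ℝ => max s 0 ^ (k + 2)) =ᶠ[nhds s] fun s => s ^ (k + 2) := by
      filter_upwards [lt_mem_nhds h] with t ht
      simp [max_eq_left ht.le]
    rw [max_eq_left h.le]
    exact (hasDerivAt_pow (k + 2) s).congr_of_eventuallyEq this

lemma posp_contDiff_one (k : ℕ) : ContDiff ℝ 1 (fun s : ℝ => max s 0 ^ (k + 2)) := by
  rw [contDiff_one_iff_deriv]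
  refine ⟨fun s => (posp_hasDerivAt k s).differentiableAt, ?_⟩
  have : deriv (fun s : ℝ => max s 0 ^ (k + 2)) = fun s : ℝ => ((k + 2 : ℕ) : ℝ) * max s 0 ^ (k + 1) :=
    funext fun s => (posp_hasDerivAt k s).deriv
  rw [this]; fun_prop

lemma posp_contDiff_two (k : ℕ) : ContDiff ℝ 2 (fun s : ℝ => max s 0 ^ (k + 3)) := by
  rw [show (2 : WithTop ℕ∞) = 1 + 1 by norm_num, contDiff_succ_iff_deriv]
  refine ⟨fun s => (posp_hasDerivAt (k+1) s).differentiableAt, by simp, ?_⟩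
  have : deriv (fun s : ℝ => max s 0 ^ (k + 3)) = fun s : ℝ => ((k + 1 + 2 : ℕ) : ℝ) * max s 0 ^ (k + 2) :=
    funext fun s => (posp_hasDerivAt (k+1) s).deriv
  rw [this]
  exact contDiff_const.mul (posp_contDiff_one k)

open Convolution in
lemma aux_moll_smooth {G : Type*} [NormedAddCommGroup G] [NormedSpace ℝ G] [FiniteDimensional ℝ G]
    [MeasurableSpace G] [BorelSpace G] (μ : Measure G) [μ.IsAddHaarMeasure]
    (U : G → ℝ) (hU : Measurable U) (C : ℝ) (hUC : ∀ z, |U z| ≤ C)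
    (ρ : ContDiffBump (0:G)) :
    ContDiff ℝ 1 (fun z => ∫ y, ρ.normed μ y * U (z - y) ∂μ) ∧
    (∀ z, |∫ y, ρ.normed μ y * U (z - y) ∂μ| ≤ C) ∧
    (∀ (e : G) (g : G → ℝ),
      (∀ ζ : G → ℝ, ContDiff ℝ 1 ζ → HasCompactSupport ζ →
        ∫ z, U z * fderiv ℝ ζ z e ∂μ = - ∫ z, g z * ζ z ∂μ) →
      ∀ z, fderiv ℝ (fun z => ∫ y, ρ.normed μ y * U (z - y) ∂μ) z e
        = ∫ y, ρ.normed μ y * g (z - y) ∂μ) := by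
  have : ProperSpace G := FiniteDimensional.proper_real G
  have hρi := ρ.integral_normed (μ := μ)
  have hρint : Integrable (ρ.normed μ) μ := ρ.integrable_normed
  have hρc : ContDiff ℝ 1 (ρ.normed μ) := ρ.contDiff_normed
  have hρs := ρ.hasCompactSupport_normed (μ := μ)
  have hρ0 := ρ.nonneg_normed (μ := μ)
  have hUl : LocallyIntegrable U μ := by
    refine (locallyIntegrable_const C).mono hU.aestronglyMeasurable (Filter.Eventually.of_forall fun z => ?_)
    exact (hUC z).trans (le_abs_self _)
  refine ⟨?_, ?_, ?_⟩
  · exact hρs.contDiff_convolution_left (ContinuousLinearMap.mul ℝ ℝ) hρc hUl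
  · intro z
    rw [← Real.norm_eq_abs]
    refine (norm_integral_le_of_norm_le (hρint.mul_const C) (Filter.Eventually.of_forall fun y => ?_)).trans ?_
    · rw [norm_mul, Real.norm_eq_abs, abs_of_nonneg (hρ0 y)]
      exact mul_le_mul_of_nonneg_left (hUC _) (hρ0 y)
    · rw [integral_mul_const, hρi, one_mul]
  · intro e g hI z
    have h1 := hρs.hasFDerivAt_convolution_left (ContinuousLinearMap.mul ℝ ℝ) (μ := μ) hρc hUl z
    have h2 : fderiv ℝ (fun z => ∫ y, ρ.normed μ y * U (z - y) ∂μ) z e =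
        ∫ y, fderiv ℝ (ρ.normed μ) y e * U (z - y) ∂μ := by
      have h3 : fderiv ℝ (fun z => ∫ y, ρ.normed μ y * U (z - y) ∂μ) z =
        (fderiv ℝ (ρ.normed μ) ⋆[(ContinuousLinearMap.mul ℝ ℝ).precompL G, μ] U) z := h1.fderiv
      rw [h3]
      have hce : ConvolutionExistsAt (fderiv ℝ (ρ.normed μ)) U z ((ContinuousLinearMap.mul ℝ ℝ).precompL G) μ :=
        (hρs.fderiv ℝ).convolutionExists_left _ (hρc.continuous_fderiv (by norm_num)) hUl z
      unfold convolution
      rw [ContinuousLinearMap.integral_apply hce]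
      rfl
    rw [h2]
    have hζ := hI (fun y => ρ.normed μ (z - y)) (hρc.comp (contDiff_const.sub contDiff_id))
      (hρs.comp_homeomorph (Homeomorph.subLeft z))
    have hf : ∀ y, fderiv ℝ (fun y => ρ.normed μ (z - y)) y e = - fderiv ℝ (ρ.normed μ) (z - y) e := by
      intro y
      have d1 : HasFDerivAt (fun y => z - y) (-(ContinuousLinearMap.id ℝ G)) y := (hasFDerivAt_id y).const_sub z
      have d2 : HasFDerivAt (ρ.normed μ) (fderiv ℝ (ρ.normed μ) (z - y)) (z - y) :=
        (hρc.differentiable (by norm_num) _).hasFDerivAt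
      have d3 := d2.comp y d1
      have := d3.fderiv
      simp only [Function.comp_def] at this
      rw [this]; simp
    simp only [hf] at hζ
    rw [← integral_sub_left_eq_self _ μ z, ← integral_sub_left_eq_self (fun y => ρ.normed μ y * g (z - y)) μ z]
    simp only [sub_sub_cancel]
    simp only [mul_neg, integral_neg, neg_inj] at hζ
    rw [show (fun y => fderiv ℝ (ρ.normed μ) (z - y) e * U y) = fun y => U y * fderiv ℝ (ρ.normed μ) (z - y) e by ext y; ring, hζ]
    congr 1; ext y; ring

lemma aux_locInt_of_sq {G : Type*} [NormedAddCommGroup G] [NormedSpace ℝ G] [FiniteDimensional ℝ G]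
    [MeasurableSpace G] [BorelSpace G] (μ : Measure G) [μ.IsAddHaarMeasure]
    (g : G → ℝ) (hg : Measurable g)
    (hg2 : ∀ R : ℝ, IntegrableOn (fun z => g z ^ 2) (Metric.closedBall 0 R) μ) :
    LocallyIntegrable g μ := by
  have : ProperSpace G := FiniteDimensional.proper_real G
  have hli2 : LocallyIntegrable (fun z => g z ^ 2) μ := by
    rw [locallyIntegrable_iff]
    intro k hk
    obtain ⟨R', hR'⟩ := hk.isBounded.subset_closedBall 0
    exact (hg2 R').mono_set hR'
  have h1 : LocallyIntegrable (fun z => 1 + g z ^ 2) μ := (locallyIntegrable_const 1).add hli2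
  refine h1.mono hg.aestronglyMeasurable (Filter.Eventually.of_forall fun z => ?_)
  rw [Real.norm_eq_abs, Real.norm_eq_abs, abs_of_nonneg (by positivity : 0 ≤ 1 + g z ^ 2)]
  nlinarith [sq_abs (g z), sq_nonneg (|g z| - 1)]

lemma aux_int_mul {G : Type*} [NormedAddCommGroup G] [NormedSpace ℝ G] [FiniteDimensional ℝ G]
    [MeasurableSpace G] [BorelSpace G] {μ : Measure G} [μ.IsAddHaarMeasure]
    {g η : G → ℝ} (hg : LocallyIntegrable g μ) (hη : Continuous η) (hs : HasCompactSupport η) :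
    Integrable (fun z => g z * η z) μ := by
  have := hg.integrable_smul_left_of_hasCompactSupport hη hs
  refine this.congr (Filter.Eventually.of_forall fun z => ?_)
  simp [mul_comm]

lemma aux_pt (M x b d φ p A κ : ℝ) (hκ : 0 < κ) (h0 : 0 ≤ 2 * M * φ) (h1 : 2 * M * φ ≤ A)
    (h2 : |M ^ 2 * p| ≤ A) :
    M ^ 2 * x * p + b * (2 * M * x * φ + M ^ 2 * p) - (A * κ + (A + A / κ) * d ^ 2)
      ≤ (x + b + d) * (2 * M * x * φ + M ^ 2 * p) := by
  have hA : 0 ≤ A := h0.trans h1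
  have e1 : 2 * M * φ * (x ^ 2 + d * x) ≥ - (A * d ^ 2) := by
    have : 2 * M * φ * (x ^ 2 + d * x) ≥ - (2 * M * φ * d ^ 2) := by
      have : 0 ≤ 2 * M * φ * (x ^ 2 + d * x + d ^ 2) := by
        apply mul_nonneg h0; nlinarith [sq_nonneg (x + d), sq_nonneg x, sq_nonneg d]
      linarith
    nlinarith [sq_nonneg d]
  have e2 : |d| ≤ κ + d ^ 2 / κ := by
    have : 0 ≤ (κ + d ^ 2 / κ - |d|) * κ := by
      have : (κ + d ^ 2 / κ - |d|) * κ = κ ^ 2 + d ^ 2 - |d| * κ := by field_simp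
      rw [this]; nlinarith [sq_abs d, sq_nonneg (κ - |d|), sq_nonneg (κ), sq_nonneg d]
    have := nonneg_of_mul_nonneg_left this hκ
    linarith
  have e3 : d * (M ^ 2 * p) ≥ - (A * κ + A / κ * d ^ 2) := by
    have : |d * (M ^ 2 * p)| ≤ (κ + d ^ 2 / κ) * A := by
      rw [abs_mul]; exact mul_le_mul e2 h2 (abs_nonneg _) (by positivity)
    have h := (abs_le.1 this).1
    have : (κ + d ^ 2 / κ) * A = A * κ + A / κ * d ^ 2 := by ring
    linarith
  nlinarith

lemma aux_pt2 (η d A κ : ℝ) (hκ : 0 < κ) (h1 : |η| ≤ A) :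
    - (A * κ + (A + A / κ) * d ^ 2) ≤ d * η := by
  have := aux_pt 0 0 0 d 0 0 0 κ hκ (by simp) (by simp) (by simp)
  have hA : 0 ≤ A := (abs_nonneg _).trans h1
  have e2 : |d| ≤ κ + d ^ 2 / κ := by
    have : 0 ≤ (κ + d ^ 2 / κ - |d|) * κ := by
      have : (κ + d ^ 2 / κ - |d|) * κ = κ ^ 2 + d ^ 2 - |d| * κ := by field_simp
      rw [this]; nlinarith [sq_abs d, sq_nonneg (κ - |d|), sq_nonneg (κ), sq_nonneg d]
    have := nonneg_of_mul_nonneg_left this hκ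
    linarith
  have : |d * η| ≤ (κ + d ^ 2 / κ) * A := by
    rw [abs_mul]; exact mul_le_mul e2 h1 (abs_nonneg _) (by positivity)
  have h := (abs_le.1 this).1
  have : (κ + d ^ 2 / κ) * A = A * κ + A / κ * d ^ 2 := by ring
  nlinarith [mul_nonneg hA (sq_nonneg d)]

/-- derivative facts for the truncated test function -/
lemma aux_eta {G : Type*} [NormedAddCommGroup G] [NormedSpace ℝ G]
    (V φ : G → ℝ) (hV : ContDiff ℝ 1 V) (hφ : ContDiff ℝ 1 φ) :
    ContDiff ℝ 1 (fun z => max (V z) 0 ^ 2 * φ z) ∧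
    (∀ z e, fderiv ℝ (fun z => max (V z) 0 ^ 2 * φ z) z e =
      2 * max (V z) 0 * fderiv ℝ V z e * φ z + max (V z) 0 ^ 2 * fderiv ℝ φ z e) ∧
    ContDiff ℝ 1 (fun z => max (V z) 0 ^ 3 / 3) ∧
    (∀ z e, fderiv ℝ (fun z => max (V z) 0 ^ 3 / 3) z e = max (V z) 0 ^ 2 * fderiv ℝ V z e) := by
  have c2 : ContDiff ℝ 1 (fun z => max (V z) 0 ^ 2) := (posp_contDiff_one 0).comp hV
  have c3 : ContDiff ℝ 1 (fun z => max (V z) 0 ^ 3) := (posp_contDiff_one 1).comp hV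
  have dV : ∀ z, HasFDerivAt V (fderiv ℝ V z) z := fun z => (hV.differentiable (by norm_num) z).hasFDerivAt
  have dφ : ∀ z, HasFDerivAt φ (fderiv ℝ φ z) z := fun z => (hφ.differentiable (by norm_num) z).hasFDerivAt
  have d2 : ∀ z, HasFDerivAt (fun z => max (V z) 0 ^ 2) ((2 * max (V z) 0) • fderiv ℝ V z) z := by
    intro z
    have := (posp_hasDerivAt 0 (V z)).comp_hasFDerivAt z (dV z)
    simpa [Function.comp_def] using this
  have d3 : ∀ z, HasFDerivAt (fun z => max (V z) 0 ^ 3) ((3 * max (V z) 0 ^ 2) • fderiv ℝ V z) z := by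
    intro z
    have := (posp_hasDerivAt 1 (V z)).comp_hasFDerivAt z (dV z)
    simpa [Function.comp_def] using this
  refine ⟨c2.mul hφ, ?_, c3.div_const 3, ?_⟩
  · intro z e
    have h : fderiv ℝ (fun z => max (V z) 0 ^ 2 * φ z) z = _ := ((d2 z).mul (dφ z)).fderiv
    rw [h]
    simp; ring
  · intro z e
    have h0 : (fun z => max (V z) 0 ^ 3 / 3) = fun z => max (V z) 0 ^ 3 * (3:ℝ)⁻¹ := by
      ext z; ring
    have h : fderiv ℝ (fun z => max (V z) 0 ^ 3 * (3:ℝ)⁻¹) z = _ := ((d3 z).mul_const (3:ℝ)⁻¹).fderiv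
    rw [h0, h]
    simp; ring

lemma aux_coreD {G : Type*} [NormedAddCommGroup G] [NormedSpace ℝ G] [FiniteDimensional ℝ G]
    [MeasurableSpace G] [BorelSpace G] (μ : Measure G) [μ.IsAddHaarMeasure]
    {ι : Type*} [Fintype ι] (e : ι → G)
    (g : ι → G → ℝ) (f : G → ℝ)
    (hgl : ∀ i, LocallyIntegrable (g i) μ) (hfl : LocallyIntegrable f μ)
    (Q W φ : G → ℝ) (hQ : ContDiff ℝ 1 Q) (hW : ContDiff ℝ 1 W) (hφ : ContDiff ℝ 2 φ)
    (hWd : ∀ i, Differentiable ℝ (fun z => fderiv ℝ W z (e i)))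
    (hWL : ∀ i, LocallyIntegrable (fun z => fderiv ℝ (fun z => fderiv ℝ W z (e i)) z (e i)) μ)
    (hφs : HasCompactSupport φ) (hφ0 : ∀ z, 0 ≤ φ z)
    (R : ℝ) (hR : tsupport φ ⊆ Metric.closedBall 0 R)
    (A : ℝ) (hA1 : ∀ z, 2 * max (Q z - W z) 0 * φ z ≤ A)
    (hA2 : ∀ z i, |max (Q z - W z) 0 ^ 2 * fderiv ℝ φ z (e i)| ≤ A)
    (hA3 : ∀ z, |max (Q z - W z) 0 ^ 2 * φ z| ≤ A)
    (y : G) (κ δ : ℝ) (hκ : 0 < κ)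
    (hdi : ∀ i, IntegrableOn (fun z => (g i (z - y) - fderiv ℝ Q z (e i)) ^ 2) (Metric.closedBall 0 R) μ)
    (hd : ∀ i, ∫ z in Metric.closedBall 0 R, (g i (z - y) - fderiv ℝ Q z (e i)) ^ 2 ∂μ ≤ δ)
    (hfi : IntegrableOn (fun z => (f (z - y) - f z) ^ 2) (Metric.closedBall 0 R) μ)
    (hf : ∫ z in Metric.closedBall 0 R, (f (z - y) - f z) ^ 2 ∂μ ≤ δ) :
    - (∑ i, ∫ z, (max (Q z - W z) 0 ^ 3 / 3) *
          fderiv ℝ (fun z => fderiv ℝ φ z (e i)) z (e i) ∂μ)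
      - (∑ i, ∫ z, fderiv ℝ (fun z => fderiv ℝ W z (e i)) z (e i) *
          (max (Q z - W z) 0 ^ 2 * φ z) ∂μ)
      + (∫ z, f z * (max (Q z - W z) 0 ^ 2 * φ z) ∂μ)
      - (Fintype.card ι + 1) * (A * κ * μ.real (Metric.closedBall 0 R) + (A + A / κ) * δ)
    ≤ ∫ z, ((∑ i, g i z * fderiv ℝ (fun z => max (Q z - W z) 0 ^ 2 * φ z) (z + y) (e i))
        + f z * (max (Q (z + y) - W (z + y)) 0 ^ 2 * φ (z + y))) ∂μ := by
  have : ProperSpace G := FiniteDimensional.proper_real G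
  set V : G → ℝ := fun z => Q z - W z with hVdef
  have hV : ContDiff ℝ 1 V := hQ.sub hW
  have hφ1 : ContDiff ℝ 1 φ := hφ.of_le (by norm_num)
  obtain ⟨cη, dη, cG, dG⟩ := aux_eta V φ hV hφ1
  set η : G → ℝ := fun z => max (V z) 0 ^ 2 * φ z with hη
  set Gv : G → ℝ := fun z => max (V z) 0 ^ 3 / 3 with hGv
  have hηs : HasCompactSupport η := hφs.mul_left
  have hηis : ∀ i, HasCompactSupport (fun z => fderiv ℝ η z (e i)) := fun i => hηs.fderiv_apply ℝ (e i)
  have hφis : ∀ i, HasCompactSupport (fun z => fderiv ℝ φ z (e i)) := fun i => hφs.fderiv_apply ℝ (e i)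
  have cηi : ∀ i, Continuous (fun z => fderiv ℝ η z (e i)) := fun i =>
    (cη.continuous_fderiv (by norm_num)).clm_apply continuous_const
  have cφi : ∀ i, ContDiff ℝ 1 (fun z => fderiv ℝ φ z (e i)) := fun i =>
    (hφ.fderiv_right (m := 1) (by norm_num)).clm_apply contDiff_const
  have cφii : ∀ i, Continuous (fun z => fderiv ℝ (fun z => fderiv ℝ φ z (e i)) z (e i)) := fun i =>
    ((cφi i).continuous_fderiv (by norm_num)).clm_apply continuous_const
  have cWi : ∀ i, Continuous (fun z => fderiv ℝ W z (e i)) := fun i =>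
    (hW.continuous_fderiv (by norm_num)).clm_apply continuous_const
  have cGi : ∀ i, Continuous (fun z => fderiv ℝ Gv z (e i)) := fun i =>
    (cG.continuous_fderiv (by norm_num)).clm_apply continuous_const
  have dV : ∀ z e', fderiv ℝ V z e' = fderiv ℝ Q z e' - fderiv ℝ W z e' := by
    intro z e'
    have : fderiv ℝ V z = fderiv ℝ Q z - fderiv ℝ W z :=
      fderiv_fun_sub (hQ.differentiable (by norm_num) z) (hW.differentiable (by norm_num) z)
    rw [this]; rfl
  have hBm : MeasurableSet (Metric.closedBall (0:G) R) := Metric.isClosed_closedBall.measurableSet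
  -- integration by parts
  have ibp1 : ∀ i, ∫ z, fderiv ℝ Gv z (e i) * fderiv ℝ φ z (e i) ∂μ =
      - ∫ z, Gv z * fderiv ℝ (fun z => fderiv ℝ φ z (e i)) z (e i) ∂μ := by
    intro i
    have := integral_mul_fderiv_eq_neg_fderiv_mul_of_integrable (μ := μ) (f := Gv)
      (g := fun z => fderiv ℝ φ z (e i)) (v := e i)
      (((cGi i).mul (cφi i).continuous).integrable_of_hasCompactSupport (hφis i).mul_left)
      ((cG.continuous.mul (cφii i)).integrable_of_hasCompactSupport
        (((hφis i).fderiv_apply ℝ (e i)).mul_left))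
      ((cG.continuous.mul (cφi i).continuous).integrable_of_hasCompactSupport (hφis i).mul_left)
      (fun z _ => (cG.differentiable (by norm_num) z))
      (fun z _ => ((cφi i).differentiable (by norm_num) z))
    rw [this, neg_neg]
  have iWη : ∀ i, Integrable (fun z => fderiv ℝ (fun z => fderiv ℝ W z (e i)) z (e i) * η z) μ :=
    fun i => aux_int_mul (hWL i) cη.continuous hηs
  have ibp2 : ∀ i, ∫ z, fderiv ℝ W z (e i) * fderiv ℝ η z (e i) ∂μ =
      - ∫ z, fderiv ℝ (fun z => fderiv ℝ W z (e i)) z (e i) * η z ∂μ := by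
    intro i
    exact integral_mul_fderiv_eq_neg_fderiv_mul_of_integrable (μ := μ)
      (f := fun z => fderiv ℝ W z (e i)) (g := η) (v := e i) (iWη i)
      (((cWi i).mul (cηi i)).integrable_of_hasCompactSupport (hηis i).mul_left)
      (((cWi i).mul cη.continuous).integrable_of_hasCompactSupport hηs.mul_left)
      (fun z _ => hWd i z) (fun z _ => cη.differentiable (by norm_num) z)
  -- translation
  have htr : ∫ z, ((∑ i, g i z * fderiv ℝ η (z + y) (e i)) + f z * (max (Q (z + y) - W (z + y)) 0 ^ 2 * φ (z + y))) ∂μ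
      = ∫ z, ((∑ i, g i (z - y) * fderiv ℝ η z (e i)) + f (z - y) * η z) ∂μ := by
    rw [← integral_add_right_eq_self (fun z => (∑ i, g i (z - y) * fderiv ℝ η z (e i)) + f (z - y) * η z) y]
    simp only [add_sub_cancel_right]
    rfl
  rw [htr]
  have ig : ∀ i, Integrable (fun z => g i (z - y) * fderiv ℝ η z (e i)) μ := by
    intro i
    have h1 : Integrable (fun z => g i z * fderiv ℝ η (z + y) (e i)) μ :=
      aux_int_mul (hgl i) ((cηi i).comp (continuous_add_const y))
        ((hηis i).comp_homeomorph (Homeomorph.addRight y))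
    have := h1.comp_sub_right y
    simpa using this
  have ify : Integrable (fun z => f (z - y) * η z) μ := by
    have h1 : Integrable (fun z => f z * η (z + y)) μ :=
      aux_int_mul hfl (cη.continuous.comp (continuous_add_const y))
        (hηs.comp_homeomorph (Homeomorph.addRight y))
    have := h1.comp_sub_right y
    simpa using this
  have ifη : Integrable (fun z => f z * η z) μ := aux_int_mul hfl cη.continuous hηs
  have iG : ∀ i, Integrable (fun z => fderiv ℝ Gv z (e i) * fderiv ℝ φ z (e i)) μ := fun i =>
    ((cGi i).mul (cφi i).continuous).integrable_of_hasCompactSupport (hφis i).mul_left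
  have iW : ∀ i, Integrable (fun z => fderiv ℝ W z (e i) * fderiv ℝ η z (e i)) μ := fun i =>
    ((cWi i).mul (cηi i)).integrable_of_hasCompactSupport (hηis i).mul_left
  have hA : 0 ≤ A := (abs_nonneg _).trans (hA3 0)
  -- errors
  have errI : ∀ d : G → ℝ, IntegrableOn (fun z => d z ^ 2) (Metric.closedBall 0 R) μ →
      IntegrableOn (fun z => A * κ + (A + A / κ) * d z ^ 2) (Metric.closedBall 0 R) μ := by
    intro d h
    exact (integrableOn_const (by exact (isCompact_closedBall (0:G) R).measure_lt_top.ne)).add (h.const_mul _)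
  have errB : ∀ d : G → ℝ, IntegrableOn (fun z => d z ^ 2) (Metric.closedBall 0 R) μ →
      ∫ z in Metric.closedBall 0 R, d z ^ 2 ∂μ ≤ δ →
      ∫ z, (Metric.closedBall (0:G) R).indicator (fun z => A * κ + (A + A / κ) * d z ^ 2) z ∂μ
        ≤ A * κ * μ.real (Metric.closedBall 0 R) + (A + A / κ) * δ := by
    intro d h hd
    have hc : Integrable (fun _ : G => A * κ) (μ.restrict (Metric.closedBall 0 R)) :=
      integrableOn_const (isCompact_closedBall (0:G) R).measure_lt_top.ne
    have h2 : Integrable (fun z => (A + A / κ) * d z ^ 2) (μ.restrict (Metric.closedBall 0 R)) :=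
      h.const_mul _
    rw [integral_indicator hBm, integral_add hc h2,
      setIntegral_const, integral_const_mul, smul_eq_mul]
    exact add_le_add (le_of_eq (mul_comm _ _)) (mul_le_mul_of_nonneg_left hd (by positivity : 0 ≤ A + A / κ))
  have out : ∀ z, z ∉ Metric.closedBall (0:G) R → φ z = 0 ∧ ∀ i, fderiv ℝ φ z (e i) = 0 := by
    intro z hz
    have hz' : z ∉ tsupport φ := fun h => hz (hR h)
    refine ⟨image_eq_zero_of_notMem_tsupport hz', fun i => ?_⟩
    rw [image_eq_zero_of_notMem_tsupport (f := fderiv ℝ φ) (fun h => hz' (tsupport_fderiv_subset ℝ h))]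
    rfl
  have Bi : ∀ i, (- ∫ z, Gv z * fderiv ℝ (fun z => fderiv ℝ φ z (e i)) z (e i) ∂μ)
      - (∫ z, fderiv ℝ (fun z => fderiv ℝ W z (e i)) z (e i) * η z ∂μ)
      - (A * κ * μ.real (Metric.closedBall 0 R) + (A + A / κ) * δ)
      ≤ ∫ z, g i (z - y) * fderiv ℝ η z (e i) ∂μ := by
    intro i
    have E := errB _ (hdi i) (hd i)
    have EI := (errI _ (hdi i)).integrable_indicator hBm
    have mono : ∫ z, (fderiv ℝ Gv z (e i) * fderiv ℝ φ z (e i) + fderiv ℝ W z (e i) * fderiv ℝ η z (e i)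
        - (Metric.closedBall (0:G) R).indicator (fun z => A * κ + (A + A / κ) * (g i (z - y) - fderiv ℝ Q z (e i)) ^ 2) z) ∂μ
        ≤ ∫ z, g i (z - y) * fderiv ℝ η z (e i) ∂μ := by
      refine integral_mono (((iG i).add (iW i)).sub EI) (ig i) fun z => ?_
      by_cases hz : z ∈ Metric.closedBall (0:G) R
      · have P := aux_pt (max (V z) 0) (fderiv ℝ V z (e i)) (fderiv ℝ W z (e i))
          (g i (z - y) - fderiv ℝ Q z (e i)) (φ z) (fderiv ℝ φ z (e i)) A κ hκ
          (mul_nonneg (mul_nonneg (by norm_num) (le_max_right _ _)) (hφ0 z)) (hA1 z) (hA2 z i)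
        simp only [indicator_of_mem hz, dη, dG]
        refine P.trans (le_of_eq ?_)
        rw [dV]; ring
      · obtain ⟨o1, o2⟩ := out z hz
        simp only [indicator_of_notMem hz, dη, dG, o1, o2]
        simp
    have s1 : Integrable (fun z => fderiv ℝ Gv z (e i) * fderiv ℝ φ z (e i) + fderiv ℝ W z (e i) * fderiv ℝ η z (e i)) μ :=
      (iG i).add (iW i)
    rw [integral_sub s1 EI, integral_add (iG i) (iW i), ibp1, ibp2] at mono
    linarith
  have Bf : (∫ z, f z * η z ∂μ) - (A * κ * μ.real (Metric.closedBall 0 R) + (A + A / κ) * δ)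
      ≤ ∫ z, f (z - y) * η z ∂μ := by
    have E := errB _ hfi hf
    have EI := (errI _ hfi).integrable_indicator hBm
    have mono : ∫ z, (f z * η z
        - (Metric.closedBall (0:G) R).indicator (fun z => A * κ + (A + A / κ) * (f (z - y) - f z) ^ 2) z) ∂μ
        ≤ ∫ z, f (z - y) * η z ∂μ := by
      refine integral_mono (ifη.sub EI) ify fun z => ?_
      by_cases hz : z ∈ Metric.closedBall (0:G) R
      · have P := aux_pt2 (η z) (f (z - y) - f z) A κ hκ (hA3 z)
        simp only [indicator_of_mem hz]
        linarith
      · obtain ⟨o1, o2⟩ := out z hz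
        simp only [indicator_of_notMem hz, hη, o1]
        simp
    rw [integral_sub ifη EI] at mono
    linarith
  rw [integral_add (integrable_finsetSum _ fun i _ => ig i) ify, integral_finsetSum _ fun i _ => ig i]
  have S := Finset.sum_le_sum (s := Finset.univ) fun i _ => Bi i
  simp only [Finset.sum_sub_distrib, Finset.sum_neg_distrib, Finset.sum_const, Finset.card_univ, nsmul_eq_mul] at S
  linarith

lemma aux_timeMV {G : Type*} [NormedAddCommGroup G] [NormedSpace ℝ G] [FiniteDimensional ℝ G]
    [MeasurableSpace G] [BorelSpace G] (μ : Measure G) [μ.IsAddHaarMeasure]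
    (v η : G → ℝ) (hv : LocallyIntegrable v μ) (hη : ContDiff ℝ 1 η) (hs : HasCompactSupport η)
    (e0 : G) (h c0 : ℝ) (hh : 0 ≤ h)
    (hc : ∀ s, 0 ≤ s → s ≤ h → c0 ≤ ∫ z, v z * fderiv ℝ η (z + s • e0) e0 ∂μ) :
    c0 * h ≤ (∫ z, v z * η (z + h • e0) ∂μ) - ∫ z, v z * η z ∂μ := by
  have : ProperSpace G := FiniteDimensional.proper_real G
  have cη' : Continuous (fun z => fderiv ℝ η z e0) :=
    (hη.continuous_fderiv (by norm_num)).clm_apply continuous_const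
  have sη' : HasCompactSupport (fun z => fderiv ℝ η z e0) := hs.fderiv_apply ℝ e0
  obtain ⟨B, hB⟩ := cη'.bounded_above_of_compact_support sη'
  obtain ⟨R, hR⟩ := sη'.isCompact.isBounded.subset_closedBall 0
  have hder : ∀ s0 : ℝ, HasDerivAt (fun s : ℝ => ∫ z, v z * η (z + s • e0) ∂μ)
      (∫ z, v z * fderiv ℝ η (z + s0 • e0) e0 ∂μ) s0 := by
    intro s0
    refine (hasDerivAt_integral_of_dominated_loc_of_deriv_le (s := Metric.ball s0 1)
      (F := fun s z => v z * η (z + s • e0)) (F' := fun s z => v z * fderiv ℝ η (z + s • e0) e0)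
      (bound := (Metric.closedBall (0:G) (R + (|s0| + 1) * ‖e0‖)).indicator (fun z => ‖v z‖ * B))
      (Metric.ball_mem_nhds _ one_pos) ?_ ?_ ?_ ?_ ?_ ?_).2
    · refine Filter.Eventually.of_forall fun s => hv.aestronglyMeasurable.mul ?_
      exact (hη.continuous.comp (continuous_add_const _)).aestronglyMeasurable
    · exact aux_int_mul hv (hη.continuous.comp (continuous_add_const _))
        (hs.comp_homeomorph (Homeomorph.addRight (s0 • e0)))
    · exact hv.aestronglyMeasurable.mul (cη'.comp (continuous_add_const _)).aestronglyMeasurable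
    · refine Filter.Eventually.of_forall fun z s hs' => ?_
      by_cases hz : z ∈ Metric.closedBall (0:G) (R + (|s0| + 1) * ‖e0‖)
      · rw [indicator_of_mem hz, norm_mul]
        exact mul_le_mul_of_nonneg_left (hB _) (norm_nonneg _)
      · rw [indicator_of_notMem hz]
        have : z + s • e0 ∉ tsupport (fun z => fderiv ℝ η z e0) := by
          intro hmem
          have h1 := hR hmem
          rw [mem_closedBall_zero_iff] at h1 hz
          apply hz
          have h2 : ‖z‖ ≤ ‖z + s • e0‖ + ‖s • e0‖ := by
            have := norm_sub_le (z + s • e0) (s • e0); simpa using this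
          rw [norm_smul] at h2
          have h3 : ‖s‖ ≤ |s0| + 1 := by
            rw [Metric.mem_ball, Real.dist_eq] at hs'
            have := abs_sub_abs_le_abs_sub s s0
            rw [Real.norm_eq_abs]; linarith
          have := mul_le_mul_of_nonneg_right h3 (norm_nonneg e0)
          linarith
        have := image_eq_zero_of_notMem_tsupport this
        simp [this]
    · rw [integrable_indicator_iff Metric.isClosed_closedBall.measurableSet]
      exact ((hv.integrableOn_isCompact (isCompact_closedBall _ _)).norm.mul_const B)
    · refine Filter.Eventually.of_forall fun z s _ => ?_
      have d1 : HasDerivAt (fun s : ℝ => z + s • e0) e0 s := by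
        simpa using ((hasDerivAt_id s).smul_const e0).const_add z
      have d2 : HasFDerivAt η (fderiv ℝ η (z + s • e0)) (z + s • e0) :=
        (hη.differentiable (by norm_num) _).hasFDerivAt
      exact (d2.comp_hasDerivAt s d1).const_mul (v z)
  have := Convex.mul_sub_le_image_sub_of_le_deriv (D := Icc 0 h) (convex_Icc 0 h)
    (f := fun s : ℝ => ∫ z, v z * η (z + s • e0) ∂μ)
    (fun s _ => (hder s).continuousAt.continuousWithinAt)
    (fun s _ => (hder s).differentiableAt.differentiableWithinAt) (C := c0)
    (fun s hs => by
      rw [(hder s).deriv]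
      have := interior_subset hs
      exact hc s this.1 this.2) 0 ⟨le_rfl, hh⟩ h ⟨hh, le_rfl⟩ hh
  simpa using this

lemma aux_lint_int {G : Type*} [MeasurableSpace G] (ν : Measure G) (d : G → ℝ) (hd : Measurable d)
    (δ : ℝ) (hδ : 0 ≤ δ) (h : ∫⁻ z, ENNReal.ofReal (d z ^ 2) ∂ν ≤ ENNReal.ofReal δ) :
    Integrable (fun z => d z ^ 2) ν ∧ ∫ z, d z ^ 2 ∂ν ≤ δ := by
  have h0 : 0 ≤ᵐ[ν] fun z => d z ^ 2 := Filter.Eventually.of_forall fun z => sq_nonneg _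
  refine ⟨⟨(hd.pow_const 2).aestronglyMeasurable, ?_⟩, ?_⟩
  · rw [hasFiniteIntegral_iff_ofReal h0]
    exact h.trans_lt ENNReal.ofReal_lt_top
  · rw [integral_eq_lintegral_of_nonneg_ae h0 (hd.pow_const 2).aestronglyMeasurable]
    exact ENNReal.toReal_le_of_le_ofReal hδ h

lemma aux_lim {G : Type*} [NormedAddCommGroup G] [NormedSpace ℝ G] [FiniteDimensional ℝ G]
    [MeasurableSpace G] [BorelSpace G] (μ : Measure G) [μ.IsAddHaarMeasure]
    (Un : ℕ → G → ℝ) (U W k p : G → ℝ) (Ψ : ℝ → ℝ) (C : ℝ)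
    (hUn : ∀ n, Continuous (Un n)) (hUnC : ∀ n z, |Un n z| ≤ C)
    (hlim : ∀ᵐ z ∂μ, Filter.Tendsto (fun n => Un n z) Filter.atTop (nhds (U z)))
    (hW : Continuous W) (hk : LocallyIntegrable k μ) (hp : Continuous p) (hps : HasCompactSupport p)
    (hΨ : Continuous Ψ) :
    Filter.Tendsto (fun n => ∫ z, k z * (Ψ (Un n z - W z) * p z) ∂μ) Filter.atTop
      (nhds (∫ z, k z * (Ψ (U z - W z) * p z) ∂μ)) := by
  have : ProperSpace G := FiniteDimensional.proper_real G
  obtain ⟨CW, hCW⟩ := hps.isCompact.exists_bound_of_continuousOn hW.continuousOn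
  obtain ⟨M, hM⟩ := (isCompact_Icc (a := -(C + CW)) (b := C + CW)).exists_bound_of_continuousOn hΨ.continuousOn
  refine tendsto_integral_of_dominated_convergence (fun z => ‖k z * p z‖ * M) ?_ ?_ ?_ ?_
  · intro n
    exact hk.aestronglyMeasurable.mul
      ((hΨ.comp ((hUn n).sub hW)).mul hp).aestronglyMeasurable
  · exact (aux_int_mul hk hp hps).norm.mul_const M
  · intro n
    refine Filter.Eventually.of_forall fun z => ?_
    by_cases hz : z ∈ tsupport p
    · have h1 := abs_le.1 (hUnC n z)
      have h2 := abs_le.1 (hCW z hz)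
      have := hM (Un n z - W z) ⟨by linarith, by linarith⟩
      calc ‖k z * (Ψ (Un n z - W z) * p z)‖ = ‖k z * p z‖ * ‖Ψ (Un n z - W z)‖ := by
            rw [← norm_mul]; congr 1; ring
        _ ≤ _ := mul_le_mul_of_nonneg_left this (norm_nonneg _)
    · have := image_eq_zero_of_notMem_tsupport hz
      simp [this]
  · filter_upwards [hlim] with z hz
    exact (((hΨ.tendsto _).comp (hz.sub_const (W z))).mul_const (p z)).const_mul (k z)

lemma aux_common_r {ι : Type*} [Finite ι] (P : ι → ℝ → Prop) 
    (h : ∀ i, ∃ r > 0, ∀ r', r' ≤ r → P i r') : ∃ r > 0, ∀ i, ∀ r', r' ≤ r → P i r' := by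
  choose r hr hP using h
  have : ∀ᶠ s in nhdsWithin (0:ℝ) (Ioi 0), ∀ i, s ≤ r i := by
    rw [Filter.eventually_all]
    intro i
    filter_upwards [Ioc_mem_nhdsGT (hr i)] with s hs using hs.2
  obtain ⟨s, hs, hs0⟩ := (this.and self_mem_nhdsWithin).exists
  exact ⟨s, hs0, fun i r' h' => hP i r' (h'.trans (hs i))⟩

lemma aux_sqdiff {G : Type*} [NormedAddCommGroup G] [NormedSpace ℝ G] [FiniteDimensional ℝ G]
    [MeasurableSpace G] [BorelSpace G] (μ : Measure G) [μ.IsAddHaarMeasure]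
    (g d : G → ℝ) (hg : Measurable g) (hd : Measurable d) (y : G) (δ R : ℝ) (hδ : 0 < δ)
    (h1 : ∫⁻ z in Metric.closedBall 0 R, ENNReal.ofReal ((g (z - y) - g z) ^ 2) ∂μ ≤ ENNReal.ofReal (δ / 4))
    (h2 : ∫⁻ z in Metric.closedBall 0 R, ENNReal.ofReal ((d z - g z) ^ 2) ∂μ ≤ ENNReal.ofReal (δ / 4)) :
    IntegrableOn (fun z => (g (z - y) - d z) ^ 2) (Metric.closedBall 0 R) μ ∧
    ∫ z in Metric.closedBall 0 R, (g (z - y) - d z) ^ 2 ∂μ ≤ δ := by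
  have hgy : Measurable (fun z => g (z - y)) := hg.comp (measurable_id.sub_const y)
  obtain ⟨i1, b1⟩ := aux_lint_int _ (fun z => g (z - y) - g z) (hgy.sub hg) _ (by positivity) h1
  obtain ⟨i2, b2⟩ := aux_lint_int _ (fun z => d z - g z) (hd.sub hg) _ (by positivity) h2
  have key : ∀ z, (g (z - y) - d z) ^ 2 ≤ 2 * (g (z - y) - g z) ^ 2 + 2 * (d z - g z) ^ 2 := by
    intro z; nlinarith [sq_nonneg ((g (z - y) - g z) + (d z - g z))]
  have i3 := (i1.const_mul 2).add (i2.const_mul 2)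
  have i4 : IntegrableOn (fun z => (g (z - y) - d z) ^ 2) (Metric.closedBall 0 R) μ := by
    refine i3.mono' ((hgy.sub hd).pow_const 2).aestronglyMeasurable (Filter.Eventually.of_forall fun z => ?_)
    rw [Real.norm_eq_abs, abs_of_nonneg (sq_nonneg _)]
    exact key z
  refine ⟨i4, ?_⟩
  have := integral_mono i4 i3 key
  refine this.trans ?_
  have e : ∫ z in Metric.closedBall 0 R, (2 * (g (z - y) - g z) ^ 2 + 2 * (d z - g z) ^ 2) ∂μ
    = 2 * ∫ z in Metric.closedBall 0 R, (g (z - y) - g z) ^ 2 ∂μ + 2 * ∫ z in Metric.closedBall 0 R, (d z - g z) ^ 2 ∂μ := by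
    rw [integral_add (i1.const_mul 2) (i2.const_mul 2), integral_const_mul, integral_const_mul]
  calc _ = _ := e
    _ ≤ _ := by linarith

set_option maxHeartbeats 2000000 in
open Convolution in
lemma aux_R1 {G : Type*} [NormedAddCommGroup G] [NormedSpace ℝ G] [FiniteDimensional ℝ G]
    [MeasurableSpace G] [BorelSpace G] (μ : Measure G) [μ.IsAddHaarMeasure]
    {ι : Type*} [Fintype ι] (e0 : G) (e : ι → G)
    (g : ι → G → ℝ) (f U v : G → ℝ) (hgm : ∀ i, Measurable (g i)) (hfm : Measurable f)
    (hUm : Measurable U) (C : ℝ) (hUC : ∀ z, |U z| ≤ C)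
    (hg2 : ∀ i, ∀ R : ℝ, IntegrableOn (fun z => g i z ^ 2) (Metric.closedBall 0 R) μ)
    (hf2 : ∀ R : ℝ, IntegrableOn (fun z => f z ^ 2) (Metric.closedBall 0 R) μ)
    (hv : LocallyIntegrable v μ)
    (I1 : ∀ ζ : G → ℝ, ContDiff ℝ 1 ζ → HasCompactSupport ζ →
      ∫ z, v z * fderiv ℝ ζ z e0 ∂μ = ∫ z, ((∑ i, g i z * fderiv ℝ ζ z (e i)) + f z * ζ z) ∂μ)
    (I2 : ∀ i, ∀ ζ : G → ℝ, ContDiff ℝ 1 ζ → HasCompactSupport ζ →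
      ∫ z, U z * fderiv ℝ ζ z (e i) ∂μ = - ∫ z, g i z * ζ z ∂μ)
    (W φ : G → ℝ) (hW : ContDiff ℝ 1 W) (hφ : ContDiff ℝ 2 φ)
    (hWd : ∀ i, Differentiable ℝ (fun z => fderiv ℝ W z (e i)))
    (hWL : ∀ i, LocallyIntegrable (fun z => fderiv ℝ (fun z => fderiv ℝ W z (e i)) z (e i)) μ)
    (hφs : HasCompactSupport φ) (hφ0 : ∀ z, 0 ≤ φ z) (δ : ℝ) (hδ : 0 < δ) :
    ∃ r > 0, ∀ h, 0 < h → h ≤ r →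
      ∫ z, (v z - v (z - h • e0)) * (max (U z - W z) 0 ^ 2 * φ z) ∂μ ≤
      h * ((∑ i, ∫ z, (max (U z - W z) 0 ^ 3 / 3) *
          fderiv ℝ (fun z => fderiv ℝ φ z (e i)) z (e i) ∂μ)
        + (∑ i, ∫ z, fderiv ℝ (fun z => fderiv ℝ W z (e i)) z (e i) *
          (max (U z - W z) 0 ^ 2 * φ z) ∂μ)
        - (∫ z, f z * (max (U z - W z) 0 ^ 2 * φ z) ∂μ) + δ) := by
  have : ProperSpace G := FiniteDimensional.proper_real G
  have hφ1 : ContDiff ℝ 1 φ := hφ.of_le (by norm_num)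
  obtain ⟨R, hR⟩ := hφs.isCompact.isBounded.subset_closedBall 0
  have hC0 : 0 ≤ C := (abs_nonneg _).trans (hUC 0)
  obtain ⟨CW, hCW⟩ := hφs.isCompact.exists_bound_of_continuousOn hW.continuous.continuousOn
  have cφi : ∀ i, ContDiff ℝ 1 (fun z => fderiv ℝ φ z (e i)) := fun i =>
    (hφ.fderiv_right (m := 1) (by norm_num)).clm_apply contDiff_const
  have hφis : ∀ i, HasCompactSupport (fun z => fderiv ℝ φ z (e i)) := fun i => hφs.fderiv_apply ℝ (e i)
  have cφii : ∀ i, Continuous (fun z => fderiv ℝ (fun z => fderiv ℝ φ z (e i)) z (e i)) := fun i =>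
    ((cφi i).continuous_fderiv (by norm_num)).clm_apply continuous_const
  obtain ⟨B0, hB0⟩ := hφ.continuous.bounded_above_of_compact_support hφs
  choose Bi hBi using fun i => (cφi i).continuous.bounded_above_of_compact_support (hφis i)
  set B : ℝ := |B0| + ∑ i, |Bi i| with hB
  have hBn : 0 ≤ B := by positivity
  have hφB : ∀ z, |φ z| ≤ B := fun z => by
    have := hB0 z
    have h2 : 0 ≤ ∑ i, |Bi i| := by positivity
    rw [Real.norm_eq_abs] at this
    have := le_abs_self B0; linarith
  have hφiB : ∀ z i, |fderiv ℝ φ z (e i)| ≤ B := fun z i => by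
    have := hBi i z
    have h2 : |Bi i| ≤ ∑ i, |Bi i| := Finset.single_le_sum (f := fun i => |Bi i|) (fun _ _ => abs_nonneg _) (Finset.mem_univ i)
    rw [Real.norm_eq_abs] at this
    have := le_abs_self (Bi i)
    have := abs_nonneg B0; linarith
  set P : ℝ := C + |CW| with hP
  have hP0 : 0 ≤ P := by positivity
  set A : ℝ := 2 * P * B + P ^ 2 * B with hA
  have hA0 : 0 ≤ A := by positivity
  set c : ℝ := Fintype.card ι + 1 with hc
  have hc0 : 0 < c := by positivity
  set m0 : ℝ := μ.real (Metric.closedBall (0:G) R) with hm0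
  have hm00 : 0 ≤ m0 := measureReal_nonneg
  clear_value B P A c m0
  set κ : ℝ := δ / (2 * c * (A * m0 + 1)) with hκ
  have hκ0 : 0 < κ := by positivity
  set δ1 : ℝ := δ / (2 * c * (A + A / κ + 1)) with hδ1
  have hδ10 : 0 < δ1 := by positivity
  have hsmall : c * (A * κ * m0 + (A + A / κ) * δ1) ≤ δ := by
    have h1 : c * (A * κ * m0) ≤ δ / 2 := by
      have : c * (A * κ * m0) = (δ / 2) * ((A * m0) / (A * m0 + 1)) := by rw [hκ]; field_simp
      rw [this]
      have : (A * m0) / (A * m0 + 1) ≤ 1 := by rw [div_le_one (by positivity)]; linarith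
      nlinarith
    have h2 : c * ((A + A / κ) * δ1) ≤ δ / 2 := by
      have hh : 0 ≤ A / κ := by positivity
      have : c * ((A + A / κ) * δ1) = (δ / 2) * ((A + A / κ) / (A + A / κ + 1)) := by
        rw [hδ1]; generalize A / κ = x at *; field_simp
      rw [this]
      have : (A + A / κ) / (A + A / κ + 1) ≤ 1 := by rw [div_le_one (by positivity)]; linarith
      nlinarith
    linarith
  obtain ⟨r1, hr1, hr1'⟩ := aux_common_r (fun i (r : ℝ) => ∀ y : G, ‖y‖ = r →
      ∫⁻ z in Metric.closedBall 0 R, ENNReal.ofReal ((g i (z - y) - g i z) ^ 2) ∂μ ≤ ENNReal.ofReal (δ1 / 4))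
      (fun i => by
        obtain ⟨r, hr, h⟩ := aux_transl_L2 μ (g i) (hgm i) (hg2 i) R (δ1 / 4) (by positivity)
        exact ⟨r, hr, fun r' hr' y hy => h y (hy.le.trans hr')⟩)
  obtain ⟨r2, hr2, hr2'⟩ := aux_common_r (fun i (r : ℝ) => ∀ ρ : ContDiffBump (0:G), ρ.rOut = r →
      ∫⁻ z in Metric.closedBall 0 R,
        ENNReal.ofReal (((∫ y, ρ.normed μ y * g i (z - y) ∂μ) - g i z) ^ 2) ∂μ ≤ ENNReal.ofReal (δ1 / 4))
      (fun i => by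
        obtain ⟨r, hr, h⟩ := aux_mollify_L2 μ (g i) (hgm i) (hg2 i) R (δ1 / 4) (by positivity)
        exact ⟨r, hr, fun r' hr' ρ hρ => h ρ (hρ.le.trans hr')⟩)
  obtain ⟨r3, hr3, hr3'⟩ := aux_transl_L2 μ f hfm hf2 R δ1 hδ10
  refine ⟨min r1 r3 / (‖e0‖ + 1), by positivity, fun h hh hhr => ?_⟩
  have hyr : ∀ s, 0 ≤ s → s ≤ h → ‖s • e0‖ ≤ min r1 r3 := by
    intro s hs0 hs
    rw [norm_smul, Real.norm_eq_abs, abs_of_nonneg hs0]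
    have h1 : s ≤ min r1 r3 / (‖e0‖ + 1) := hs.trans hhr
    rw [le_div_iff₀ (by positivity)] at h1
    have := norm_nonneg e0
    nlinarith
  have hgl : ∀ i, LocallyIntegrable (g i) μ := fun i => aux_locInt_of_sq μ (g i) (hgm i) (hg2 i)
  have hfl : LocallyIntegrable f μ := aux_locInt_of_sq μ f hfm hf2
  have hUl : LocallyIntegrable U μ := by
    refine (locallyIntegrable_const C).mono hUm.aestronglyMeasurable (Filter.Eventually.of_forall fun z => ?_)
    exact (hUC z).trans (le_abs_self _)
  have step : ∀ ρ : ContDiffBump (0:G), ρ.rOut ≤ r2 → ∀ Q : G → ℝ, Q = (fun z => ∫ y, ρ.normed μ y * U (z - y) ∂μ) →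
      (- (∑ i, ∫ z, (max (Q z - W z) 0 ^ 3 / 3) *
          fderiv ℝ (fun z => fderiv ℝ φ z (e i)) z (e i) ∂μ)
      - (∑ i, ∫ z, fderiv ℝ (fun z => fderiv ℝ W z (e i)) z (e i) *
          (max (Q z - W z) 0 ^ 2 * φ z) ∂μ)
      + (∫ z, f z * (max (Q z - W z) 0 ^ 2 * φ z) ∂μ)
      - δ) * h ≤ ∫ z, (v (z - h • e0) - v z) * (max (Q z - W z) 0 ^ 2 * φ z) ∂μ := by
    intro ρ hρ Q hQd
    obtain ⟨hQ, hQC, hQf⟩ := aux_moll_smooth μ U hUm C hUC ρ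
    rw [← hQd] at hQ hQf
    have hQC' : ∀ z, |Q z| ≤ C := by rw [hQd]; exact hQC
    have hM : ∀ z, z ∈ tsupport φ → max (Q z - W z) 0 ≤ P := by
      intro z hz
      have h1 := abs_le.1 (hQC' z)
      have h2 := abs_le.1 (hCW z hz)
      have := le_abs_self CW
      exact max_le (by linarith) hP0
    have hout : ∀ z, z ∉ tsupport φ → φ z = 0 ∧ ∀ i, fderiv ℝ φ z (e i) = 0 := by
      intro z hz'
      refine ⟨image_eq_zero_of_notMem_tsupport hz', fun i => ?_⟩
      rw [image_eq_zero_of_notMem_tsupport (f := fderiv ℝ φ) (fun h => hz' (tsupport_fderiv_subset ℝ h))]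
      rfl
    have a1 : ∀ z, 2 * max (Q z - W z) 0 * φ z ≤ A := by
      intro z
      by_cases hz : z ∈ tsupport φ
      · have h1 := hM z hz
        have h2 := (abs_le.1 (hφB z)).2
        have : 2 * max (Q z - W z) 0 * φ z ≤ 2 * P * B := by
          have := hφ0 z
          gcongr
        have : 0 ≤ P ^ 2 * B := by positivity
        linarith
      · rw [(hout z hz).1]; simpa using hA0
    have a23 : ∀ z x, |x| ≤ B → z ∈ tsupport φ → |max (Q z - W z) 0 ^ 2 * x| ≤ A := by
      intro z x hx hz
      rw [abs_mul, abs_of_nonneg (sq_nonneg _)]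
      have h1 := hM z hz
      have h0 : 0 ≤ max (Q z - W z) 0 := le_max_right _ _
      have : max (Q z - W z) 0 ^ 2 * |x| ≤ P ^ 2 * B := by gcongr
      have : 0 ≤ 2 * P * B := by positivity
      linarith
    have a2 : ∀ z i, |max (Q z - W z) 0 ^ 2 * fderiv ℝ φ z (e i)| ≤ A := by
      intro z i
      by_cases hz : z ∈ tsupport φ
      · exact a23 z _ (hφiB z i) hz
      · rw [(hout z hz).2 i]; simpa using hA0
    have a3 : ∀ z, |max (Q z - W z) 0 ^ 2 * φ z| ≤ A := by
      intro z
      by_cases hz : z ∈ tsupport φ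
      · exact a23 z _ (hφB z) hz
      · rw [(hout z hz).1]; simpa using hA0
    obtain ⟨cη, -, -, -⟩ := aux_eta (fun z => Q z - W z) φ (hQ.sub hW) hφ1
    have hηs : HasCompactSupport (fun z => max (Q z - W z) 0 ^ 2 * φ z) := hφs.mul_left
    have T := aux_timeMV μ v _ hv cη hηs e0 h (- (∑ i, ∫ z, (max (Q z - W z) 0 ^ 3 / 3) *
          fderiv ℝ (fun z => fderiv ℝ φ z (e i)) z (e i) ∂μ)
      - (∑ i, ∫ z, fderiv ℝ (fun z => fderiv ℝ W z (e i)) z (e i) *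
          (max (Q z - W z) 0 ^ 2 * φ z) ∂μ)
      + (∫ z, f z * (max (Q z - W z) 0 ^ 2 * φ z) ∂μ)
      - δ) hh.le (fun s hs0 hs => by
        have hy := hyr s hs0 hs
        set y := s • e0 with hy'
        have hgd : ∀ i, _ := fun i => aux_sqdiff μ (g i) (fun z => fderiv ℝ Q z (e i)) (hgm i)
          ((hQ.continuous_fderiv (by norm_num)).clm_apply continuous_const).measurable y δ1 R hδ10
          (hr1' i ‖y‖ (hy.trans (min_le_left _ _)) y rfl)
          (by
            have := hr2' i ρ.rOut hρ ρ rfl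
            simp only [← hQf (e i) (g i) (I2 i)] at this
            exact this)
        have hfd := aux_lint_int (μ.restrict (Metric.closedBall 0 R)) (fun z => f (z - y) - f z)
          ((hfm.comp (measurable_id.sub_const y)).sub hfm) δ1 hδ10.le (hr3' y (hy.trans (min_le_right _ _)))
        have key := aux_coreD μ e g f hgl hfl Q W φ hQ hW hφ hWd hWL hφs hφ0 R hR A a1 a2 a3 y κ δ1 hκ0
          (fun i => (hgd i).1) (fun i => (hgd i).2) hfd.1 hfd.2
        have e1 := I1 (fun z => (fun z => max (Q z - W z) 0 ^ 2 * φ z) (z + y))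
          (cη.comp (contDiff_id.add contDiff_const)) (hηs.comp_homeomorph (Homeomorph.addRight y))
        have efd : ∀ z, fderiv ℝ (fun z => (fun z => max (Q z - W z) 0 ^ 2 * φ z) (z + y)) z
            = fderiv ℝ (fun z => max (Q z - W z) 0 ^ 2 * φ z) (z + y) := fun z => fderiv_comp_add_right (𝕜 := ℝ) (f := fun z => max (Q z - W z) 0 ^ 2 * φ z) (x := z) y
        simp only [efd] at e1
        rw [e1]
        rw [← hm0, ← hc] at key
        refine le_trans ?_ key
        linarith)
    refine T.trans (le_of_eq ?_)
    have i1 : Integrable (fun z => v z * (max (Q (z + h • e0) - W (z + h • e0)) 0 ^ 2 * φ (z + h • e0))) μ :=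
      aux_int_mul hv (cη.continuous.comp (continuous_add_const (h • e0)))
        (hηs.comp_homeomorph (Homeomorph.addRight (h • e0)))
    have i2 := i1.comp_sub_right (h • e0)
    have i3 : Integrable (fun z => v z * (max (Q z - W z) 0 ^ 2 * φ z)) μ := aux_int_mul hv cη.continuous hηs
    have e2 := integral_sub_right_eq_self (μ := μ) (fun z => v z * (max (Q (z + h • e0) - W (z + h • e0)) 0 ^ 2 * φ (z + h • e0))) (h • e0)
    simp only [sub_add_cancel] at e2 i2
    rw [← e2, ← integral_sub i2 i3]
    congr 1; ext z; ring
  -- limit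
  set ρ : ℕ → ContDiffBump (0:G) := fun n => ⟨r2 / (n + 1) / 2, r2 / (n + 1), by positivity,
    half_lt_self (by positivity)⟩ with hρ
  have hρr : ∀ n, (ρ n).rOut ≤ r2 := fun n => by
    change r2 / (n + 1) ≤ r2
    exact div_le_self hr2.le (by have : (0:ℝ) ≤ n := by positivity
                                 linarith)
  set Un : ℕ → G → ℝ := fun n z => ∫ y, (ρ n).normed μ y * U (z - y) ∂μ with hUn
  have hUnlim : ∀ᵐ z ∂μ, Filter.Tendsto (fun n => Un n z) Filter.atTop (nhds (U z)) := by
    refine ContDiffBump.ae_convolution_tendsto_right_of_locallyIntegrable (K := 2) (φ := ρ) (μ := μ) (g := U) ?_ ?_ hUl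
    · change Filter.Tendsto (fun n : ℕ => r2 / ((n:ℝ) + 1)) Filter.atTop (nhds 0)
      exact tendsto_const_div_atTop_nhds_zero_nat r2 |>.comp (Filter.tendsto_add_atTop_nat 1) |>.congr (fun n => by simp)
    · refine Filter.Eventually.of_forall fun n => ?_
      change r2 / ((n:ℝ) + 1) ≤ 2 * (r2 / (n + 1) / 2)
      linarith
  have hUnc : ∀ n, Continuous (Un n) := fun n => (aux_moll_smooth μ U hUm C hUC (ρ n)).1.continuous
  have hUnC : ∀ n z, |Un n z| ≤ C := fun n => (aux_moll_smooth μ U hUm C hUC (ρ n)).2.1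
  have hvh : LocallyIntegrable (fun z => v (z - h • e0) - v z) μ := by
    refine LocallyIntegrable.sub ?_ hv
    rw [locallyIntegrable_iff]
    intro K hK
    have h1 := (hv.integrableOn_isCompact (hK.image ((continuous_id.sub continuous_const : Continuous fun z : G => z - h • e0))))
    have mp := measurePreserving_sub_right μ (h • e0)
    have := (mp.integrableOn_comp_preimage (Homeomorph.subRight (h • e0)).measurableEmbedding).2 h1
    refine this.mono_set ?_
    exact subset_preimage_image _ _
  have l1 : ∀ i, Filter.Tendsto (fun n => ∫ z, (max (Un n z - W z) 0 ^ 3 / 3) *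
          fderiv ℝ (fun z => fderiv ℝ φ z (e i)) z (e i) ∂μ) Filter.atTop
      (nhds (∫ z, (max (U z - W z) 0 ^ 3 / 3) * fderiv ℝ (fun z => fderiv ℝ φ z (e i)) z (e i) ∂μ)) := by
    intro i
    have := aux_lim μ Un U W (fun _ => 1) (fun z => fderiv ℝ (fun z => fderiv ℝ φ z (e i)) z (e i))
      (fun s => max s 0 ^ 3 / 3) C hUnc hUnC hUnlim hW.continuous (locallyIntegrable_const 1) (cφii i)
      ((hφis i).fderiv_apply ℝ (e i)) (by fun_prop)
    simpa only [one_mul] using this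
  have l2 : ∀ k, LocallyIntegrable k μ → Filter.Tendsto (fun n => ∫ z, k z * (max (Un n z - W z) 0 ^ 2 * φ z) ∂μ) Filter.atTop
      (nhds (∫ z, k z * (max (U z - W z) 0 ^ 2 * φ z) ∂μ)) := by
    intro k hk
    exact aux_lim μ Un U W k φ (fun s => max s 0 ^ 2) C hUnc hUnC hUnlim hW.continuous hk hφ.continuous
      hφs (by fun_prop)
  have LL := ((((tendsto_finsetSum Finset.univ fun i _ => l1 i).neg.sub
    (tendsto_finsetSum Finset.univ fun i _ => l2 _ (hWL i))).add (l2 f hfl)).sub_const δ).mul_const h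
  have fin := le_of_tendsto_of_tendsto LL (l2 _ hvh) (Filter.Eventually.of_forall fun n => step (ρ n) (hρr n) (Un n) rfl)
  have neg : ∫ z, (v z - v (z - h • e0)) * (max (U z - W z) 0 ^ 2 * φ z) ∂μ
     = - ∫ z, (v (z - h • e0) - v z) * (max (U z - W z) 0 ^ 2 * φ z) ∂μ := by
    rw [← integral_neg]; congr 1; ext z; ring
  rw [neg]
  linarith

def FF (m r W : ℝ) : ℝ := ∫ ρ in (0:ℝ)..r, max (ρ ^ m - W) 0 ^ 2
def KK (m r W : ℝ) : ℝ := ∫ ρ in (0:ℝ)..r, 2 * max (ρ ^ m - W) 0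

lemma FF_cont (m : ℝ) (hm : 1 < m) : Continuous (fun p : ℝ × ℝ => FF m p.1 p.2) := by
  unfold FF
  have hc : Continuous (fun ρ : ℝ => ρ ^ m) := Real.continuous_rpow_const (by linarith)
  have h1 : Continuous (fun q : ℝ × ℝ => max (q.2 ^ m - q.1) 0 ^ 2) := by
    have := hc.comp (continuous_snd (X := ℝ) (Y := ℝ))
    exact ((this.sub continuous_fst).max continuous_const).pow 2
  have := intervalIntegral.continuous_parametric_primitive_of_continuous (μ := volume) (a₀ := 0)
    (f := fun W ρ => max (ρ ^ m - W) 0 ^ 2) h1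
  exact this.comp continuous_swap

lemma KK_cont (m : ℝ) (hm : 1 < m) : Continuous (fun p : ℝ × ℝ => KK m p.1 p.2) := by
  unfold KK
  have hc : Continuous (fun ρ : ℝ => ρ ^ m) := Real.continuous_rpow_const (by linarith)
  have h1 : Continuous (fun q : ℝ × ℝ => 2 * max (q.2 ^ m - q.1) 0) := by
    have := hc.comp (continuous_snd (X := ℝ) (Y := ℝ))
    exact continuous_const.mul ((this.sub continuous_fst).max continuous_const)
  have := intervalIntegral.continuous_parametric_primitive_of_continuous (μ := volume) (a₀ := 0)
    (f := fun W ρ => 2 * max (ρ ^ m - W) 0) h1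
  exact this.comp continuous_swap

lemma HH_cont (m : ℝ) (hm : 1 < m) (W : ℝ) : Continuous (fun ρ : ℝ => max (ρ ^ m - W) 0 ^ 2) := by
  have hc : Continuous (fun ρ : ℝ => ρ ^ m) := Real.continuous_rpow_const (by linarith)
  exact ((hc.sub continuous_const).max continuous_const).pow 2

lemma HH_mono (m : ℝ) (hm : 1 < m) (W a b : ℝ) (ha : 0 ≤ a) (hab : a ≤ b) :
    max (a ^ m - W) 0 ^ 2 ≤ max (b ^ m - W) 0 ^ 2 := by
  have : a ^ m ≤ b ^ m := Real.rpow_le_rpow ha hab (by linarith)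
  have h2 : max (a ^ m - W) 0 ≤ max (b ^ m - W) 0 := max_le_max (by linarith) le_rfl
  exact pow_le_pow_left₀ (le_max_right _ _) h2 2

lemma FF_sub (m : ℝ) (hm : 1 < m) (W a b : ℝ) :
    FF m a W - FF m b W = ∫ ρ in b..a, max (ρ ^ m - W) 0 ^ 2 := by
  unfold FF
  rw [intervalIntegral.integral_interval_sub_left] <;> exact (HH_cont m hm W).intervalIntegrable _ _

lemma FF_convex (m : ℝ) (hm : 1 < m) (W a b : ℝ) (ha : 0 ≤ a) (hb : 0 ≤ b) :
    FF m a W - FF m b W ≤ (a - b) * max (a ^ m - W) 0 ^ 2 := by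
  rw [FF_sub m hm]
  rcases le_total b a with h | h
  · have := intervalIntegral.integral_mono_on (μ := volume) h ((HH_cont m hm W).intervalIntegrable b a)
      (g := fun _ => max (a ^ m - W) 0 ^ 2) (continuous_const.intervalIntegrable _ _)
      (fun x hx => HH_mono m hm W x a (hb.trans hx.1) hx.2)
    simpa using this
  · rw [intervalIntegral.integral_symm]
    have := intervalIntegral.integral_mono_on (μ := volume) h (f := fun _ => max (a ^ m - W) 0 ^ 2) (continuous_const.intervalIntegrable _ _)
      ((HH_cont m hm W).intervalIntegrable a b) 
      (fun x hx => HH_mono m hm W a x ha hx.1)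
    simp only [intervalIntegral.integral_const, smul_eq_mul] at this
    linarith

lemma FF_zero (m W : ℝ) : FF m 0 W = 0 := by simp [FF]
lemma KK_zero (m W : ℝ) : KK m 0 W = 0 := by simp [KK]

lemma FF_nonneg (m r W : ℝ) (hr : 0 ≤ r) : 0 ≤ FF m r W := by
  unfold FF
  exact intervalIntegral.integral_nonneg hr fun x _ => sq_nonneg _

lemma KK_nonneg (m r W : ℝ) (hr : 0 ≤ r) : 0 ≤ KK m r W := by
  unfold KK
  exact intervalIntegral.integral_nonneg hr fun x _ => by positivity

lemma FF_eq_zero (m : ℝ) (hm : 1 < m) (r W : ℝ) (hr : 0 ≤ r) (h : r ^ m ≤ W) : FF m r W = 0 := by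
  have h1 := FF_convex m hm W r 0 hr le_rfl
  rw [FF_zero, max_eq_right (by linarith)] at h1
  have := FF_nonneg m r W hr
  nlinarith

lemma FF_hasDerivAt_r (m : ℝ) (hm : 1 < m) (r W : ℝ) :
    HasDerivAt (fun r => FF m r W) (max (r ^ m - W) 0 ^ 2) r := by
  unfold FF
  exact intervalIntegral.integral_hasDerivAt_right ((HH_cont m hm W).intervalIntegrable _ _)
    ((HH_cont m hm W).stronglyMeasurableAtFilter _ _) (HH_cont m hm W).continuousAt

lemma FF_G (m : ℝ) (hm : 1 < m) (r C W : ℝ) (hr : 0 ≤ r) (hC : r ≤ C) (hW : 0 ≤ W) :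
    max (r ^ m - W) 0 ^ 3 / 3 ≤ m * C ^ (m - 1) * FF m r W := by
  have hd : ∀ s, HasDerivAt (fun s => m * C ^ (m - 1) * FF m s W - max (s ^ m - W) 0 ^ 3 / 3)
      (m * C ^ (m - 1) * max (s ^ m - W) 0 ^ 2 - max (s ^ m - W) 0 ^ 2 * (m * s ^ (m - 1))) s := by
    intro s
    have h1 := (FF_hasDerivAt_r m hm s W).const_mul (m * C ^ (m - 1))
    have h2 : HasDerivAt (fun s : ℝ => s ^ m - W) (m * s ^ (m - 1)) s :=
      (Real.hasDerivAt_rpow_const (Or.inr hm.le)).sub_const W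
    have h3 := ((posp_hasDerivAt 1 (s ^ m - W)).comp s h2).div_const 3
    refine (h1.sub h3).congr_deriv ?_
    push_cast; ring
  have := monotoneOn_of_deriv_nonneg (convex_Icc 0 C)
    (fun s _ => (hd s).continuousAt.continuousWithinAt)
    (fun s _ => (hd s).differentiableAt.differentiableWithinAt)
    (fun s hs => by
      rw [(hd s).deriv]
      have hs := interior_subset hs
      have : s ^ (m - 1) ≤ C ^ (m - 1) := Real.rpow_le_rpow hs.1 hs.2 (by linarith)
      have h2 := mul_nonneg (mul_nonneg (by linarith : 0 ≤ m) (sq_nonneg (max (s ^ m - W) 0))) (sub_nonneg.2 this)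
      nlinarith) ⟨le_rfl, hr.trans hC⟩ ⟨hr, hC⟩ hr
  simp only [FF_zero] at this
  rw [Real.zero_rpow (by linarith), max_eq_right (by linarith)] at this
  simp at this
  linarith

lemma le_of_FF_eq_zero (m : ℝ) (hm : 1 < m) (r W : ℝ) (hr : 0 ≤ r) (hW : 0 ≤ W) (h : FF m r W = 0) : r ^ m ≤ W := by
  have h1 := FF_G m hm r r W hr le_rfl hW
  rw [h, mul_zero] at h1
  by_contra hc
  push Not at hc
  rw [max_eq_left (by linarith)] at h1
  have : 0 < (r ^ m - W) ^ 3 := pow_pos (by linarith) 3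
  linarith

lemma FF_hasDerivAt_W (m : ℝ) (hm : 1 < m) (r W : ℝ) :
    HasDerivAt (fun W => FF m r W) (- KK m r W) W := by
  have hc : Continuous (fun ρ : ℝ => ρ ^ m) := Real.continuous_rpow_const (by linarith)
  have hcu : Continuous (fun p : ℝ × ℝ => -(2 * max (p.2 ^ m - p.1) 0)) := by
    have := hc.comp (continuous_snd (X := ℝ) (Y := ℝ))
    exact (continuous_const.mul ((this.sub continuous_fst).max continuous_const)).neg
  have hbd := ((isCompact_closedBall W 1).prod (isCompact_uIcc (a := 0) (b := r))).exists_bound_of_continuousOn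
    hcu.continuousOn
  obtain ⟨B, hB⟩ := hbd
  have := (intervalIntegral.hasDerivAt_integral_of_dominated_loc_of_deriv_le (μ := volume) (a := 0) (b := r)
    (F := fun W ρ => max (ρ ^ m - W) 0 ^ 2) (F' := fun W ρ => -(2 * max (ρ ^ m - W) 0)) (x₀ := W)
    (s := Metric.closedBall W 1) (bound := fun _ => B) (Metric.closedBall_mem_nhds _ one_pos)
    (Filter.Eventually.of_forall fun x => (HH_cont m hm x).aestronglyMeasurable)
    ((HH_cont m hm W).intervalIntegrable _ _)
    (hcu.comp (continuous_const.prodMk continuous_id : Continuous fun ρ : ℝ => (W, ρ))).aestronglyMeasurable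
    (Filter.Eventually.of_forall fun ρ hρ x hx => hB (x, ρ) ⟨hx, uIoc_subset_uIcc hρ⟩)
    (by simp)
    (Filter.Eventually.of_forall fun ρ hρ x hx => by
      have h1 := (posp_hasDerivAt 0 (ρ ^ m - x)).comp x ((hasDerivAt_id x).const_sub (ρ ^ m))
      refine h1.congr_deriv ?_
      simp)).2
  unfold KK FF
  refine this.congr_deriv ?_
  rw [intervalIntegral.integral_neg]

lemma aux_I_deriv {G : Type*} [NormedAddCommGroup G] [NormedSpace ℝ G] [FiniteDimensional ℝ G]
    [MeasurableSpace G] [BorelSpace G] (μ : Measure G) [μ.IsAddHaarMeasure]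
    (m : ℝ) (hm : 1 < m) (e0 : G) (w W φ : G → ℝ) (C : ℝ) (hwm : Measurable w)
    (hw0 : ∀ z, 0 ≤ w z) (hwC : ∀ z, w z ≤ C)
    (hW : ContDiff ℝ 1 W) (hφ : ContDiff ℝ 1 φ) (hφs : HasCompactSupport φ) :
    (∀ s : ℝ, Integrable (fun z => FF m (w z) (W (z + s • e0)) * φ (z + s • e0)) μ) ∧
    Integrable (fun z => -KK m (w z) (W z) * fderiv ℝ W z e0 * φ z + FF m (w z) (W z) * fderiv ℝ φ z e0) μ ∧
    HasDerivAt (fun s : ℝ => ∫ z, FF m (w z) (W (z + s • e0)) * φ (z + s • e0) ∂μ)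
      (∫ z, (-KK m (w z) (W z) * fderiv ℝ W z e0 * φ z + FF m (w z) (W z) * fderiv ℝ φ z e0) ∂μ) 0 := by
  have : ProperSpace G := FiniteDimensional.proper_real G
  have cφ' : Continuous (fun z => fderiv ℝ φ z e0) :=
    (hφ.continuous_fderiv (by norm_num)).clm_apply continuous_const
  have cW' : Continuous (fun z => fderiv ℝ W z e0) :=
    (hW.continuous_fderiv (by norm_num)).clm_apply continuous_const
  have cF : Continuous (fun p : ℝ × G => FF m p.1 (W p.2)) :=
    (FF_cont m hm).comp (continuous_fst.prodMk (hW.continuous.comp continuous_snd))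
  have cK : Continuous (fun p : ℝ × G => KK m p.1 (W p.2)) :=
    (KK_cont m hm).comp (continuous_fst.prodMk (hW.continuous.comp continuous_snd))
  set Φ : ℝ × G → ℝ := fun p => -KK m p.1 (W p.2) * fderiv ℝ W p.2 e0 * φ p.2 + FF m p.1 (W p.2) * fderiv ℝ φ p.2 e0 with hΦ
  have cΦ : Continuous Φ := by
    have h1 := cW'.comp (continuous_snd (X := ℝ) (Y := G))
    have h2 := cφ'.comp (continuous_snd (X := ℝ) (Y := G))
    have h3 := hφ.continuous.comp (continuous_snd (X := ℝ) (Y := G))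
    exact ((cK.neg.mul h1).mul h3).add (cF.mul h2)
  have cΨ : Continuous (fun p : ℝ × G => FF m p.1 (W p.2) * φ p.2) :=
    cF.mul (hφ.continuous.comp (continuous_snd (X := ℝ) (Y := G)))
  obtain ⟨R, hR⟩ := hφs.isCompact.isBounded.subset_closedBall 0
  have hout : ∀ z, z ∉ tsupport φ → φ z = 0 ∧ fderiv ℝ φ z e0 = 0 := by
    intro z hz'
    refine ⟨image_eq_zero_of_notMem_tsupport hz', ?_⟩
    rw [image_eq_zero_of_notMem_tsupport (f := fderiv ℝ φ) (fun h => hz' (tsupport_fderiv_subset ℝ h))]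
    rfl
  have gen : ∀ Θ : ℝ × G → ℝ, Continuous Θ → (∀ r z, z ∉ tsupport φ → Θ (r, z) = 0) →
      ∃ B, 0 ≤ B ∧ ∀ s : ℝ, ∀ z, ‖Θ (w z, z + s • e0)‖ ≤ (Metric.closedBall (0:G) (R + |s| * ‖e0‖)).indicator (fun _ => B) z := by
    intro Θ hΘ h0
    obtain ⟨B, hB⟩ := ((isCompact_Icc (a := 0) (b := C)).prod hφs.isCompact).exists_bound_of_continuousOn hΘ.continuousOn
    refine ⟨|B|, abs_nonneg _, fun s z => ?_⟩
    by_cases hz : z + s • e0 ∈ tsupport φ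
    · have hz2 : z ∈ Metric.closedBall (0:G) (R + |s| * ‖e0‖) := by
        have h1 := hR hz
        rw [mem_closedBall_zero_iff] at h1 ⊢
        have h2 : ‖z‖ ≤ ‖z + s • e0‖ + ‖s • e0‖ := by
          have := norm_sub_le (z + s • e0) (s • e0); simpa using this
        rw [norm_smul, Real.norm_eq_abs] at h2
        linarith
      rw [indicator_of_mem hz2]
      exact (hB (w z, z + s • e0) ⟨⟨hw0 z, hwC z⟩, hz⟩).trans (le_abs_self _)
    · rw [h0 _ _ hz, norm_zero]
      exact indicator_nonneg (fun _ _ => abs_nonneg _) _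
  have indI : ∀ R' B : ℝ, Integrable ((Metric.closedBall (0:G) R').indicator (fun _ => B)) μ := by
    intro R' B
    rw [integrable_indicator_iff Metric.isClosed_closedBall.measurableSet]
    exact integrableOn_const (isCompact_closedBall (0:G) R').measure_lt_top.ne
  have hmeas : ∀ Θ : ℝ × G → ℝ, Continuous Θ → ∀ s : ℝ, Measurable (fun z => Θ (w z, z + s • e0)) := by
    intro Θ hΘ s
    exact hΘ.measurable.comp (hwm.prodMk (measurable_id.add_const _))
  obtain ⟨B1, hB10, hB1⟩ := gen _ cΨ (fun r z hz => by simp [(hout z hz).1])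
  obtain ⟨B2, hB20, hB2⟩ := gen Φ cΦ (fun r z hz => by simp [hΦ, (hout z hz).1, (hout z hz).2])
  have int1 : ∀ s : ℝ, Integrable (fun z => FF m (w z) (W (z + s • e0)) * φ (z + s • e0)) μ := by
    intro s
    exact (indI _ B1).mono' (hmeas _ cΨ s).aestronglyMeasurable (Filter.Eventually.of_forall fun z => hB1 s z)
  have main := hasDerivAt_integral_of_dominated_loc_of_deriv_le (μ := μ) (s := Metric.ball (0:ℝ) 1) (x₀ := 0)
      (F := fun s z => FF m (w z) (W (z + s • e0)) * φ (z + s • e0))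
      (F' := fun s z => Φ (w z, z + s • e0))
      (bound := (Metric.closedBall (0:G) (R + 1 * ‖e0‖)).indicator (fun z => B2))
      (Metric.ball_mem_nhds _ one_pos)
      (Filter.Eventually.of_forall fun s => (int1 s).aestronglyMeasurable) (int1 0)
      (hmeas Φ cΦ 0).aestronglyMeasurable
      (Filter.Eventually.of_forall fun z s hs => by
        refine (hB2 s z).trans ?_
        refine indicator_le_indicator_of_subset (Metric.closedBall_subset_closedBall ?_) (fun _ => hB20) z
        rw [Metric.mem_ball, dist_zero_right, Real.norm_eq_abs] at hs
        gcongr)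
      (indI _ B2)
      (Filter.Eventually.of_forall fun z s _ => by
        have d1 : HasDerivAt (fun s : ℝ => z + s • e0) e0 s := by
          simpa using ((hasDerivAt_id s).smul_const e0).const_add z
        have d2 : HasFDerivAt φ (fderiv ℝ φ (z + s • e0)) (z + s • e0) :=
          (hφ.differentiable (by norm_num) _).hasFDerivAt
        have d3 : HasFDerivAt W (fderiv ℝ W (z + s • e0)) (z + s • e0) :=
          (hW.differentiable (by norm_num) _).hasFDerivAt
        have d4 := (FF_hasDerivAt_W m hm (w z) (W (z + s • e0))).comp s (d3.comp_hasDerivAt s d1)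
        exact d4.mul (d2.comp_hasDerivAt s d1))
  refine ⟨int1, ?_, ?_⟩
  · simpa [hΦ] using main.1
  · simpa only [hΦ, zero_smul, add_zero] using main.2

set_option maxHeartbeats 1000000 in
lemma aux_R3 {G : Type*} [NormedAddCommGroup G] [NormedSpace ℝ G] [FiniteDimensional ℝ G]
    [MeasurableSpace G] [BorelSpace G] (μ : Measure G) [μ.IsAddHaarMeasure]
    {ι : Type*} [Fintype ι] (e0 : G) (e : ι → G) (m : ℝ) (hm : 1 < m)
    (g : ι → G → ℝ) (f w v : G → ℝ) (hgm : ∀ i, Measurable (g i)) (hfm : Measurable f)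
    (hwm : Measurable w) (C : ℝ) (hw0 : ∀ z, 0 ≤ w z) (hwC : ∀ z, w z ≤ C)
    (hg2 : ∀ i, ∀ R : ℝ, IntegrableOn (fun z => g i z ^ 2) (Metric.closedBall 0 R) μ)
    (hf2 : ∀ R : ℝ, IntegrableOn (fun z => f z ^ 2) (Metric.closedBall 0 R) μ)
    (hv : LocallyIntegrable v μ)
    (I1 : ∀ ζ : G → ℝ, ContDiff ℝ 1 ζ → HasCompactSupport ζ →
      ∫ z, v z * fderiv ℝ ζ z e0 ∂μ = ∫ z, ((∑ i, g i z * fderiv ℝ ζ z (e i)) + f z * ζ z) ∂μ)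
    (I2 : ∀ i, ∀ ζ : G → ℝ, ContDiff ℝ 1 ζ → HasCompactSupport ζ →
      ∫ z, w z ^ m * fderiv ℝ ζ z (e i) ∂μ = - ∫ z, g i z * ζ z ∂μ)
    (W φ : G → ℝ) (hW : ContDiff ℝ 1 W) (hφ : ContDiff ℝ 2 φ)
    (hWd : ∀ i, Differentiable ℝ (fun z => fderiv ℝ W z (e i)))
    (hWL : ∀ i, LocallyIntegrable (fun z => fderiv ℝ (fun z => fderiv ℝ W z (e i)) z (e i)) μ)
    (hφs : HasCompactSupport φ) (hφ0 : ∀ z, 0 ≤ φ z)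
    (hconv : ∃ τ > (0:ℝ), ∀ h : ℝ, 0 < h → h < τ → ∀ᵐ z ∂μ,
      FF m (w z) (W z) - FF m (w (z - h • e0)) (W z) ≤
        (v z - v (z - h • e0)) * max (w z ^ m - W z) 0 ^ 2)
    (hcomp : ∀ᵐ z ∂μ, ((∑ i, fderiv ℝ (fun z => fderiv ℝ W z (e i)) z (e i)) - f z) * max (w z ^ m - W z) 0 ^ 2
      ≤ KK m (w z) (W z) * fderiv ℝ W z e0) :
    - ∫ z, FF m (w z) (W z) * fderiv ℝ φ z e0 ∂μ ≤
      ∑ i, ∫ z, (max (w z ^ m - W z) 0 ^ 3 / 3) * fderiv ℝ (fun z => fderiv ℝ φ z (e i)) z (e i) ∂μ := by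
  have : ProperSpace G := FiniteDimensional.proper_real G
  have hφ1 : ContDiff ℝ 1 φ := hφ.of_le (by norm_num)
  obtain ⟨Ii, Ji, Id⟩ := aux_I_deriv μ m hm e0 w W φ C hwm hw0 hwC hW hφ1 hφs
  have hUm : Measurable (fun z => w z ^ m) := hwm.pow_const m
  have hUC : ∀ z, |w z ^ m| ≤ C ^ m := fun z => by
    rw [abs_of_nonneg (Real.rpow_nonneg (hw0 z) m)]
    exact Real.rpow_le_rpow (hw0 z) (hwC z) (by linarith)
  -- H φ integrability against locally integrable functions
  have hHi : ∀ k : G → ℝ, LocallyIntegrable k μ → Integrable (fun z => k z * (max (w z ^ m - W z) 0 ^ 2 * φ z)) μ := by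
    intro k hk
    obtain ⟨CW, hCW⟩ := hφs.isCompact.exists_bound_of_continuousOn hW.continuous.continuousOn
    have h1 := (aux_int_mul hk hφ.continuous hφs).norm.mul_const ((C ^ m + |CW|) ^ 2)
    refine h1.mono' (hk.aestronglyMeasurable.mul ((((hUm.sub hW.continuous.measurable).max measurable_const).pow_const 2).mul hφ.continuous.measurable).aestronglyMeasurable) (Filter.Eventually.of_forall fun z => ?_)
    by_cases hz : z ∈ tsupport φ
    · have h1 := abs_le.1 (hUC z)
      have h2 := abs_le.1 (hCW z hz)
      have h3 := le_abs_self CW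
      have h4 : max (w z ^ m - W z) 0 ≤ C ^ m + |CW| := max_le (by linarith) (by
        have := (abs_nonneg _).trans (hUC z); positivity)
      have h5 : max (w z ^ m - W z) 0 ^ 2 ≤ (C ^ m + |CW|) ^ 2 := pow_le_pow_left₀ (le_max_right _ _) h4 2
      calc ‖k z * (max (w z ^ m - W z) 0 ^ 2 * φ z)‖ = ‖k z * φ z‖ * max (w z ^ m - W z) 0 ^ 2 := by
            rw [show k z * (max (w z ^ m - W z) 0 ^ 2 * φ z) = k z * φ z * max (w z ^ m - W z) 0 ^ 2 by ring, norm_mul]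
            congr 1
            rw [Real.norm_eq_abs, abs_of_nonneg (sq_nonneg _)]
        _ ≤ _ := mul_le_mul_of_nonneg_left h5 (norm_nonneg _)
    · have := image_eq_zero_of_notMem_tsupport hz
      simp [this]
  have hfl : LocallyIntegrable f μ := aux_locInt_of_sq μ f hfm hf2
  have hvh : ∀ h : ℝ, LocallyIntegrable (fun z => v z - v (z - h • e0)) μ := by
    intro h
    refine LocallyIntegrable.sub hv ?_
    rw [locallyIntegrable_iff]
    intro K hK
    have h1 := (hv.integrableOn_isCompact (hK.image (continuous_id.sub continuous_const : Continuous fun z : G => z - h • e0)))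
    have mp := measurePreserving_sub_right μ (h • e0)
    have := (mp.integrableOn_comp_preimage (Homeomorph.subRight (h • e0)).measurableEmbedding).2 h1
    refine this.mono_set ?_
    exact subset_preimage_image _ _
  set S1 := ∑ i, ∫ z, (max (w z ^ m - W z) 0 ^ 3 / 3) * fderiv ℝ (fun z => fderiv ℝ φ z (e i)) z (e i) ∂μ with hS1
  set S2 := ∑ i, ∫ z, fderiv ℝ (fun z => fderiv ℝ W z (e i)) z (e i) * (max (w z ^ m - W z) 0 ^ 2 * φ z) ∂μ with hS2
  set S3 := ∫ z, f z * (max (w z ^ m - W z) 0 ^ 2 * φ z) ∂μ with hS3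
  set D := ∫ z, (-KK m (w z) (W z) * fderiv ℝ W z e0 * φ z + FF m (w z) (W z) * fderiv ℝ φ z e0) ∂μ with hD
  have R2 : - D ≤ S1 + S2 - S3 := by
    refine le_of_forall_pos_le_add fun δ hδ => ?_
    obtain ⟨r, hr, hR1⟩ := aux_R1 μ e0 e g f (fun z => w z ^ m) v hgm hfm hUm (C ^ m) hUC hg2 hf2 hv I1 I2 W φ hW hφ hWd hWL hφs hφ0 δ hδ
    obtain ⟨τ, hτ, hcv⟩ := hconv
    have lim := Id.tendsto_slope_zero_right
    have ev : ∀ᶠ h in nhdsWithin (0:ℝ) (Ioi 0), -(S1 + S2 - S3 + δ) ≤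
        h⁻¹ • ((fun s : ℝ => ∫ z, FF m (w z) (W (z + s • e0)) * φ (z + s • e0) ∂μ) (0 + h)
          - (fun s : ℝ => ∫ z, FF m (w z) (W (z + s • e0)) * φ (z + s • e0) ∂μ) 0) := by
      filter_upwards [Ioo_mem_nhdsGT (lt_min hr hτ)] with h hh
      have hh0 : 0 < h := hh.1
      have a1 := hR1 h hh0 (hh.2.le.trans (min_le_left _ _))
      have a2 := hcv h hh0 (hh.2.trans_le (min_le_right _ _))
      have i1 := (Ii h).comp_sub_right (h • e0)
      have i0 := Ii 0
      have e2 := integral_sub_right_eq_self (μ := μ) (fun z => FF m (w z) (W (z + h • e0)) * φ (z + h • e0)) (h • e0)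
      simp only [sub_add_cancel] at e2 i1
      simp only [zero_smul, add_zero] at i0
      have a3 : ∫ z, (FF m (w z) (W z) * φ z - FF m (w (z - h • e0)) (W z) * φ z) ∂μ ≤
          ∫ z, (v z - v (z - h • e0)) * (max (w z ^ m - W z) 0 ^ 2 * φ z) ∂μ := by
        refine integral_mono_ae (i0.sub i1) (hHi _ (hvh h)) ?_
        filter_upwards [a2] with z hz
        have := mul_le_mul_of_nonneg_right hz (hφ0 z)
        linarith
      rw [integral_sub i0 i1, e2] at a3
      have a4 := a3.trans a1
      simp only [zero_add, zero_smul, add_zero, smul_eq_mul]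
      rw [← mul_le_mul_iff_of_pos_left hh0, mul_inv_cancel_left₀ hh0.ne']
      linarith
    have := ge_of_tendsto lim ev
    linarith
  have hKl : Integrable (fun z => KK m (w z) (W z) * fderiv ℝ W z e0 * φ z) μ ∧ Integrable (fun z => FF m (w z) (W z) * fderiv ℝ φ z e0) μ := by
    have h1 := (aux_I_deriv μ m hm e0 w (fun z => W z) φ C hwm hw0 hwC hW hφ1 hφs).2.1
    have cF : Continuous (fun p : ℝ × G => FF m p.1 (W p.2)) :=
      (FF_cont m hm).comp (continuous_fst.prodMk (hW.continuous.comp continuous_snd))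
    have cφ' : Continuous (fun z => fderiv ℝ φ z e0) :=
      (hφ1.continuous_fderiv (by norm_num)).clm_apply continuous_const
    have sφ' : HasCompactSupport (fun z => fderiv ℝ φ z e0) := hφs.fderiv_apply ℝ e0
    have h2 : Integrable (fun z => FF m (w z) (W z) * fderiv ℝ φ z e0) μ := by
      obtain ⟨B, hB⟩ := ((isCompact_Icc (a := 0) (b := C)).prod sφ'.isCompact).exists_bound_of_continuousOn cF.continuousOn
      have hi := (cφ'.integrable_of_hasCompactSupport (μ := μ) sφ').norm.const_mul B
      refine hi.mono' ((cF.measurable.comp (hwm.prodMk measurable_id)).mul cφ'.measurable).aestronglyMeasurable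
        (Filter.Eventually.of_forall fun z => ?_)
      by_cases hz : z ∈ tsupport (fun z => fderiv ℝ φ z e0)
      · rw [norm_mul]
        exact mul_le_mul_of_nonneg_right (hB (w z, z) ⟨⟨hw0 z, hwC z⟩, hz⟩) (norm_nonneg _)
      · have := image_eq_zero_of_notMem_tsupport hz
        simp [this]
    refine ⟨?_, h2⟩
    refine (h2.sub h1).congr (Filter.Eventually.of_forall fun z => ?_)
    simp only [Pi.sub_apply]; ring
  have hDe : D = - (∫ z, KK m (w z) (W z) * fderiv ℝ W z e0 * φ z ∂μ) + ∫ z, FF m (w z) (W z) * fderiv ℝ φ z e0 ∂μ := by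
    rw [hD, ← integral_neg]
    have h1 : Integrable (fun z => -(KK m (w z) (W z) * fderiv ℝ W z e0 * φ z)) μ := hKl.1.neg
    rw [← integral_add h1 hKl.2]
    congr 1; ext z; ring
  have hS : S2 - S3 ≤ ∫ z, KK m (w z) (W z) * fderiv ℝ W z e0 * φ z ∂μ := by
    rw [hS2, hS3, ← integral_finsetSum _ (fun i _ => hHi _ (hWL i)), ← integral_sub (integrable_finsetSum _ (fun i _ => hHi _ (hWL i))) (hHi _ hfl)]
    refine integral_mono_ae ((integrable_finsetSum _ (fun i _ => hHi _ (hWL i))).sub (hHi _ hfl)) hKl.1 ?_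
    filter_upwards [hcomp] with z hz
    have := mul_le_mul_of_nonneg_right hz (hφ0 z)
    rw [← Finset.sum_mul]
    linarith
  linarith

lemma prodf {E : Type*} [NormedAddCommGroup E] [NormedSpace ℝ E] (θ : ℝ → ℝ) (ψ : E → ℝ)
    (hθ : Differentiable ℝ θ) (hψ : Differentiable ℝ ψ) (z : ℝ × E) (a : ℝ) (b : E) :
    fderiv ℝ (fun z : ℝ × E => θ z.1 * ψ z.2) z (a, b) = a * deriv θ z.1 * ψ z.2 + θ z.1 * fderiv ℝ ψ z.2 b := by
  have d1 : HasFDerivAt (fun z : ℝ × E => z.1) (ContinuousLinearMap.fst ℝ ℝ E) z := hasFDerivAt_fst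
  have d2 : HasFDerivAt (fun z : ℝ × E => z.2) (ContinuousLinearMap.snd ℝ ℝ E) z := hasFDerivAt_snd
  have h1 := (hθ z.1).hasDerivAt.comp_hasFDerivAt z d1
  have h2 := (hψ z.2).hasFDerivAt.comp z d2
  rw [HasFDerivAt.fderiv (f := fun z : ℝ × E => θ z.1 * ψ z.2) (h1.mul h2)]
  simp; ring

lemma prodf2 {E : Type*} [NormedAddCommGroup E] [NormedSpace ℝ E] (θ : ℝ → ℝ) (ψ : E → ℝ) (b : E)
    (hθ : Differentiable ℝ θ) (hψ : Differentiable ℝ ψ) (hψ2 : Differentiable ℝ (fun x => fderiv ℝ ψ x b)) :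
    Differentiable ℝ (fun z => fderiv ℝ (fun z : ℝ × E => θ z.1 * ψ z.2) z (0, b)) ∧
    ∀ z, fderiv ℝ (fun z => fderiv ℝ (fun z : ℝ × E => θ z.1 * ψ z.2) z (0, b)) z (0, b)
      = θ z.1 * fderiv ℝ (fun x => fderiv ℝ ψ x b) z.2 b := by
  have h : (fun z => fderiv ℝ (fun z : ℝ × E => θ z.1 * ψ z.2) z (0, b)) = fun z : ℝ × E => θ z.1 * fderiv ℝ ψ z.2 b := by
    ext z; rw [prodf θ ψ hθ hψ]; simp
  rw [h]
  refine ⟨?_, fun z => ?_⟩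
  · exact (hθ.comp differentiable_fst).mul (hψ2.comp differentiable_snd)
  · rw [prodf θ (fun x => fderiv ℝ ψ x b) hθ hψ2]; simp

/-- spatial cut-off -/
def psiR (N k : ℕ) (R : ℝ) (x : EuclideanSpace ℝ (Fin N)) : ℝ := max (1 - ‖x‖ ^ 2 / R ^ 2) 0 ^ k

lemma psiR_contDiff (N k : ℕ) (R : ℝ) : ContDiff ℝ 2 (psiR N (k + 3) R) := by
  unfold psiR
  exact (posp_contDiff_two k).comp (contDiff_const.sub ((contDiff_norm_sq ℝ).div_const _))

lemma inner_hasFDerivAt (N : ℕ) (R : ℝ) (x : EuclideanSpace ℝ (Fin N)) :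
    HasFDerivAt (fun x : EuclideanSpace ℝ (Fin N) => 1 - ‖x‖ ^ 2 / R ^ 2) (-((R ^ 2)⁻¹ • (2 • innerSL ℝ x))) x := by
  have h := (hasStrictFDerivAt_norm_sq x).hasFDerivAt
  have := (h.mul_const ((R ^ 2)⁻¹)).const_sub 1
  simpa [div_eq_mul_inv] using this

lemma psiR_fderiv (N k : ℕ) (R : ℝ) (x : EuclideanSpace ℝ (Fin N)) (i : Fin N) :
    fderiv ℝ (psiR N (k + 3) R) x (EuclideanSpace.single i 1) =
      - ((k + 3 : ℕ) : ℝ) * 2 / R ^ 2 * (x i * max (1 - ‖x‖ ^ 2 / R ^ 2) 0 ^ (k + 2)) := by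
  have h := (posp_hasDerivAt (k + 1) (1 - ‖x‖ ^ 2 / R ^ 2)).comp_hasFDerivAt x (inner_hasFDerivAt N R x)
  have h' : HasFDerivAt (psiR N (k + 3) R) _ x := h
  rw [h'.fderiv]
  simp [EuclideanSpace.inner_single_right]
  ring

lemma psiR_lap (N k : ℕ) (R : ℝ) (hR : 0 < R) (x : EuclideanSpace ℝ (Fin N)) :
    ∑ i, fderiv ℝ (fun x => fderiv ℝ (psiR N (k + 3) R) x (EuclideanSpace.single i 1)) x (EuclideanSpace.single i 1)
      ≤ ((k + 3 : ℕ) : ℝ) * 2 / R ^ 2 * (2 * (k + 2 : ℕ) * max (1 - ‖x‖ ^ 2 / R ^ 2) 0 ^ (k + 1)) := by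
  have hi : ∀ i : Fin N, fderiv ℝ (fun x => fderiv ℝ (psiR N (k + 3) R) x (EuclideanSpace.single i 1)) x (EuclideanSpace.single i 1)
      ≤ ((k + 3 : ℕ) : ℝ) * 2 / R ^ 2 * (((k + 2 : ℕ) : ℝ) * max (1 - ‖x‖ ^ 2 / R ^ 2) 0 ^ (k + 1) * 2 / R ^ 2) * (x i) ^ 2 := by
    intro i
    have e : (fun x => fderiv ℝ (psiR N (k + 3) R) x (EuclideanSpace.single i 1)) =
      fun x : EuclideanSpace ℝ (Fin N) => - ((k + 3 : ℕ) : ℝ) * 2 / R ^ 2 * (x i * max (1 - ‖x‖ ^ 2 / R ^ 2) 0 ^ (k + 2)) := by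
      ext x; exact psiR_fderiv N k R x i
    rw [e]
    have h1 :=
      (posp_hasDerivAt k (1 - ‖x‖ ^ 2 / R ^ 2)).comp_hasFDerivAt x (inner_hasFDerivAt N R x)
    have h2 : HasFDerivAt (fun x : EuclideanSpace ℝ (Fin N) => x i) (EuclideanSpace.proj i : EuclideanSpace ℝ (Fin N) →L[ℝ] ℝ) x :=
      (EuclideanSpace.proj i : EuclideanSpace ℝ (Fin N) →L[ℝ] ℝ).hasFDerivAt
    have h3 := (h2.mul h1).const_mul (- ((k + 3 : ℕ) : ℝ) * 2 / R ^ 2)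
    rw [HasFDerivAt.fderiv (f := fun x : EuclideanSpace ℝ (Fin N) => - ((k + 3 : ℕ) : ℝ) * 2 / R ^ 2 * (x i * max (1 - ‖x‖ ^ 2 / R ^ 2) 0 ^ (k + 2))) h3]
    have p : 0 ≤ ((k + 3 : ℕ) : ℝ) * 2 / R ^ 2 * max (1 - ‖x‖ ^ 2 / R ^ 2) 0 ^ (k + 2) := by positivity
    simp [EuclideanSpace.inner_single_right]
    push_cast at p
    rw [← sub_nonneg]
    refine p.trans (le_of_eq ?_)
    ring
  refine (Finset.sum_le_sum fun i _ => hi i).trans ?_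
  rw [← Finset.mul_sum, ← EuclideanSpace.real_norm_sq_eq]
  rw [mul_assoc]
  refine mul_le_mul_of_nonneg_left ?_ (by positivity)
  by_cases hx : 0 < 1 - ‖x‖ ^ 2 / R ^ 2
  · have : ‖x‖ ^ 2 / R ^ 2 ≤ 1 := by linarith
    have p : 0 ≤ ((k + 2 : ℕ) : ℝ) * max (1 - ‖x‖ ^ 2 / R ^ 2) 0 ^ (k + 1) * 2 := by positivity
    have := mul_le_mul_of_nonneg_left this p
    calc _ = ((k + 2 : ℕ) : ℝ) * max (1 - ‖x‖ ^ 2 / R ^ 2) 0 ^ (k + 1) * 2 * (‖x‖ ^ 2 / R ^ 2) := by ring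
      _ ≤ _ := this
      _ = _ := by ring
  · rw [max_eq_right (by linarith)]
    simp

lemma aux_young (k : ℕ) (s R lam : ℝ) (hs : 0 ≤ s) (hR : 0 < R) (hl : 0 < lam) :
    s ^ (k + 1) / R ^ 2 ≤ s ^ (k + 3) / lam ^ 2 + lam ^ (k + 1) / R ^ (k + 3) := by
  by_cases h : lam / R ≤ s
  · have h1 : (lam / R) ^ 2 ≤ s ^ 2 := by gcongr
    have : s ^ (k + 1) / R ^ 2 ≤ s ^ (k + 3) / lam ^ 2 := by
      rw [div_le_div_iff₀ (by positivity) (by positivity)]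
      rw [div_pow, div_le_iff₀ (by positivity)] at h1
      have := mul_le_mul_of_nonneg_left h1 (by positivity : 0 ≤ s ^ (k + 1))
      calc _ ≤ _ := this
        _ = _ := by ring
    have : 0 ≤ lam ^ (k + 1) / R ^ (k + 3) := by positivity
    linarith
  · push Not at h
    have h1 : s ^ (k + 1) ≤ (lam / R) ^ (k + 1) := by gcongr
    have h2 : s ^ (k + 1) / R ^ 2 ≤ (lam / R) ^ (k + 1) / R ^ 2 := by gcongr
    have h3 : (lam / R) ^ (k + 1) / R ^ 2 = lam ^ (k + 1) / R ^ (k + 3) := by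
      rw [div_pow, div_div, ← pow_add]
    have : 0 ≤ s ^ (k + 3) / lam ^ 2 := by positivity
    linarith

instance volHaar (N : ℕ) : (volume : Measure (ℝ × EuclideanSpace ℝ (Fin N))).IsAddHaarMeasure := by
  rw [Measure.volume_eq_prod]; infer_instance

def thT (T t : ℝ) : ℝ := max ((T - t) * (t + 3 * T)) 0 ^ 3

lemma thT_contDiff (T : ℝ) : ContDiff ℝ 2 (thT T) := by
  unfold thT
  exact (posp_contDiff_two 0).comp (f := fun t : ℝ => (T - t) * (t + 3 * T)) (by fun_prop)

lemma thT_deriv (T t : ℝ) : deriv (thT T) t = 3 * max ((T - t) * (t + 3 * T)) 0 ^ 2 * (-2 * t - 2 * T) := by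
  have h1 : HasDerivAt (fun t : ℝ => (T - t) * (t + 3 * T)) (-2 * t - 2 * T) t := by
    have := ((hasDerivAt_id' t).const_sub T).mul ((hasDerivAt_id' t).add_const (3 * T))
    exact this.congr_deriv (by ring)
  have h2 := (posp_hasDerivAt 1 ((T - t) * (t + 3 * T))).comp t h1
  have h3 : HasDerivAt (thT T) _ t := h2
  rw [h3.deriv]; norm_num

lemma thT_nonneg (T t : ℝ) : 0 ≤ thT T t := by unfold thT; positivity

lemma thT_decay (T t : ℝ) (hT : 0 < T) (ht : 0 ≤ t) : thT T t / T ≤ - deriv (thT T) t := by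
  rw [thT_deriv, thT, div_le_iff₀ hT]
  set p := max ((T - t) * (t + 3 * T)) 0 with hp
  have hp0 : 0 ≤ p := le_max_right _ _
  have h1 : p ≤ 3 * T ^ 2 := max_le (by nlinarith) (by positivity)
  have h2 : p ^ 2 * p ≤ p ^ 2 * (6 * T ^ 2 + 6 * t * T) := by
    gcongr; nlinarith [mul_nonneg ht hT.le]
  nlinarith

lemma thT_bound (T t : ℝ) (hT : 0 < T) (ht : 0 ≤ t) : thT T t ≤ (4 * T ^ 2) ^ 3 := by
  unfold thT
  gcongr
  exact max_le (by nlinarith) (by positivity)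

lemma thT_zero (T t : ℝ) (hT : 0 < T) (ht : T ≤ t) : thT T t = 0 := by
  unfold thT
  rw [max_eq_right (mul_nonpos_of_nonpos_of_nonneg (by linarith) (by linarith))]; norm_num

lemma thT_pos (T t : ℝ) (ht0 : 0 < t) (ht : t < T) : 0 < thT T t := by
  unfold thT
  rw [max_eq_left (by nlinarith)]
  have : 0 < (T - t) * (t + 3 * T) := mul_pos (by linarith) (by linarith)
  positivity

lemma psiR_nonneg (N k : ℕ) (R : ℝ) (x) : 0 ≤ psiR N k R x := by unfold psiR; positivity

lemma test_compact (N k : ℕ) (T R : ℝ) (hT : 0 < T) (hR : 0 < R) :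
    HasCompactSupport (fun z : ℝ × EuclideanSpace ℝ (Fin N) => thT T z.1 * psiR N (k + 3) R z.2) := by
  refine HasCompactSupport.of_support_subset_isCompact (K := Icc (-3 * T) T ×ˢ Metric.closedBall 0 R)
    (isCompact_Icc.prod (isCompact_closedBall 0 R)) ?_
  intro z hz
  rw [Function.mem_support] at hz
  by_contra hc
  apply hz
  rw [mem_prod, not_and_or] at hc
  rcases hc with hc | hc
  · have : (T - z.1) * (z.1 + 3 * T) ≤ 0 := by
      by_contra h
      push Not at h
      apply hc
      constructor
      · by_contra h1
        push Not at h1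
        nlinarith [mul_pos (show 0 < T - z.1 by linarith) (show 0 < -(z.1 + 3 * T) by linarith)]
      · by_contra h1
        push Not at h1
        nlinarith [mul_pos (show 0 < z.1 - T by linarith) (show 0 < (z.1 + 3 * T) by linarith)]
    simp [thT, max_eq_right this]
  · have h1 : R < ‖z.2‖ := by simpa using hc
    have : 1 - ‖z.2‖ ^ 2 / R ^ 2 ≤ 0 := by
      rw [sub_nonpos, le_div_iff₀ (by positivity)]; nlinarith
    simp [psiR, max_eq_right this]

lemma aux_pt9 (N : ℕ) (T R L B j gv t : ℝ) (x : EuclideanSpace ℝ (Fin N)) (hT : 0 < T) (hR : 0 < R) (hL : 0 ≤ L) (hB : 0 ≤ B)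
    (hj0 : 0 ≤ j) (hjB : j ≤ B) (hg0 : 0 ≤ gv) (hgL : gv ≤ L * j) (h0 : t ≤ 0 → j = 0) (c0 lam : ℝ)
    (hc0 : c0 = ((N + 3 : ℕ) : ℝ) * 2 * (2 * (N + 2 : ℕ))) (hlam : lam = 1 + 2 * T * L * c0) :
    1 / (2 * T) * (j * (thT T t * psiR N (N + 3) R x)) ≤
      - (j * (deriv (thT T) t * psiR N (N + 3) R x))
      - gv * (thT T t * ∑ i, fderiv ℝ (fun x => fderiv ℝ (psiR N (N + 3) R) x (EuclideanSpace.single i 1)) x (EuclideanSpace.single i 1))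
      + (Icc 0 T ×ˢ Metric.closedBall (0 : EuclideanSpace ℝ (Fin N)) R).indicator (fun _ => L * B * (4 * T ^ 2) ^ 3 * c0 * lam ^ (N + 1) / R ^ (N + 3)) (t, x) := by
  have hc00 : 0 ≤ c0 := by rw [hc0]; positivity
  have hl1 : 1 ≤ lam := by rw [hlam]; nlinarith [show 0 ≤ 2 * T * L * c0 by positivity]
  have hi0 : 0 ≤ (Icc 0 T ×ˢ Metric.closedBall (0 : EuclideanSpace ℝ (Fin N)) R).indicator (fun _ => L * B * (4 * T ^ 2) ^ 3 * c0 * lam ^ (N + 1) / R ^ (N + 3)) (t, x) := by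
    apply indicator_nonneg; intro z _; positivity
  rcases le_or_gt t 0 with ht | ht
  · have hj := h0 ht
    have hg : gv = 0 := le_antisymm (by rw [hj] at hgL; simpa using hgL) hg0
    rw [hj, hg]; simpa using hi0
  rcases le_or_gt T t with ht2 | ht2
  · have : (T - t) * (t + 3 * T) ≤ 0 := mul_nonpos_of_nonpos_of_nonneg (by linarith) (by linarith)
    rw [thT_zero T t hT ht2, thT_deriv, max_eq_right this]
    simpa using hi0
  have hlap := psiR_lap N N R hR x
  set Lp := ∑ i, fderiv ℝ (fun x => fderiv ℝ (psiR N (N + 3) R) x (EuclideanSpace.single i 1)) x (EuclideanSpace.single i 1)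
  have hdec := thT_decay T t hT ht.le
  have hbd := thT_bound T t hT ht.le
  have hth0 := thT_nonneg T t
  have hps0 := psiR_nonneg N (N + 3) R x
  set th := thT T t
  set dth := deriv (thT T) t
  have hpsE : psiR N (N + 3) R x = max (1 - ‖x‖ ^ 2 / R ^ 2) 0 ^ (N + 3) := rfl
  set ps := psiR N (N + 3) R x
  set s := max (1 - ‖x‖ ^ 2 / R ^ 2) 0
  have hs0 : 0 ≤ s := le_max_right _ _
  set I := (Icc 0 T ×ˢ Metric.closedBall (0 : EuclideanSpace ℝ (Fin N)) R).indicator (fun _ => L * B * (4 * T ^ 2) ^ 3 * c0 * lam ^ (N + 1) / R ^ (N + 3)) (t, x) with hI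
  have key : gv * (th * Lp) ≤ L * j * th * (c0 * (ps / lam ^ 2)) + I := by
    by_cases hx : ‖x‖ ≤ R
    · have hy := aux_young N s R lam hs0 hR (by linarith)
      have hIe : I = L * B * (4 * T ^ 2) ^ 3 * c0 * lam ^ (N + 1) / R ^ (N + 3) := by
        rw [hI, indicator_of_mem]
        exact ⟨⟨ht.le, ht2.le⟩, by simpa using hx⟩
      have h1 : Lp ≤ c0 * (ps / lam ^ 2 + lam ^ (N + 1) / R ^ (N + 3)) := by
        calc Lp ≤ _ := hlap
          _ = c0 * (s ^ (N + 1) / R ^ 2) := by rw [hc0]; ring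
          _ ≤ _ := by rw [hpsE]; gcongr
      have hn : 0 ≤ c0 * (ps / lam ^ 2 + lam ^ (N + 1) / R ^ (N + 3)) := by positivity
      calc gv * (th * Lp) ≤ gv * (th * (c0 * (ps / lam ^ 2 + lam ^ (N + 1) / R ^ (N + 3)))) := by gcongr
        _ ≤ L * j * (th * (c0 * (ps / lam ^ 2 + lam ^ (N + 1) / R ^ (N + 3)))) := by gcongr
        _ = L * j * th * (c0 * (ps / lam ^ 2)) + L * j * th * (c0 * (lam ^ (N + 1) / R ^ (N + 3))) := by ring
        _ ≤ L * j * th * (c0 * (ps / lam ^ 2)) + L * B * (4 * T ^ 2) ^ 3 * (c0 * (lam ^ (N + 1) / R ^ (N + 3))) := by gcongr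
        _ = _ := by rw [hIe]; ring
    · have hs : s = 0 := by
        apply max_eq_right
        push Not at hx
        rw [sub_nonpos, le_div_iff₀ (by positivity)]; nlinarith
      rw [hs] at hlap
      have : Lp ≤ 0 := by simpa using hlap
      have h2 : gv * (th * Lp) ≤ 0 := mul_nonpos_of_nonneg_of_nonpos hg0 (mul_nonpos_of_nonneg_of_nonpos hth0 this)
      have : 0 ≤ L * j * th * (c0 * (ps / lam ^ 2)) := by positivity
      linarith
  have h3 : L * j * th * (c0 * (ps / lam ^ 2)) ≤ 1 / (2 * T) * (j * (th * ps)) := by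
    have : L * c0 / lam ^ 2 ≤ 1 / (2 * T) := by
      rw [div_le_div_iff₀ (by positivity) (by positivity)]
      nlinarith
    calc L * j * th * (c0 * (ps / lam ^ 2)) = (L * c0 / lam ^ 2) * (j * (th * ps)) := by ring
      _ ≤ _ := by gcongr
  have h4 : 1 / T * (j * (th * ps)) ≤ -(j * (dth * ps)) := by
    calc 1 / T * (j * (th * ps)) = j * ((th / T) * ps) := by ring
      _ ≤ j * ((-dth) * ps) := by gcongr
      _ = _ := by ring
  have h5 : 1 / T * (j * (th * ps)) = 2 * (1 / (2 * T) * (j * (th * ps))) := by field_simp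
  linarith

lemma aux_bdd_mul {G : Type*} [NormedAddCommGroup G] [NormedSpace ℝ G] [FiniteDimensional ℝ G]
    [MeasurableSpace G] [BorelSpace G] {μ : Measure G} [μ.IsAddHaarMeasure]
    {g η : G → ℝ} (hg : Measurable g) (C : ℝ) (hC : ∀ z, |g z| ≤ C) (hη : Continuous η) (hs : HasCompactSupport η) :
    Integrable (fun z => g z * η z) μ := by
  have : ProperSpace G := FiniteDimensional.proper_real G
  refine aux_int_mul ?_ hη hs
  refine (locallyIntegrable_const C).mono hg.aestronglyMeasurable (Filter.Eventually.of_forall fun z => ?_)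
  simpa using (hC z).trans (le_abs_self C)

lemma aux_est9 (N : ℕ) (T R L B : ℝ) (J Gv : ℝ × EuclideanSpace ℝ (Fin N) → ℝ) (hJm : Measurable J) (hGm : Measurable Gv)
    (hT : 0 < T) (hR : 0 < R) (hL : 0 ≤ L)
    (hj0 : ∀ z, 0 ≤ J z) (hjB : ∀ z, J z ≤ B) (hg0 : ∀ z, 0 ≤ Gv z) (hgL : ∀ z, Gv z ≤ L * J z) (h0 : ∀ z : ℝ × EuclideanSpace ℝ (Fin N), z.1 ≤ 0 → J z = 0) (c0 lam : ℝ)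
    (hc0 : c0 = ((N + 3 : ℕ) : ℝ) * 2 * (2 * (N + 2 : ℕ))) (hlam : lam = 1 + 2 * T * L * c0)
    (H : ∀ φ : ℝ × EuclideanSpace ℝ (Fin N) → ℝ, ContDiff ℝ 2 φ → HasCompactSupport φ → (∀ z, 0 ≤ φ z) →
      - ∫ z, J z * fderiv ℝ φ z (1, 0) ≤
      ∑ i, ∫ z, Gv z * fderiv ℝ (fun z => fderiv ℝ φ z (0, EuclideanSpace.single i 1)) z (0, EuclideanSpace.single i 1)) :
    Integrable (fun z : ℝ × EuclideanSpace ℝ (Fin N) => J z * (thT T z.1 * psiR N (N + 3) R z.2)) ∧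
    1 / (2 * T) * ∫ z : ℝ × EuclideanSpace ℝ (Fin N), J z * (thT T z.1 * psiR N (N + 3) R z.2) ≤
      L * B * (4 * T ^ 2) ^ 3 * c0 * lam ^ (N + 1) * T * (volume (Metric.closedBall (0 : EuclideanSpace ℝ (Fin N)) 1)).toReal / R ^ 3 := by
  have hB : 0 ≤ B := (hj0 0).trans (hjB 0)
  have hth := thT_contDiff T
  have hps := psiR_contDiff N N R
  have hthd : Differentiable ℝ (thT T) := hth.differentiable (by norm_num)
  have hpsd : Differentiable ℝ (psiR N (N + 3) R) := hps.differentiable (by norm_num)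
  have hps2 : ∀ b, ContDiff ℝ 1 (fun x => fderiv ℝ (psiR N (N + 3) R) x b) := fun b =>
    (hps.fderiv_right (m := 1) (by norm_num)).clm_apply contDiff_const
  have hps3 : ∀ b, Differentiable ℝ (fun x => fderiv ℝ (psiR N (N + 3) R) x b) := fun b =>
    (hps2 b).differentiable (by norm_num)
  set φ : ℝ × EuclideanSpace ℝ (Fin N) → ℝ := fun z => thT T z.1 * psiR N (N + 3) R z.2 with hφ
  have hφc : ContDiff ℝ 2 φ := (hth.comp contDiff_fst).mul (hps.comp contDiff_snd)
  have hφs : HasCompactSupport φ := test_compact N N T R hT hR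
  have hφ0 : ∀ z, 0 ≤ φ z := fun z => mul_nonneg (thT_nonneg _ _) (psiR_nonneg _ _ _ _)
  have hH := H φ hφc hφs hφ0
  have hJa : ∀ z, |J z| ≤ B := fun z => by rw [abs_of_nonneg (hj0 z)]; exact hjB z
  have hGa : ∀ z, |Gv z| ≤ L * B := fun z => by
    rw [abs_of_nonneg (hg0 z)]; exact (hgL z).trans (by have := hjB z; gcongr)
  have hd1 : ∀ e, ContDiff ℝ 1 (fun z => fderiv ℝ φ z e) := fun e =>
    (hφc.fderiv_right (m := 1) (by norm_num)).clm_apply contDiff_const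
  have hd1s : ∀ e, HasCompactSupport (fun z => fderiv ℝ φ z e) := fun e => hφs.fderiv_apply ℝ e
  have hi1 : Integrable (fun z => J z * φ z) := aux_bdd_mul hJm B hJa hφc.continuous hφs
  have hi2 : Integrable (fun z => J z * fderiv ℝ φ z (1, 0)) := aux_bdd_mul hJm B hJa (hd1 _).continuous (hd1s _)
  have hi3 : ∀ i, Integrable (fun z => Gv z * fderiv ℝ (fun z => fderiv ℝ φ z (0, EuclideanSpace.single i 1)) z (0, EuclideanSpace.single i 1)) := fun i =>
    aux_bdd_mul hGm (L * B) hGa (((hd1 _).continuous_fderiv (by norm_num)).clm_apply continuous_const) ((hd1s _).fderiv_apply ℝ _)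
  refine ⟨hi1, ?_⟩
  set S : Set (ℝ × EuclideanSpace ℝ (Fin N)) := Icc 0 T ×ˢ Metric.closedBall (0 : EuclideanSpace ℝ (Fin N)) R with hS
  have hSm : MeasurableSet S := measurableSet_Icc.prod measurableSet_closedBall
  have hSv : volume S = ENNReal.ofReal T * (ENNReal.ofReal (R ^ N) * volume (Metric.closedBall (0 : EuclideanSpace ℝ (Fin N)) 1)) := by
    rw [hS, Measure.volume_eq_prod, Measure.prod_prod, Real.volume_Icc, Measure.addHaar_closedBall' volume _ hR.le]
    simp
  have hSf : volume S ≠ ⊤ := by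
    rw [hSv]
    exact ENNReal.mul_ne_top ENNReal.ofReal_ne_top (ENNReal.mul_ne_top ENNReal.ofReal_ne_top measure_closedBall_lt_top.ne)
  set D := L * B * (4 * T ^ 2) ^ 3 * c0 * lam ^ (N + 1) / R ^ (N + 3) with hD
  have hi4 : Integrable (S.indicator (fun _ => D)) := (integrable_indicator_iff hSm).2 (integrableOn_const hSf)
  have hint4 : ∫ z, S.indicator (fun _ => D) z = D * (T * (R ^ N * (volume (Metric.closedBall (0 : EuclideanSpace ℝ (Fin N)) 1)).toReal)) := by
    rw [integral_indicator hSm, setIntegral_const, Measure.real, hSv, ENNReal.toReal_mul, ENNReal.toReal_mul,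
      ENNReal.toReal_ofReal hT.le, ENNReal.toReal_ofReal (by positivity), smul_eq_mul, mul_comm]
  have hpt : ∀ z, 1 / (2 * T) * (J z * φ z) ≤ - (J z * fderiv ℝ φ z (1, 0)) -
      (∑ i, Gv z * fderiv ℝ (fun z => fderiv ℝ φ z (0, EuclideanSpace.single i 1)) z (0, EuclideanSpace.single i 1)) + S.indicator (fun _ => D) z := by
    intro z
    have h := aux_pt9 N T R L B (J z) (Gv z) z.1 z.2 hT hR hL hB (hj0 z) (hjB z) (hg0 z) (hgL z) (h0 z) c0 lam hc0 hlam
    rw [hφ, prodf _ _ hthd hpsd]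
    simp_rw [(prodf2 _ _ _ hthd hpsd (hps3 _)).2]
    rw [← Finset.mul_sum, ← Finset.mul_sum]
    simpa using h
  have hfin := integral_mono (hi1.const_mul (1 / (2 * T))) ((hi2.neg.sub (integrable_finsetSum _ fun i _ => hi3 i)).add hi4) hpt
  have e1 : ∫ z, ((-(fun z => J z * fderiv ℝ φ z (1, 0)) - (fun z => ∑ i, Gv z * fderiv ℝ (fun z => fderiv ℝ φ z (0, EuclideanSpace.single i 1)) z (0, EuclideanSpace.single i 1))) + S.indicator (fun _ => D)) z
     = - (∫ z, J z * fderiv ℝ φ z (1, 0)) - (∑ i, ∫ z, Gv z * fderiv ℝ (fun z => fderiv ℝ φ z (0, EuclideanSpace.single i 1)) z (0, EuclideanSpace.single i 1)) + ∫ z, S.indicator (fun _ => D) z := by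
    rw [integral_add' (hi2.neg.sub (integrable_finsetSum _ fun i _ => hi3 i)) hi4, integral_sub' hi2.neg (integrable_finsetSum _ fun i _ => hi3 i),
      integral_neg', integral_finsetSum _ fun i _ => hi3 i]
  have hfin2 := hfin.trans_eq e1
  rw [integral_const_mul, hint4] at hfin2
  have : D * (T * (R ^ N * (volume (Metric.closedBall (0 : EuclideanSpace ℝ (Fin N)) 1)).toReal)) = L * B * (4 * T ^ 2) ^ 3 * c0 * lam ^ (N + 1) * T * (volume (Metric.closedBall (0 : EuclideanSpace ℝ (Fin N)) 1)).toReal / R ^ 3 := by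
    rw [hD, pow_add R N 3]; field_simp
  rw [this] at hfin2
  linarith

lemma aux_R4 (N : ℕ) (L B : ℝ) (J Gv : ℝ × EuclideanSpace ℝ (Fin N) → ℝ) (hJm : Measurable J) (hGm : Measurable Gv)
    (hL : 0 ≤ L)
    (hj0 : ∀ z, 0 ≤ J z) (hjB : ∀ z, J z ≤ B) (hg0 : ∀ z, 0 ≤ Gv z) (hgL : ∀ z, Gv z ≤ L * J z) (h0 : ∀ z : ℝ × EuclideanSpace ℝ (Fin N), z.1 ≤ 0 → J z = 0)
    (H : ∀ φ : ℝ × EuclideanSpace ℝ (Fin N) → ℝ, ContDiff ℝ 2 φ → HasCompactSupport φ → (∀ z, 0 ≤ φ z) →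
      - ∫ z, J z * fderiv ℝ φ z (1, 0) ≤
      ∑ i, ∫ z, Gv z * fderiv ℝ (fun z => fderiv ℝ φ z (0, EuclideanSpace.single i 1)) z (0, EuclideanSpace.single i 1)) :
    ∀ᵐ z, J z = 0 := by
  have main : ∀ n : ℕ, ∀ᵐ z : ℝ × EuclideanSpace ℝ (Fin N), ‖z.2‖ ≤ (n + 1 : ℝ) → J z * thT (n + 1 : ℝ) z.1 = 0 := by
    intro n
    set T : ℝ := n + 1 with hTd
    have hT : 0 < T := by positivity
    set c0 : ℝ := ((N + 3 : ℕ) : ℝ) * 2 * (2 * (N + 2 : ℕ)) with hc0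
    set lam : ℝ := 1 + 2 * T * L * c0 with hlam
    set K := L * B * (4 * T ^ 2) ^ 3 * c0 * lam ^ (N + 1) * T * (volume (Metric.closedBall (0 : EuclideanSpace ℝ (Fin N)) 1)).toReal with hK
    set S : Set (ℝ × EuclideanSpace ℝ (Fin N)) := {z | ‖z.2‖ ≤ T} with hS
    have hSm : MeasurableSet S := (isClosed_le (by fun_prop) continuous_const).measurableSet
    set Q : ℝ × EuclideanSpace ℝ (Fin N) → ℝ := S.indicator (fun z => J z * thT T z.1) with hQ
    have hQ0 : ∀ z, 0 ≤ Q z := fun z => indicator_nonneg (fun z _ => mul_nonneg (hj0 z) (thT_nonneg _ _)) z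
    have hQm : Measurable Q := (hJm.mul ((thT_contDiff T).continuous.measurable.comp measurable_fst)).indicator hSm
    have hle : ∀ R : ℝ, 2 * T ≤ R → ∀ z, Q z ≤ (4 / 3) ^ (N + 3) * (J z * (thT T z.1 * psiR N (N + 3) R z.2)) := by
      intro R hR z
      have hR0 : 0 < R := by linarith
      by_cases hz : z ∈ S
      · rw [hQ, indicator_of_mem hz]
        have h1 : (3 / 4 : ℝ) ≤ max (1 - ‖z.2‖ ^ 2 / R ^ 2) 0 := by
          refine le_max_of_le_left ?_
          have : ‖z.2‖ ≤ T := hz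
          have h2 : ‖z.2‖ ^ 2 / R ^ 2 ≤ 1 / 4 := by
            rw [div_le_iff₀ (by positivity)]
            have := norm_nonneg z.2
            nlinarith
          linarith
        have h2 : (3 / 4 : ℝ) ^ (N + 3) ≤ psiR N (N + 3) R z.2 := by
          unfold psiR; gcongr
        have h3 : 0 ≤ J z * thT T z.1 := mul_nonneg (hj0 z) (thT_nonneg _ _)
        calc J z * thT T z.1 = (4 / 3) ^ (N + 3) * (J z * thT T z.1 * (3 / 4) ^ (N + 3)) := by
              rw [mul_comm (J z * thT T z.1), ← mul_assoc, ← mul_pow]; norm_num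
          _ ≤ (4 / 3) ^ (N + 3) * (J z * thT T z.1 * psiR N (N + 3) R z.2) := by gcongr
          _ = _ := by ring
      · rw [hQ, indicator_of_notMem hz]
        have := hj0 z
        have := thT_nonneg T z.1
        have := psiR_nonneg N (N + 3) R z.2
        positivity
    have hest : ∀ R : ℝ, 2 * T ≤ R → Integrable Q ∧ ∫ z, Q z ≤ ((4 / 3) ^ (N + 3) * (2 * T) * K) / R ^ 3 := by
      intro R hR
      have hR0 : 0 < R := by linarith
      obtain ⟨h1, h2⟩ := aux_est9 N T R L B J Gv hJm hGm hT hR0 hL hj0 hjB hg0 hgL h0 c0 lam hc0 hlam H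
      have h3 := h1.const_mul ((4 / 3 : ℝ) ^ (N + 3))
      have hQi : Integrable Q := h3.mono' hQm.aestronglyMeasurable (Filter.Eventually.of_forall fun z => by
        rw [Real.norm_of_nonneg (hQ0 z)]; exact hle R hR z)
      refine ⟨hQi, ?_⟩
      have h4 := integral_mono hQi h3 (hle R hR)
      rw [integral_const_mul] at h4
      rw [← hK] at h2
      have h5 : (∫ z : ℝ × EuclideanSpace ℝ (Fin N), J z * (thT T z.1 * psiR N (N + 3) R z.2)) ≤ 2 * T * (K / R ^ 3) := by
        rw [one_div, inv_mul_le_iff₀ (by positivity)] at h2; exact h2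
      calc _ ≤ _ := h4
        _ ≤ (4 / 3) ^ (N + 3) * (2 * T * (K / R ^ 3)) := by gcongr
        _ = _ := by ring
    have hlim : Filter.Tendsto (fun R : ℝ => ((4 / 3) ^ (N + 3) * (2 * T) * K) / R ^ 3) Filter.atTop (nhds 0) :=
      Filter.Tendsto.const_div_atTop (Filter.tendsto_pow_atTop (by norm_num)) _
    have hz : ∫ z, Q z ≤ 0 := by
      refine ge_of_tendsto hlim ?_
      filter_upwards [Filter.eventually_ge_atTop (2 * T)] with R hR using (hest R hR).2
    have hz2 : ∫ z, Q z = 0 := le_antisymm hz (integral_nonneg hQ0)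
    rw [integral_eq_zero_iff_of_nonneg hQ0 (hest _ le_rfl).1] at hz2
    filter_upwards [hz2] with z hz hzn
    rw [hQ, indicator_of_mem (show z ∈ S from hzn)] at hz
    exact hz
  rw [← ae_all_iff] at main
  filter_upwards [main] with z hz
  by_cases ht : z.1 ≤ 0
  · exact h0 z ht
  push Not at ht
  obtain ⟨n, hn⟩ := exists_nat_ge (max ‖z.2‖ z.1)
  have h1 := hz n ((le_max_left _ _).trans (hn.trans (by linarith)))
  have h2 := thT_pos (n + 1 : ℝ) z.1 ht (by have := (le_max_right _ _).trans hn; linarith)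
  exact (mul_eq_zero.1 h1).resolve_right h2.ne'

/-- comparison principle with a smooth supersolution -/
lemma aux_comp (N : ℕ) (m : ℝ) (hm : 1 < m)
    (g : Fin N → ℝ × EuclideanSpace ℝ (Fin N) → ℝ) (f w v : ℝ × EuclideanSpace ℝ (Fin N) → ℝ)
    (u0 : EuclideanSpace ℝ (Fin N) → ℝ) (hu00 : ∀ x, 0 ≤ u0 x)
    (hgm : ∀ i, Measurable (g i)) (hfm : Measurable f)
    (hwm : Measurable w) (C : ℝ) (hw0 : ∀ z, 0 ≤ w z) (hwC : ∀ z, w z ≤ C)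
    (hwt : ∀ z, z.1 ≤ 0 → w z = 0)
    (hvdef : ∀ z, v z = if 0 < z.1 then w z - u0 z.2 else 0)
    (hg2 : ∀ i, ∀ R : ℝ, IntegrableOn (fun z => g i z ^ 2) (Metric.closedBall 0 R))
    (hf2 : ∀ R : ℝ, IntegrableOn (fun z => f z ^ 2) (Metric.closedBall 0 R))
    (hv : LocallyIntegrable v)
    (I1 : ∀ ζ : ℝ × EuclideanSpace ℝ (Fin N) → ℝ, ContDiff ℝ 1 ζ → HasCompactSupport ζ →
      ∫ z, v z * fderiv ℝ ζ z (1, 0) = ∫ z, ((∑ i, g i z * fderiv ℝ ζ z (0, EuclideanSpace.single i 1)) + f z * ζ z))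
    (I2 : ∀ i, ∀ ζ : ℝ × EuclideanSpace ℝ (Fin N) → ℝ, ContDiff ℝ 1 ζ → HasCompactSupport ζ →
      ∫ z, w z ^ m * fderiv ℝ ζ z (0, EuclideanSpace.single i 1) = - ∫ z, g i z * ζ z)
    (W : ℝ × EuclideanSpace ℝ (Fin N) → ℝ) (hW : ContDiff ℝ 1 W) (hW0 : ∀ z, 0 ≤ W z)
    (hWd : ∀ i : Fin N, Differentiable ℝ (fun z => fderiv ℝ W z (0, EuclideanSpace.single i 1)))
    (hWL : ∀ i : Fin N, LocallyIntegrable (fun z => fderiv ℝ (fun z => fderiv ℝ W z (0, EuclideanSpace.single i 1)) z (0, EuclideanSpace.single i 1)))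
    (hini : ∃ τ > (0:ℝ), ∀ᵐ x, ∀ t : ℝ, 0 < t → t < τ → u0 x ^ m ≤ W (t, x))
    (hcomp : ∀ᵐ z : ℝ × EuclideanSpace ℝ (Fin N), ((∑ i, fderiv ℝ (fun z => fderiv ℝ W z (0, EuclideanSpace.single i 1)) z (0, EuclideanSpace.single i 1)) - f z) * max (w z ^ m - W z) 0 ^ 2
      ≤ KK m (w z) (W z) * fderiv ℝ W z (1, 0)) :
    ∀ᵐ z, w z ^ m ≤ W z := by
  have hC0 : 0 ≤ C := (hw0 0).trans (hwC 0)
  have hconv : ∃ τ > (0:ℝ), ∀ h : ℝ, 0 < h → h < τ → ∀ᵐ z : ℝ × EuclideanSpace ℝ (Fin N),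
      FF m (w z) (W z) - FF m (w (z - h • ((1 : ℝ), (0 : EuclideanSpace ℝ (Fin N))))) (W z) ≤
        (v z - v (z - h • ((1 : ℝ), (0 : EuclideanSpace ℝ (Fin N))))) * max (w z ^ m - W z) 0 ^ 2 := by
    obtain ⟨τ, hτ, hx⟩ := hini
    refine ⟨τ, hτ, fun h hh hhτ => ?_⟩
    have hx2 : ∀ᵐ z : ℝ × EuclideanSpace ℝ (Fin N), ∀ t : ℝ, 0 < t → t < τ → u0 z.2 ^ m ≤ W (t, z.2) := by
      rw [Measure.volume_eq_prod]
      exact Measure.quasiMeasurePreserving_snd.ae hx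
    filter_upwards [hx2] with z hz
    have e1 : (z - h • ((1 : ℝ), (0 : EuclideanSpace ℝ (Fin N)))).1 = z.1 - h := by simp
    have e2 : (z - h • ((1 : ℝ), (0 : EuclideanSpace ℝ (Fin N)))).2 = z.2 := by simp
    rw [hvdef z, hvdef (z - _), e1, e2]
    set z' := (z - h • ((1 : ℝ), (0 : EuclideanSpace ℝ (Fin N))))
    by_cases h1 : z.1 ≤ 0
    · rw [if_neg (by linarith), if_neg (by linarith), hwt z h1, hwt z' (by rw [e1]; linarith)]
      simp
    push Not at h1
    rw [if_pos h1]
    by_cases h2 : 0 < z.1 - h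
    · rw [if_pos h2]
      calc _ ≤ _ := FF_convex m hm (W z) (w z) (w z') (hw0 _) (hw0 _)
        _ = _ := by ring
    · rw [if_neg h2, hwt z' (by rw [e1]; linarith), FF_zero]
      have h3 := FF_convex m hm (W z) (w z) (u0 z.2) (hw0 _) (hu00 _)
      rw [FF_eq_zero m hm (u0 z.2) (W z) (hu00 _) (hz z.1 h1 (by linarith))] at h3
      simpa using h3
  have hWm : Measurable W := hW.continuous.measurable
  have hwWm : Measurable (fun z => (w z, W z)) := hwm.prodMk hWm
  have hae := aux_R4 N (m * C ^ (m - 1)) (C * (C ^ m) ^ 2) (fun z => FF m (w z) (W z)) (fun z => max (w z ^ m - W z) 0 ^ 3 / 3)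
    ((FF_cont m hm).measurable.comp hwWm) (((((hwm.pow_const m).sub hWm).max measurable_const).pow_const 3).div_const 3)
    (by positivity) (fun z => FF_nonneg _ _ _ (hw0 z)) (fun z => ?_) (fun z => by positivity)
    (fun z => FF_G m hm (w z) C (W z) (hw0 z) (hwC z) (hW0 z)) (fun z hz => by simp only [hwt z hz, FF_zero])
    (fun φ hφ hφs hφ0 => aux_R3 volume (1, 0) (fun i => (0, EuclideanSpace.single i 1)) m hm g f w v hgm hfm hwm C hw0 hwC hg2 hf2 hv I1 I2
      W φ hW hφ hWd hWL hφs hφ0 hconv hcomp)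
  · filter_upwards [hae] with z hz using le_of_FF_eq_zero m hm _ _ (hw0 z) (hW0 z) hz
  · have h1 := FF_convex m hm (W z) (w z) 0 (hw0 z) le_rfl
    rw [FF_zero, sub_zero, sub_zero] at h1
    refine h1.trans ?_
    have h2 : w z ^ m ≤ C ^ m := Real.rpow_le_rpow (hw0 z) (hwC z) (by linarith)
    have h3 : max (w z ^ m - W z) 0 ≤ C ^ m := max_le (by linarith [hW0 z]) (by positivity)
    have := hwC z
    gcongr

lemma br_T (N : ℕ) (ζ : ℝ × EuclideanSpace ℝ (Fin N) → ℝ) (hs : HasCompactSupport ζ) :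
    ∃ T > (0:ℝ), ∀ z, T ≤ z.1 → z ∉ tsupport ζ := by
  obtain ⟨R, hR⟩ := hs.isCompact.isBounded.subset_closedBall 0
  refine ⟨|R| + 1, by positivity, fun z hz hz2 => ?_⟩
  have h1 := hR hz2
  have h2 : ‖z‖ ≤ R := by simpa using h1
  have h3 := norm_fst_le z
  have h4 := le_abs_self z.1
  have h5 := le_abs_self R
  rw [Real.norm_eq_abs] at h3
  linarith

lemma br_conv (N : ℕ) (F : ℝ × EuclideanSpace ℝ (Fin N) → ℝ) (T : ℝ) (hF : Integrable F)
    (h0 : ∀ s x, s ∉ Ioo 0 T → F (s, x) = 0) : ∫ z, F z = ∫ s in Ioo 0 T, ∫ x, F (s, x) := by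
  rw [Measure.volume_eq_prod] at hF ⊢
  rw [integral_prod F hF, setIntegral_eq_integral_of_forall_compl_eq_zero]
  intro s hs
  simp [h0 s _ hs]

lemma br_I2a (N : ℕ) (i : Fin N) (U gi : ℝ × EuclideanSpace ℝ (Fin N) → ℝ) (hU : LocallyIntegrable U) (hg : LocallyIntegrable gi)
    (hU0 : ∀ z, z.1 ≤ 0 → U z = 0) (hg0 : ∀ z, z.1 ≤ 0 → gi z = 0)
    (h : ∀ ζ : ℝ × EuclideanSpace ℝ (Fin N) → ℝ, ContDiff ℝ 1 ζ → HasCompactSupport ζ → (∀ z, z.1 ≤ 0 → ζ z = 0) →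
      ∫ z, U z * fderiv ℝ ζ z (0, EuclideanSpace.single i 1) = - ∫ z, gi z * ζ z) 
    (ζ : ℝ × EuclideanSpace ℝ (Fin N) → ℝ) (hζ : ContDiff ℝ 1 ζ) (hζs : HasCompactSupport ζ) :
      ∫ z, U z * fderiv ℝ ζ z (0, EuclideanSpace.single i 1) = - ∫ z, gi z * ζ z := by
  set χ : ℕ → ℝ → ℝ := fun n s => Real.smoothTransition (n * s) with hχ
  have hχc : ∀ n, ContDiff ℝ 1 (χ n) := fun n => Real.smoothTransition.contDiff.comp (by fun_prop)
  have hχ0 : ∀ n s, s ≤ 0 → χ n s = 0 := fun n s hs =>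
    Real.smoothTransition.zero_of_nonpos (mul_nonpos_of_nonneg_of_nonpos (by positivity) hs)
  have hχ1 : ∀ n s, |χ n s| ≤ 1 := fun n s => by
    rw [abs_of_nonneg (Real.smoothTransition.nonneg _)]; exact Real.smoothTransition.le_one _
  have hχl : ∀ s, 0 < s → Filter.Tendsto (fun n => χ n s) Filter.atTop (nhds 1) := by
    intro s hs
    refine tendsto_const_nhds.congr' ?_
    obtain ⟨n0, hn0⟩ := exists_nat_ge (1 / s)
    filter_upwards [Filter.eventually_ge_atTop n0] with n hn
    refine (Real.smoothTransition.one_of_one_le ?_).symm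
    have : (n0 : ℝ) ≤ n := by exact_mod_cast hn
    rw [div_le_iff₀ hs] at hn0
    nlinarith
  have hfd : ∀ n z, fderiv ℝ (fun z : ℝ × EuclideanSpace ℝ (Fin N) => χ n z.1 * ζ z) z (0, EuclideanSpace.single i 1)
      = χ n z.1 * fderiv ℝ ζ z (0, EuclideanSpace.single i 1) := by
    intro n z
    have h1 := (((hχc n).differentiable (by norm_num)) z.1).hasDerivAt.comp_hasFDerivAt z (hasFDerivAt_fst (𝕜 := ℝ) (p := z))
    have h2 := ((hζ.differentiable (by norm_num)) z).hasFDerivAt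
    have h3 : HasFDerivAt (fun z : ℝ × EuclideanSpace ℝ (Fin N) => χ n z.1 * ζ z) _ z := h1.mul h2
    rw [h3.fderiv]; simp
  have hn : ∀ n, ∫ z, χ n z.1 * (U z * fderiv ℝ ζ z (0, EuclideanSpace.single i 1)) = - ∫ z, χ n z.1 * (gi z * ζ z) := by
    intro n
    have := h (fun z => χ n z.1 * ζ z) (((hχc n).comp contDiff_fst).mul hζ) (hζs.mul_left) (fun z hz => by simp [hχ0 n z.1 hz])
    simp_rw [hfd] at this
    calc _ = ∫ z, U z * (χ n z.1 * fderiv ℝ ζ z (0, EuclideanSpace.single i 1)) := by congr 1; ext z; ring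
      _ = _ := this
      _ = _ := by congr 2; ext z; ring
  have lim : ∀ k : ℝ × EuclideanSpace ℝ (Fin N) → ℝ, Integrable k → (∀ z, z.1 ≤ 0 → k z = 0) →
      Filter.Tendsto (fun n => ∫ z, χ n z.1 * k z) Filter.atTop (nhds (∫ z, k z)) := by
    intro k hk hk0
    refine tendsto_integral_of_dominated_convergence (fun z => ‖k z‖) (fun n => ?_) hk.norm (fun n => ?_) ?_
    · exact ((hχc n).continuous.comp continuous_fst).aestronglyMeasurable.mul hk.aestronglyMeasurable
    · refine Filter.Eventually.of_forall fun z => ?_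
      rw [norm_mul]
      exact mul_le_of_le_one_left (norm_nonneg _) (hχ1 n z.1)
    · refine Filter.Eventually.of_forall fun z => ?_
      rcases le_or_gt z.1 0 with hz | hz
      · simp [hk0 z hz]
      · simpa using (hχl z.1 hz).mul_const (k z)
  have c1 : Continuous (fun z => fderiv ℝ ζ z (0, EuclideanSpace.single i 1)) := (hζ.continuous_fderiv (by norm_num)).clm_apply continuous_const
  have l1 := lim _ (aux_int_mul hU c1 (hζs.fderiv_apply ℝ _)) (fun z hz => by simp [hU0 z hz])
  have l2 := lim _ (aux_int_mul hg hζ.continuous hζs) (fun z hz => by simp [hg0 z hz])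
  simp_rw [hn] at l1
  exact tendsto_nhds_unique l1 l2.neg

lemma br_L2 (N : ℕ) (g : ℝ → EuclideanSpace ℝ (Fin N) → EuclideanSpace ℝ (Fin N))
    (hgm : Measurable (Function.uncurry g)) 
    (hg : ∀ T > (0:ℝ), ∀ K : Set (EuclideanSpace ℝ (Fin N)), IsCompact K →
        ∫⁻ s in Ioo (0:ℝ) T, ∫⁻ x in K, ENNReal.ofReal (‖g s x‖ ^ 2) < ⊤) (i : Fin N)
    (gi : ℝ × EuclideanSpace ℝ (Fin N) → ℝ) (hgi : gi = fun z => if 0 < z.1 then g z.1 z.2 i else 0) :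
    Measurable gi ∧ ∀ R : ℝ, IntegrableOn (fun z => gi z ^ 2) (Metric.closedBall 0 R) := by
  have hm1 : Measurable (fun z : ℝ × EuclideanSpace ℝ (Fin N) => g z.1 z.2 i) :=
    (EuclideanSpace.proj i : EuclideanSpace ℝ (Fin N) →L[ℝ] ℝ).continuous.measurable.comp hgm
  have hm : Measurable gi := by
    rw [hgi]
    exact Measurable.ite (measurableSet_lt measurable_const measurable_fst) hm1 measurable_const
  refine ⟨hm, fun R => ?_⟩
  set K := Metric.closedBall (0 : EuclideanSpace ℝ (Fin N)) R
  set T := |R| + 1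
  have hA : IntegrableOn (fun z => gi z ^ 2) (Ioo 0 T ×ˢ K) := by
    refine ⟨(hm.pow_const 2).aestronglyMeasurable, ?_⟩
    have h1 := hg T (by positivity) K (isCompact_closedBall 0 R)
    have hmm : Measurable (fun z : ℝ × EuclideanSpace ℝ (Fin N) => ENNReal.ofReal (‖g z.1 z.2‖ ^ 2)) := 
      (hgm.norm.pow_const 2).ennreal_ofReal
    rw [HasFiniteIntegral]
    refine lt_of_le_of_lt (b := ∫⁻ z in Ioo 0 T ×ˢ K, ENNReal.ofReal (‖g z.1 z.2‖ ^ 2)) ?_ ?_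
    · refine lintegral_mono fun z => ?_
      rw [Real.enorm_of_nonneg (by positivity)]
      refine ENNReal.ofReal_le_ofReal ?_
      rw [hgi]
      dsimp only
      split_ifs
      · have := PiLp.norm_apply_le (g z.1 z.2) i
        rw [Real.norm_eq_abs] at this
        rw [← sq_abs]
        gcongr
      · simp; 
    · rw [Measure.volume_eq_prod, ← Measure.prod_restrict, lintegral_prod _ hmm.aemeasurable]
      exact h1
  have hB : IntegrableOn (fun z => gi z ^ 2) (Iic 0 ×ˢ univ) := by
    refine integrableOn_zero.congr_fun (fun z hz => ?_) (measurableSet_Iic.prod MeasurableSet.univ)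
    have : ¬ 0 < z.1 := not_lt.2 hz.1
    simp [hgi, this]
  refine (hA.union hB).mono_set ?_
  intro z hz
  have hz1 : ‖z‖ ≤ R := by simpa using hz
  have h3 := norm_fst_le z
  have h4 := le_abs_self z.1
  have h5 := le_abs_self R
  have h6 := norm_snd_le z
  rw [Real.norm_eq_abs] at h3
  rcases le_or_gt z.1 0 with h | h
  · right; exact ⟨h, mem_univ _⟩
  · left; exact ⟨⟨h, by show z.1 < |R| + 1; linarith⟩, by show z.2 ∈ Metric.closedBall 0 R; simp; linarith⟩

lemma weak_comp (N : ℕ) (m q σ : ℝ) (hm : 1 < m) (hq0 : 0 < q) (hσ0 : 0 < σ)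
    (u0 : EuclideanSpace ℝ (Fin N) → ℝ) (hu0 : IsBddNonneg N u0)
    (u : ℝ → EuclideanSpace ℝ (Fin N) → ℝ) (hu : IsWeakSolution N m q (fun x => ‖x‖ ^ σ) u0 u)
    (w : ℝ × EuclideanSpace ℝ (Fin N) → ℝ) (hw : w = fun z => if 0 < z.1 then u z.1 z.2 else 0)
    (W : ℝ × EuclideanSpace ℝ (Fin N) → ℝ) (hW : ContDiff ℝ 1 W) (hW0 : ∀ z, 0 ≤ W z)
    (hWd : ∀ i : Fin N, Differentiable ℝ (fun z => fderiv ℝ W z (0, EuclideanSpace.single i 1)))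
    (hWL : ∀ i : Fin N, LocallyIntegrable (fun z => fderiv ℝ (fun z => fderiv ℝ W z (0, EuclideanSpace.single i 1)) z (0, EuclideanSpace.single i 1)))
    (hini : ∃ τ > (0:ℝ), ∀ᵐ x, ∀ t : ℝ, 0 < t → t < τ → u0 x ^ m ≤ W (t, x))
    (hcomp : ∀ᵐ z : ℝ × EuclideanSpace ℝ (Fin N), ((∑ i, fderiv ℝ (fun z => fderiv ℝ W z (0, EuclideanSpace.single i 1)) z (0, EuclideanSpace.single i 1)) - ‖z.2‖ ^ σ * w z ^ q) * max (w z ^ m - W z) 0 ^ 2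
      ≤ KK m (w z) (W z) * fderiv ℝ W z (1, 0)) :
    ∀ᵐ z, w z ^ m ≤ W z := by
  obtain ⟨hum, hu00, ⟨C, hC⟩, G, hGm, hG⟩ := hu
  obtain ⟨hu0m, hu0n, ⟨C0, hC0⟩⟩ := hu0
  have hC00 : 0 ≤ C := (hu00 0 0).trans (hC 0 0)
  have hpos : MeasurableSet {z : ℝ × EuclideanSpace ℝ (Fin N) | 0 < z.1} := measurableSet_lt measurable_const measurable_fst
  have hwm : Measurable w := by
    rw [hw]; exact Measurable.ite hpos hum measurable_const
  have hw0 : ∀ z, 0 ≤ w z := fun z => by rw [hw]; dsimp only; split_ifs; exacts [hu00 _ _, le_rfl]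
  have hwC : ∀ z, w z ≤ C := fun z => by rw [hw]; dsimp only; split_ifs; exacts [hC _ _, hC00]
  have hwt : ∀ z, z.1 ≤ 0 → w z = 0 := fun z hz => by rw [hw]; simp [not_lt.2 hz]
  set g : Fin N → ℝ × EuclideanSpace ℝ (Fin N) → ℝ := fun i z => if 0 < z.1 then G z.1 z.2 i else 0 with hg
  have hL2 := fun i => br_L2 N G hGm (fun T hT => (hG T hT).1) i (g i) rfl
  set f : ℝ × EuclideanSpace ℝ (Fin N) → ℝ := fun z => ‖z.2‖ ^ σ * w z ^ q with hf
  set v : ℝ × EuclideanSpace ℝ (Fin N) → ℝ := fun z => if 0 < z.1 then w z - u0 z.2 else 0 with hv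
  have hfm : Measurable f := (measurable_snd.norm.pow_const σ).mul (hwm.pow_const q)
  have hvm : Measurable v := Measurable.ite hpos (hwm.sub (hu0m.comp measurable_snd)) measurable_const
  have hf0 : ∀ z, 0 ≤ f z := fun z => mul_nonneg (Real.rpow_nonneg (norm_nonneg _) _) (Real.rpow_nonneg (hw0 z) _)
  have hf2 : ∀ R : ℝ, IntegrableOn (fun z => f z ^ 2) (Metric.closedBall 0 R) := by
    intro R
    refine Measure.integrableOn_of_bounded (M := (|R| ^ σ * C ^ q) ^ 2) measure_closedBall_lt_top.ne (hfm.pow_const 2).aestronglyMeasurable ?_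
    filter_upwards [ae_restrict_mem measurableSet_closedBall] with z hz
    have hz1 : ‖z‖ ≤ R := by simpa using hz
    have h2 : ‖z.2‖ ≤ |R| := (norm_snd_le z).trans (hz1.trans (le_abs_self _))
    rw [Real.norm_of_nonneg (by positivity)]
    have := hf0 z
    gcongr
    show ‖z.2‖ ^ σ * w z ^ q ≤ _
    have := hw0 z
    have := hwC z
    gcongr
  have hvl : LocallyIntegrable v := by
    refine (locallyIntegrable_const (C + C0)).mono hvm.aestronglyMeasurable (Filter.Eventually.of_forall fun z => ?_)
    have hC0' : 0 ≤ C0 := (hu0n 0).trans (hC0 0)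
    rw [Real.norm_of_nonneg (by positivity : 0 ≤ C + C0), Real.norm_eq_abs, hv]
    dsimp only
    split_ifs
    · rw [abs_le]; constructor <;> linarith [hw0 z, hwC z, hu0n z.2, hC0 z.2]
    · simp; positivity
  have hgl : ∀ i, LocallyIntegrable (g i) := fun i => aux_locInt_of_sq volume (g i) (hL2 i).1 (hL2 i).2
  have hfl : LocallyIntegrable f := aux_locInt_of_sq volume f hfm hf2
  have hUl : LocallyIntegrable (fun z => w z ^ m) := by
    refine (locallyIntegrable_const (C ^ m)).mono (hwm.pow_const m).aestronglyMeasurable (Filter.Eventually.of_forall fun z => ?_)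
    rw [Real.norm_of_nonneg (by positivity : 0 ≤ C ^ m), Real.norm_of_nonneg (Real.rpow_nonneg (hw0 z) _)]
    exact Real.rpow_le_rpow (hw0 z) (hwC z) (by linarith)
  have cd : ∀ ζ : ℝ × EuclideanSpace ℝ (Fin N) → ℝ, ContDiff ℝ 1 ζ → ∀ e, Continuous (fun z => fderiv ℝ ζ z e) := fun ζ hζ e =>
    (hζ.continuous_fderiv (by norm_num)).clm_apply continuous_const
  have fd0 : ∀ ζ : ℝ × EuclideanSpace ℝ (Fin N) → ℝ, ∀ z, z ∉ tsupport ζ → fderiv ℝ ζ z = 0 := fun ζ z hz => by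
    by_contra hc
    exact hz (support_fderiv_subset ℝ hc)
  refine aux_comp N m hm g f w v u0 hu0n (fun i => (hL2 i).1) hfm hwm C hw0 hwC hwt (fun z => rfl) (fun i => (hL2 i).2) hf2 hvl ?_ ?_
    W hW hW0 hWd hWL hini hcomp
  · intro ζ hζ hζs
    obtain ⟨T, hT, hTs⟩ := br_T N ζ hζs
    have h1 := (hG T hT).2.2 ζ hζ hζs (fun s x hs => image_eq_zero_of_notMem_tsupport (hTs (s, x) hs))
    have i1 : Integrable (fun z => v z * fderiv ℝ ζ z (1, 0)) := aux_int_mul hvl (cd ζ hζ _) (hζs.fderiv_apply ℝ _)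
    have i2 : ∀ i, Integrable (fun z => g i z * fderiv ℝ ζ z (0, EuclideanSpace.single i 1)) := fun i =>
      aux_int_mul (hgl i) (cd ζ hζ _) (hζs.fderiv_apply ℝ _)
    have i3 : Integrable (fun z => f z * ζ z) := aux_int_mul hfl hζ.continuous hζs
    have i4 : Integrable (fun z => (∑ i, g i z * fderiv ℝ ζ z (0, EuclideanSpace.single i 1)) + f z * ζ z) :=
      (integrable_finsetSum _ fun i _ => i2 i).add i3
    have h2 := br_conv N (fun z => ((∑ i, g i z * fderiv ℝ ζ z (0, EuclideanSpace.single i 1)) + f z * ζ z) - v z * fderiv ℝ ζ z (1, 0)) T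
      (i4.sub i1) (by
        intro s x hs
        rw [mem_Ioo, not_and_or] at hs
        rcases hs with hs | hs
        · have e1 : w (s, x) = 0 := hwt (s, x) (not_lt.1 hs)
          simp [hg, hf, hv, hs, e1, Real.zero_rpow hq0.ne']
        · have e1 := hTs (s, x) (not_lt.1 hs)
          simp [fd0 ζ _ e1, image_eq_zero_of_notMem_tsupport e1])
    have h3 : ∫ s in Ioo 0 T, ∫ x, (((∑ i, g i (s, x) * fderiv ℝ ζ (s, x) (0, EuclideanSpace.single i 1)) + f (s, x) * ζ (s, x)) - v (s, x) * fderiv ℝ ζ (s, x) (1, 0)) = 0 := by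
      refine Eq.trans ?_ h1
      refine setIntegral_congr_fun measurableSet_Ioo fun s hs => ?_
      refine integral_congr_ae (Filter.Eventually.of_forall fun x => ?_)
      have e0 : w (s, x) = u s x := by rw [hw]; simp [hs.1]
      have e3 : fderiv ℝ ζ (s, x) (0, G s x) = ∑ i, G s x i * fderiv ℝ ζ (s, x) (0, EuclideanSpace.single i 1) := by
        have : ((0 : ℝ), G s x) = ∑ i, G s x i • ((0 : ℝ), EuclideanSpace.single i (1 : ℝ)) := by
          have h := (EuclideanSpace.basisFun (Fin N) ℝ).sum_repr (G s x)
          refine Prod.ext ?_ ?_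
          · simp [Prod.fst_sum]
          · simp only [Prod.snd_sum, Prod.smul_snd]
            conv_lhs => rw [← h]
            simp
        rw [this, map_sum]
        simp [-Prod.smul_mk]
      have e4 : ∀ i, g i (s, x) = G s x i := fun i => by simp [hg, hs.1]
      have e5 : v (s, x) = u s x - u0 x := by simp [hv, hs.1, e0]
      simp only [e4, e5, hf, e0, e3]
      ring
    rw [h3, integral_sub i4 i1] at h2
    linarith
  · intro i
    refine br_I2a N i (fun z => w z ^ m) (g i) hUl (hgl i) (fun z hz => by simp [hwt z hz, Real.zero_rpow (by linarith : m ≠ 0)])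
      (fun z hz => by simp [hg, not_lt.2 hz]) ?_
    intro ζ hζ hζs hζ0
    obtain ⟨T, hT, hTs⟩ := br_T N ζ hζs
    have hz : ∀ s x, s ∉ Ioo (0:ℝ) T → ζ (s, x) = 0 := by
      intro s x hs
      rw [mem_Ioo, not_and_or] at hs
      rcases hs with hs | hs
      · exact hζ0 _ (not_lt.1 hs)
      · exact image_eq_zero_of_notMem_tsupport (hTs (s, x) (not_lt.1 hs))
    have h1 := (hG T hT).2.1 ζ hζ hζs hz i
    rw [br_conv N _ T (aux_int_mul hUl (cd ζ hζ _) (hζs.fderiv_apply ℝ _)), br_conv N _ T (aux_int_mul (hgl i) hζ.continuous hζs)]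
    · convert h1 using 1
      · refine setIntegral_congr_fun measurableSet_Ioo fun s hs => ?_
        refine integral_congr_ae (Filter.Eventually.of_forall fun x => ?_)
        simp [hw, hs.1]
      · congr 1
        refine setIntegral_congr_fun measurableSet_Ioo fun s hs => ?_
        refine integral_congr_ae (Filter.Eventually.of_forall fun x => ?_)
        simp [hg, hs.1]
    · intro s x hs; simp [hz s x hs]
    · intro s x hs
      rw [mem_Ioo, not_and_or] at hs
      rcases hs with hs | hs
      · simp [hwt (s, x) (not_lt.1 hs), Real.zero_rpow (by linarith : m ≠ 0)]
      · simp [fd0 ζ _ (hTs (s, x) (not_lt.1 hs))]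

lemma npow_deriv2 (N : ℕ) (s : ℝ) (hs : 0 < s) (i : Fin N) (x : EuclideanSpace ℝ (Fin N)) :
    DifferentiableAt ℝ (fun x : EuclideanSpace ℝ (Fin N) => ‖x‖ ^ s * x i) x ∧
    fderiv ℝ (fun x : EuclideanSpace ℝ (Fin N) => ‖x‖ ^ s * x i) x (EuclideanSpace.single i 1) =
      s * ‖x‖ ^ (s - 2) * x i ^ 2 + ‖x‖ ^ s := by
  by_cases hx : x = 0
  · subst hx
    have h : HasFDerivAt (fun x : EuclideanSpace ℝ (Fin N) => ‖x‖ ^ s * x i) (0 : EuclideanSpace ℝ (Fin N) →L[ℝ] ℝ) 0 := by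
      rw [hasFDerivAt_iff_isLittleO_nhds_zero]
      simp only [zero_add, norm_zero, PiLp.zero_apply, mul_zero, sub_zero, _root_.zero_apply]
      have h1 : (fun x : EuclideanSpace ℝ (Fin N) => ‖x‖ ^ s) =o[nhds 0] (fun _ => (1 : ℝ)) := by
        rw [Asymptotics.isLittleO_one_iff]
        have : Continuous (fun x : EuclideanSpace ℝ (Fin N) => ‖x‖ ^ s) := continuous_norm.rpow_const (fun _ => Or.inr hs.le)
        have h := this.tendsto 0
        simpa [Real.zero_rpow hs.ne'] using h
      have h2 : (fun x : EuclideanSpace ℝ (Fin N) => x i) =O[nhds 0] (fun x => ‖x‖) :=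
        Asymptotics.IsBigO.of_bound 1 (Filter.Eventually.of_forall fun x => by
          simpa using PiLp.norm_apply_le x i)
      have := h1.mul_isBigO h2
      simp only [one_mul] at this
      exact Asymptotics.isLittleO_norm_right.1 this
    refine ⟨h.differentiableAt, ?_⟩
    rw [h.fderiv]; simp [Real.zero_rpow hs.ne']
  · have hn : 0 < ‖x‖ := norm_pos_iff.2 hx
    have h1 := ((hasStrictFDerivAt_norm_sq x).hasFDerivAt).rpow_const (p := s / 2) (Or.inl (by positivity))
    have h2 : HasFDerivAt (fun x : EuclideanSpace ℝ (Fin N) => x i) (EuclideanSpace.proj i : EuclideanSpace ℝ (Fin N) →L[ℝ] ℝ) x :=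
      (EuclideanSpace.proj i : EuclideanSpace ℝ (Fin N) →L[ℝ] ℝ).hasFDerivAt
    have e : ∀ (r : ℝ) (y : EuclideanSpace ℝ (Fin N)), (‖y‖ ^ 2) ^ r = ‖y‖ ^ (2 * r) := fun r y => by
      rw [← Real.rpow_natCast, ← Real.rpow_mul (norm_nonneg _)]; norm_num
    have h3 := h1.mul h2
    have h4 : HasFDerivAt (fun x : EuclideanSpace ℝ (Fin N) => ‖x‖ ^ s * x i) _ x := h3.congr_of_eventuallyEq (Filter.Eventually.of_forall fun y => by
      show ‖y‖ ^ s * y i = (‖y‖ ^ 2) ^ (s / 2) * y i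
      rw [e]; congr 2; ring)
    refine ⟨h4.differentiableAt, ?_⟩
    rw [h4.fderiv]
    simp [EuclideanSpace.inner_single_right, e]
    rw [show 2 * (s / 2) = s by ring, show 2 * (s / 2 - 1) = s - 2 by ring]
    ring

lemma npow_data (N : ℕ) (b : ℝ) (hb : 2 < b) :
    ContDiff ℝ 1 (fun x : EuclideanSpace ℝ (Fin N) => ‖x‖ ^ b) ∧
    (∀ i : Fin N, Differentiable ℝ (fun x => fderiv ℝ (fun x : EuclideanSpace ℝ (Fin N) => ‖x‖ ^ b) x (EuclideanSpace.single i 1))) ∧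
    (∀ (i : Fin N) x, fderiv ℝ (fun x => fderiv ℝ (fun x : EuclideanSpace ℝ (Fin N) => ‖x‖ ^ b) x (EuclideanSpace.single i 1)) x (EuclideanSpace.single i 1)
      = b * ((b - 2) * ‖x‖ ^ (b - 2 - 2) * x i ^ 2 + ‖x‖ ^ (b - 2))) := by
  have e : ∀ i : Fin N, (fun x => fderiv ℝ (fun x : EuclideanSpace ℝ (Fin N) => ‖x‖ ^ b) x (EuclideanSpace.single i 1)) =
      fun x => b * (‖x‖ ^ (b - 2) * x i) := by
    intro i; ext x
    rw [(hasFDerivAt_norm_rpow x (by linarith : 1 < b)).fderiv]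
    simp [EuclideanSpace.inner_single_right]; ring
  refine ⟨contDiff_norm_rpow (by linarith), fun i => ?_, fun i x => ?_⟩
  · rw [e]
    exact fun x => ((npow_deriv2 N (b - 2) (by linarith) i x).1).const_mul b
  · rw [e, fderiv_const_mul (npow_deriv2 N (b - 2) (by linarith) i x).1]
    simp [(npow_deriv2 N (b - 2) (by linarith) i x).2]

lemma npow_pt (N : ℕ) (x : EuclideanSpace ℝ (Fin N)) (s : ℝ) (hs : 0 < s) : ‖x‖ ^ (s - 2) * ‖x‖ ^ 2 = ‖x‖ ^ s := by
  rcases (norm_nonneg x).eq_or_lt with h | h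
  · rw [← h, Real.zero_rpow hs.ne']; simp
  · rw [← Real.rpow_natCast, ← Real.rpow_add h]; congr 1; push_cast; ring

lemma npow_lap (N : ℕ) (b : ℝ) (hb : 2 < b) (x : EuclideanSpace ℝ (Fin N)) :
    ∑ i : Fin N, (b * ((b - 2) * ‖x‖ ^ (b - 2 - 2) * x i ^ 2 + ‖x‖ ^ (b - 2))) = b * (b + N - 2) * ‖x‖ ^ (b - 2) := by
  rw [← Finset.mul_sum, Finset.sum_add_distrib, ← Finset.mul_sum, ← EuclideanSpace.real_norm_sq_eq, mul_assoc, npow_pt N x _ (by linarith)]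
  simp; ring

lemma npow_loc (N : ℕ) (b A : ℝ) (hb : 2 < b) (i : Fin N) :
    LocallyIntegrable (fun z : ℝ × EuclideanSpace ℝ (Fin N) => A * (b * ((b - 2) * ‖z.2‖ ^ (b - 2 - 2) * z.2 i ^ 2 + ‖z.2‖ ^ (b - 2)))) := by
  have hc : Continuous (fun z : ℝ × EuclideanSpace ℝ (Fin N) => |A| * (b * ((b - 1) * ‖z.2‖ ^ (b - 2)))) := by
    have : Continuous (fun z : ℝ × EuclideanSpace ℝ (Fin N) => ‖z.2‖ ^ (b - 2)) := continuous_snd.norm.rpow_const (fun _ => Or.inr (by linarith))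
    fun_prop
  refine hc.locallyIntegrable.mono ?_ (Filter.Eventually.of_forall fun z => ?_)
  · refine Measurable.aestronglyMeasurable ?_
    have h1 : Measurable (fun z : ℝ × EuclideanSpace ℝ (Fin N) => ‖z.2‖ ^ (b - 2)) := measurable_snd.norm.pow_const _
    have h2 : Measurable (fun z : ℝ × EuclideanSpace ℝ (Fin N) => ‖z.2‖ ^ (b - 2 - 2)) := measurable_snd.norm.pow_const _
    have h3 : Measurable (fun z : ℝ × EuclideanSpace ℝ (Fin N) => z.2 i) := 
      ((EuclideanSpace.proj i : EuclideanSpace ℝ (Fin N) →L[ℝ] ℝ).continuous.comp continuous_snd).measurable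
    fun_prop
  · have h1 := npow_pt N z.2 (b - 2) (by linarith)
    have h2 : z.2 i ^ 2 ≤ ‖z.2‖ ^ 2 := by
      have := PiLp.norm_apply_le z.2 i
      rw [Real.norm_eq_abs] at this
      rw [← sq_abs]; gcongr
    have hb2 : 0 < b - 2 := by linarith
    have hb1 : 0 < b - 1 := by linarith
    have hb0 : 0 < b := by linarith
    rw [norm_mul, Real.norm_eq_abs, Real.norm_of_nonneg (by positivity), Real.norm_of_nonneg (by positivity)]
    have h3 : ‖z.2‖ ^ (b - 2 - 2) * z.2 i ^ 2 ≤ ‖z.2‖ ^ (b - 2) := by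
      rw [← h1]; gcongr
    have h4 := mul_le_mul_of_nonneg_left h3 hb2.le
    gcongr
    linarith

lemma posr_hasDerivAt (r s : ℝ) (hr : 1 < r) : HasDerivAt (fun s : ℝ => max s 0 ^ r) (r * max s 0 ^ (r - 1)) s := by
  have hc : ∀ p : ℝ, 0 < p → Continuous (fun s : ℝ => max s 0 ^ p) := fun p hp =>
    (continuous_id.max continuous_const).rpow_const (fun _ => Or.inr hp.le)
  refine hasDerivAt_of_hasDerivAt_of_ne' (x := 0) (g := fun s => r * max s 0 ^ (r - 1)) (fun y hy => ?_) (hc r (by linarith)).continuousAt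
    ((hc (r - 1) (by linarith)).const_mul r).continuousAt s
  rcases lt_or_gt_of_ne hy with h | h
  · rw [max_eq_right h.le, Real.zero_rpow (by linarith), mul_zero]
    refine (hasDerivAt_const y (0 : ℝ)).congr_of_eventuallyEq ?_
    filter_upwards [Iio_mem_nhds h] with t ht
    rw [max_eq_right (le_of_lt ht), Real.zero_rpow (by linarith)]
  · rw [max_eq_left h.le]
    refine (Real.hasDerivAt_rpow_const (p := r) (Or.inl h.ne')).congr_of_eventuallyEq ?_
    filter_upwards [Ioi_mem_nhds h] with t ht
    rw [max_eq_left (le_of_lt ht)]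

lemma posr_contDiff (r : ℝ) (hr : 1 < r) : ContDiff ℝ 1 (fun s : ℝ => max s 0 ^ r) := by
  rw [contDiff_one_iff_deriv]
  refine ⟨fun s => (posr_hasDerivAt r s hr).differentiableAt, ?_⟩
  have : deriv (fun s : ℝ => max s 0 ^ r) = fun s => r * max s 0 ^ (r - 1) := by
    ext s; exact (posr_hasDerivAt r s hr).deriv
  rw [this]
  exact ((continuous_id.max continuous_const).rpow_const (fun _ => Or.inr (by linarith))).const_mul r

lemma KK_eq_zero (m : ℝ) (hm : 1 < m) (r W : ℝ) (hr : 0 ≤ r) (h : r ^ m ≤ W) : KK m r W = 0 := by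
  unfold KK
  rw [intervalIntegral.integral_congr (g := fun _ => (0 : ℝ))]
  · simp
  · intro ρ hρ
    rw [uIcc_of_le hr] at hρ
    have : ρ ^ m ≤ r ^ m := Real.rpow_le_rpow hρ.1 hρ.2 (by linarith)
    simp only
    rw [max_eq_right (by linarith)]; simp

lemma KK_H (m : ℝ) (hm : 1 < m) (r y : ℝ) (hr : 0 ≤ r) (hy : 0 ≤ y) :
    m * y ^ (m - 1) * KK m r (y ^ m) ≤ max (r ^ m - y ^ m) 0 ^ 2 := by
  have hc : Continuous (fun ρ : ℝ => 2 * max (ρ ^ m - y ^ m) 0) :=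
    (((Real.continuous_rpow_const (by linarith)).sub continuous_const).max continuous_const).const_mul 2
  have hK : ∀ s, HasDerivAt (fun s => KK m s (y ^ m)) (2 * max (s ^ m - y ^ m) 0) s := fun s => by
    unfold KK
    exact intervalIntegral.integral_hasDerivAt_right (hc.intervalIntegrable _ _)
      (hc.stronglyMeasurableAtFilter _ _) hc.continuousAt
  have hd : ∀ s, HasDerivAt (fun s => max (s ^ m - y ^ m) 0 ^ 2 - m * y ^ (m - 1) * KK m s (y ^ m))
      (2 * max (s ^ m - y ^ m) 0 * (m * s ^ (m - 1)) - m * y ^ (m - 1) * (2 * max (s ^ m - y ^ m) 0)) s := by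
    intro s
    have h1 := (hK s).const_mul (m * y ^ (m - 1))
    have h2 : HasDerivAt (fun s : ℝ => s ^ m - y ^ m) (m * s ^ (m - 1)) s :=
      (Real.hasDerivAt_rpow_const (Or.inr hm.le)).sub_const _
    have h3 := ((posp_hasDerivAt 0 (s ^ m - y ^ m)).comp s h2)
    refine (h3.sub h1).congr_deriv ?_
    push_cast; ring
  have := monotoneOn_of_deriv_nonneg (convex_Icc 0 r)
    (fun s _ => (hd s).continuousAt.continuousWithinAt)
    (fun s _ => (hd s).differentiableAt.differentiableWithinAt)
    (fun s hs => by
      rw [(hd s).deriv]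
      have hs := interior_subset hs
      rcases le_or_gt s y with hsy | hsy
      · have : s ^ m ≤ y ^ m := Real.rpow_le_rpow hs.1 hsy (by linarith)
        rw [max_eq_right (by linarith)]; simp
      · have : y ^ (m - 1) ≤ s ^ (m - 1) := Real.rpow_le_rpow hy hsy.le (by linarith)
        have h2 := mul_nonneg (mul_nonneg (by linarith : 0 ≤ m) (le_max_right (s ^ m - y ^ m) 0)) (sub_nonneg.2 this)
        nlinarith) ⟨le_rfl, hr⟩ ⟨hr, le_rfl⟩ hr
  simp only [KK_zero] at this
  have hy2 : 0 ≤ y ^ m := by positivity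
  rw [Real.zero_rpow (by linarith), max_eq_right (by linarith)] at this
  simp at this
  linarith

/-- **Corollary 1.4.**
Let `N ≥ 1`, `m > 1`, `q ∈ (0,1)`, `σ ≥ 2(1−q)/(m−1)`, `a > σ/(1−q)` and `A₀ > 0`.
Then there exists `M > 0` (depending only on `m, a, N, q, σ, A₀`) such that: for every
non-negative `u₀ ∈ L^∞(ℝᴺ)` with `u₀(x) ≤ A₀|x|^a` a.e. and `‖u₀‖_∞ ≤ M`, every
non-negative weak solution of `∂ₜ u = Δ(uᵐ) − |x|^σ u^q` with `u(0) = u₀` vanishes in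
finite time. -/
theorem finite_time_extinction_flat_small_data
    (N : ℕ) (hN : 1 ≤ N) (m q σ : ℝ) (hm : 1 < m) (hq0 : 0 < q) (hq1 : q < 1)
    (hσ0 : 0 < σ) (hσ : 2 * (1 - q) / (m - 1) ≤ σ)
    (a A0 : ℝ) (ha : σ / (1 - q) < a) (hA0 : 0 < A0) :
    ∃ M : ℝ, 0 < M ∧
      ∀ u0 : EuclideanSpace ℝ (Fin N) → ℝ, IsBddNonneg N u0 →
        (∀ᵐ x : EuclideanSpace ℝ (Fin N), u0 x ≤ A0 * ‖x‖ ^ a) →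
        (∀ᵐ x : EuclideanSpace ℝ (Fin N), u0 x ≤ M) →
        ∀ u : ℝ → EuclideanSpace ℝ (Fin N) → ℝ,
          IsWeakSolution N m q (fun x => ‖x‖ ^ σ) u0 u →
          VanishesInFiniteTime N u := by
  have hN1 : (1 : ℝ) ≤ N := by exact_mod_cast hN
  have hm0 : 0 < m - 1 := by linarith
  have hmp : 0 < m := by linarith
  have hq' : 0 < 1 - q := by linarith
  have ha1 : σ < a * (1 - q) := by rwa [div_lt_iff₀ hq'] at ha
  have ha0 : 0 < a := lt_trans (by positivity) ha
  have ha2 : 2 < a * (m - 1) := by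
    rw [div_le_iff₀ hm0] at hσ
    have h1 : σ * (m - 1) < a * (1 - q) * (m - 1) := by gcongr
    have h2 : 2 * (1 - q) < (a * (m - 1)) * (1 - q) := by linarith
    exact lt_of_mul_lt_mul_right h2 hq'.le
  set b := a * m with hb
  have hb2 : 2 < b := by rw [hb]; nlinarith
  set l := a * (m - q) - σ - 2 with hl
  have hl0 : 0 < l := by rw [hl]; nlinarith
  set c1 := b * (b + N - 2) with hc1
  have hc1p : 0 < c1 := mul_pos (by linarith) (by linarith)
  set R := (A0 ^ q / (A0 ^ m * c1)) ^ (1 / l) with hR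
  have hR0 : 0 < R := by positivity
  have hRl : A0 ^ m * c1 * R ^ l = A0 ^ q := by
    rw [hR, ← Real.rpow_mul (by positivity), one_div_mul_cancel hl0.ne', Real.rpow_one]
    field_simp
  set M := A0 * R ^ a with hM
  have hM0 : 0 < M := by positivity
  refine ⟨M, hM0, fun u0 hu0 hu0a hu0M u hu => ?_⟩
  set w : ℝ × EuclideanSpace ℝ (Fin N) → ℝ := fun z => if 0 < z.1 then u z.1 z.2 else 0 with hw
  have hw0 : ∀ z, 0 ≤ w z := fun z => by rw [hw]; dsimp only; split_ifs; exacts [hu.2.1 _ _, le_rfl]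
  have hu00 := hu0.2.1
  -- Step 1
  have s1 : ∀ᵐ z, w z ≤ M := by
    have := weak_comp N m q σ hm hq0 hσ0 u0 hu0 u hu w hw (fun _ => M ^ m) contDiff_const (fun _ => by positivity)
      (fun i => by simp) (fun i => by simp [locallyIntegrable_zero])
      ⟨1, one_pos, by
        filter_upwards [hu0M] with x hx t _ _
        exact Real.rpow_le_rpow (hu00 x) hx hmp.le⟩
      (Filter.Eventually.of_forall fun z => by
        have h1 : 0 ≤ ‖z.2‖ ^ σ * w z ^ q := mul_nonneg (by positivity) (Real.rpow_nonneg (hw0 z) _)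
        have h2 : 0 ≤ ‖z.2‖ ^ σ * w z ^ q * max (w z ^ m - M ^ m) 0 ^ 2 := by positivity
        simp
        linarith)
    filter_upwards [this] with z hz
    exact (Real.rpow_le_rpow_iff (hw0 z) hM0.le hmp).1 hz
  -- Step 2
  have epw : ∀ x : EuclideanSpace ℝ (Fin N), (A0 * ‖x‖ ^ a) ^ m = A0 ^ m * ‖x‖ ^ b := fun x => by
    rw [Real.mul_rpow hA0.le (by positivity), ← Real.rpow_mul (norm_nonneg _)]
  have s2 : ∀ᵐ z, w z ≤ A0 * ‖z.2‖ ^ a := by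
    obtain ⟨n1, n2, n3⟩ := npow_data N b hb2
    have hd1 : Differentiable ℝ (fun x : EuclideanSpace ℝ (Fin N) => ‖x‖ ^ b) := n1.differentiable (by norm_num)
    have hd0 : Differentiable ℝ (fun _ : ℝ => A0 ^ m) := differentiable_const _
    have p2 := fun i : Fin N => prodf2 (fun _ : ℝ => A0 ^ m) (fun x : EuclideanSpace ℝ (Fin N) => ‖x‖ ^ b) (EuclideanSpace.single i 1) hd0 hd1 (n2 i)
    have p1 := prodf (fun _ : ℝ => A0 ^ m) (fun x : EuclideanSpace ℝ (Fin N) => ‖x‖ ^ b) hd0 hd1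
    have := weak_comp N m q σ hm hq0 hσ0 u0 hu0 u hu w hw (fun z => A0 ^ m * ‖z.2‖ ^ b)
      (contDiff_const.mul (n1.comp contDiff_snd)) (fun _ => by positivity)
      (fun i => (p2 i).1) (fun i => by
        simp_rw [(p2 i).2, n3]
        exact npow_loc N b (A0 ^ m) hb2 i)
      ⟨1, one_pos, by
        filter_upwards [hu0a] with x hx t _ _
        rw [← epw]
        exact Real.rpow_le_rpow (hu00 x) hx hmp.le⟩
      (by
        filter_upwards [s1] with z hz
        simp_rw [fun i => (p2 i).2, n3]
        rw [← Finset.mul_sum, npow_lap N b hb2, p1]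
        simp only [deriv_const, mul_zero, zero_mul, map_zero, add_zero]
        rcases le_or_gt (w z ^ m) (A0 ^ m * ‖z.2‖ ^ b) with h | h
        · rw [max_eq_right (by linarith)]; simp
        refine mul_nonpos_of_nonpos_of_nonneg (sub_nonpos.2 ?_) (by positivity)
        rw [← epw] at h
        have h1 : A0 * ‖z.2‖ ^ a < w z := (Real.rpow_lt_rpow_iff (by positivity) (hw0 z) hmp).1 h
        have h2 : ‖z.2‖ ≤ R := by
          have h3 : A0 * ‖z.2‖ ^ a ≤ A0 * R ^ a := by linarith
          have h4 := le_of_mul_le_mul_left h3 hA0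
          exact (Real.rpow_le_rpow_iff (norm_nonneg _) hR0.le ha0).1 h4
        rcases (norm_nonneg z.2).eq_or_lt with h0 | h0
        · rw [← h0, Real.zero_rpow (by linarith : b - 2 ≠ 0), Real.zero_rpow hσ0.ne']; simp
        · have e1 : ‖z.2‖ ^ (b - 2) = ‖z.2‖ ^ l * (‖z.2‖ ^ σ * ‖z.2‖ ^ (a * q)) := by
            rw [← Real.rpow_add h0, ← Real.rpow_add h0]; congr 1; rw [hl, hb]; ring
          have h3 : (A0 * ‖z.2‖ ^ a) ^ q ≤ w z ^ q := Real.rpow_le_rpow (by positivity) h1.le hq0.le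
          rw [Real.mul_rpow hA0.le (by positivity), ← Real.rpow_mul (norm_nonneg _)] at h3
          calc A0 ^ m * (b * (b + N - 2) * ‖z.2‖ ^ (b - 2)) = A0 ^ m * c1 * ‖z.2‖ ^ l * (‖z.2‖ ^ σ * ‖z.2‖ ^ (a * q)) := by
                rw [e1]; ring
            _ ≤ A0 ^ m * c1 * R ^ l * (‖z.2‖ ^ σ * ‖z.2‖ ^ (a * q)) := by gcongr
            _ = ‖z.2‖ ^ σ * (A0 ^ q * ‖z.2‖ ^ (a * q)) := by rw [hRl]; ring
            _ ≤ _ := by gcongr)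
    filter_upwards [this] with z hz
    rw [← epw] at hz
    exact (Real.rpow_le_rpow_iff (hw0 z) (by positivity) hmp).1 hz
  -- Step 3
  set p := q + σ / a with hp
  have hp1 : 0 < 1 - p := by
    have : σ / a < 1 - q := by rw [div_lt_iff₀ ha0]; linarith
    rw [hp]; linarith
  have hp0 : 0 < p := by positivity
  set c := A0 ^ (-(σ / a)) with hc
  have hc0 : 0 < c := by positivity
  set κ := c * (1 - p) with hκ
  have hκ0 : 0 < κ := by positivity
  set r := m / (1 - p) with hr
  have hr1 : 1 < r := by rw [hr, lt_div_iff₀ hp1]; linarith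
  set Te := 2 * M ^ (1 - p) / κ with hTe
  have hTe0 : 0 < Te := by positivity
  set Y : ℝ → ℝ := fun t => max (κ * (Te - t)) 0 ^ r with hY
  have hYc : ContDiff ℝ 1 Y := (posr_contDiff r hr1).comp (f := fun t : ℝ => κ * (Te - t)) (by fun_prop)
  have hYd : ∀ t, deriv Y t = - (c * m * max (κ * (Te - t)) 0 ^ (r - 1)) := by
    intro t
    have h1 : HasDerivAt (fun t : ℝ => κ * (Te - t)) (κ * (-1)) t := ((hasDerivAt_id' t).const_sub Te).const_mul κ
    have h3 := (posr_hasDerivAt r (κ * (Te - t)) hr1).comp t h1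
    have h2 : HasDerivAt Y _ t := h3
    rw [h2.deriv, hκ, hr]
    field_simp
  have s3 : ∀ᵐ z, w z ^ m ≤ Y z.1 * 1 := by
    have hd0 : Differentiable ℝ Y := hYc.differentiable (by norm_num)
    have hd1 : Differentiable ℝ (fun _ : EuclideanSpace ℝ (Fin N) => (1 : ℝ)) := differentiable_const _
    have hd2 : ∀ b, Differentiable ℝ (fun x => fderiv ℝ (fun _ : EuclideanSpace ℝ (Fin N) => (1 : ℝ)) x b) := fun b => by simp
    have p2 := fun i : Fin N => prodf2 Y (fun _ : EuclideanSpace ℝ (Fin N) => (1 : ℝ)) (EuclideanSpace.single i 1) hd0 hd1 (hd2 _)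
    have p1 := prodf Y (fun _ : EuclideanSpace ℝ (Fin N) => (1 : ℝ)) hd0 hd1
    refine weak_comp N m q σ hm hq0 hσ0 u0 hu0 u hu w hw (fun z => Y z.1 * 1)
      ((hYc.comp contDiff_fst).mul contDiff_const) (fun z => by simp only [hY]; positivity)
      (fun i => (p2 i).1) (fun i => by
        simp_rw [(p2 i).2]
        simp [locallyIntegrable_zero]) ⟨Te / 2, by positivity, ?_⟩ ?_
    · filter_upwards [hu0M] with x hx t ht0 ht
      have h1 : M ^ (1 - p) ≤ max (κ * (Te - t)) 0 := by
        refine le_max_of_le_left ?_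
        have : κ * (Te / 2) = M ^ (1 - p) := by rw [hTe]; field_simp
        rw [← this]
        have : Te / 2 ≤ Te - t := by linarith
        gcongr
      have h2 : (M ^ (1 - p)) ^ r ≤ max (κ * (Te - t)) 0 ^ r := Real.rpow_le_rpow (by positivity) h1 (by linarith)
      rw [← Real.rpow_mul hM0.le, hr, mul_div_cancel₀ _ hp1.ne'] at h2
      simp only [hY, mul_one]
      exact (Real.rpow_le_rpow (hu00 x) hx hmp.le).trans h2
    · filter_upwards [s2] with z hz
      simp_rw [fun i => (p2 i).2]
      rw [p1, hYd]
      simp only [mul_one, one_mul, mul_zero]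
      set s := max (κ * (Te - z.1)) 0 with hs
      have hs0 : 0 ≤ s := le_max_right _ _
      have hYs : Y z.1 = s ^ r := rfl
      rw [hYs]
      set y := s ^ (1 / (1 - p)) with hy
      have hy0 : 0 ≤ y := by positivity
      have e1 : s ^ r = y ^ m := by
        rw [hy, ← Real.rpow_mul hs0, hr]; congr 1; ring
      have e2 : s ^ (r - 1) = y ^ (m - 1) * y ^ p := by
        rw [← Real.rpow_add_of_nonneg hy0 hm0.le hp0.le, hy, ← Real.rpow_mul hs0, hr]
        congr 1
        field_simp
        ring
      rw [e1, e2]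
      simp only [fderiv_fun_const, Pi.zero_apply, _root_.zero_apply, mul_zero, Finset.sum_const_zero, zero_sub, add_zero]
      rcases le_or_gt (w z ^ m) (y ^ m) with h | h
      · rw [KK_eq_zero m hm (w z) _ (hw0 z) h, max_eq_right (by linarith)]; simp
      have hyw : y < w z := (Real.rpow_lt_rpow_iff hy0 (hw0 z) hmp).1 h
      have hwp : 0 < w z := lt_of_le_of_lt hy0 hyw
      have hf : c * w z ^ p ≤ ‖z.2‖ ^ σ * w z ^ q := by
        have h1 : w z ^ (σ / a) ≤ (A0 * ‖z.2‖ ^ a) ^ (σ / a) := Real.rpow_le_rpow hwp.le hz (by positivity)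
        rw [Real.mul_rpow hA0.le (by positivity), ← Real.rpow_mul (norm_nonneg _), mul_div_cancel₀ _ ha0.ne'] at h1
        have h2 : c * A0 ^ (σ / a) = 1 := by
          rw [hc, ← Real.rpow_add hA0]; simp
        calc c * w z ^ p = c * w z ^ (σ / a) * w z ^ q := by rw [hp, Real.rpow_add hwp]; ring
          _ ≤ c * (A0 ^ (σ / a) * ‖z.2‖ ^ σ) * w z ^ q := by gcongr
          _ = (c * A0 ^ (σ / a)) * ‖z.2‖ ^ σ * w z ^ q := by ring
          _ = _ := by rw [h2]; ring
      have hK := KK_H m hm (w z) y hwp.le hy0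
      have hK0 := KK_nonneg m (w z) (y ^ m) hwp.le
      set H := max (w z ^ m - y ^ m) 0 ^ 2
      have hH : 0 ≤ H := by positivity
      have hyp : y ^ p ≤ w z ^ p := Real.rpow_le_rpow hy0 hyw.le hp0.le
      have : c * m * (y ^ (m - 1) * y ^ p) * KK m (w z) (y ^ m) ≤ ‖z.2‖ ^ σ * w z ^ q * H := by
        calc _ = c * y ^ p * (m * y ^ (m - 1) * KK m (w z) (y ^ m)) := by ring
          _ ≤ c * y ^ p * H := by gcongr
          _ ≤ c * w z ^ p * H := by gcongr
          _ ≤ _ := by gcongr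
      linarith
  refine ⟨Te, hTe0, ?_⟩
  rw [Measure.volume_eq_prod] at s3
  filter_upwards [Measure.ae_ae_of_ae_prod s3] with t ht htT
  filter_upwards [ht] with x hx
  have h0 : Y t = 0 := by
    simp only [hY]
    rw [max_eq_right (mul_nonpos_of_nonneg_of_nonpos hκ0.le (by linarith)), Real.zero_rpow (by linarith)]
  have hwu : w (t, x) = u t x := by
    have : 0 < t := by linarith
    simp [hw, this]
  rw [hwu, h0, zero_mul] at hx
  by_contra hne
  have hpos : 0 < u t x := lt_of_le_of_ne (hu.2.1 t x) (Ne.symm hne)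
  have := Real.rpow_pos_of_pos hpos m
  linarith
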